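/- Every ε > 1/5 has the finite rotation property; that is, for every ε > 1/5 there exist finitely many unit vectors u_0, …, u_n ∈ ℝ² such that for every x ∈ ℝ² there is an index j with ‖⟨u_j, x⟩‖ ≤ ε. (Equivalently, ε_0 ≤ 1/5, where ε_0 is the infimum of all ε with the finite rotation property.) -/

import Mathlib

/-- Distance from a real number to the nearest integer. -/
noncomputable def intDist (t : ℝ) : ℝ := |t - round t|

/-- Standard inner product on ℝ². -/
def dot2 (u x : ℝ × ℝ) : ℝ := u.1 * x.1 + u.2 * x.2

/-- `ε` has the finite rotation property if there are finitely many unit vectors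
`u 0, …, u n` such that every point of the plane is within distance `ε` (mod 1)
of the lattice of strips in some direction `u j`. -/
def HasFiniteRotationProperty (ε : ℝ) : Prop :=
  ∃ n : ℕ, ∃ u : Fin (n + 1) → ℝ × ℝ,
    (∀ j, (u j).1 ^ 2 + (u j).2 ^ 2 = 1) ∧
      ∀ x : ℝ × ℝ, ∃ j, intDist (dot2 (u j) x) ≤ ε

/-! The vectors used here are the unit vectors `a + b ω + c p + d ω p` of `ℂ = ℝ²`, where `ω` is a
primitive sixth root of unity and `p = (√69 - 5 √-3) / 12`; a vector is recorded by the integers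
`468 a`, `468 b`, `468 c`, `468 d`. A linear functional on the plane whose values at these vectors
all had distance more than `1/5` from the integers is excluded by a finite case distinction on
integer parts, in which every case is closed by a nonnegative combination of linear inequalities.
-/

namespace FiniteRotation

/-- Coordinates, multiplied by `468`, with respect to `1`, `ω`, `p`, `ω p`. -/
abbrev Coord := ℤ × ℤ × ℤ × ℤ

/-- Multiplication by `ω`. -/
def rotate (a : Coord) : Coord :=
  (-a.2.1, a.1 + a.2.1, -a.2.2.2, a.2.2.1 + a.2.2.2)

/-- The reflection fixing `1` and sending `p` to `-p`. -/
def reflect (a : Coord) : Coord :=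
  (a.1 + a.2.1, -a.2.1, -a.2.2.1 - a.2.2.2, a.2.2.2)

def negate (a : Coord) : Coord := (-a.1, -a.2.1, -a.2.2.1, -a.2.2.2)

def baseVectors : List Coord := [
  ⟨468, 0, 0, 0⟩, ⟨0, 0, 468, 0⟩, ⟨-780, 390, 0, 468⟩,
  ⟨-240, 60, -192, 672⟩, ⟨480, -672, -540, -180⟩, ⟨624, 0, 156, -312⟩,
  ⟨624, 0, 364, -728⟩, ⟨60, -240, -672, 192⟩, ⟨-192, 672, 720, -180⟩,
  ⟨216, 540, 576, -432⟩, ⟨468, 0, 390, -780⟩, ⟨234, 0, -156, 312⟩,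
  ⟨-84, 24, -144, 576⟩, ⟨576, -432, -216, -540⟩, ⟨24, -84, -576, 144⟩,
  ⟨-39, 0, -286, 572⟩, ⟨312, -156, 0, 234⟩, ⟨540, -720, -480, -192⟩,
  ⟨-676, 676, 286, 286⟩, ⟨0, -286, -728, 364⟩, ⟨-378, 108, -180, 720⟩,
  ⟨540, 180, 480, -672⟩, ⟨-378, 504, 540, 216⟩, ⟨576, -144, 216, -756⟩,
  ⟨-312, 156, 0, 624⟩, ⟨0, -507, -780, 390⟩, ⟨-364, -364, -624, 624⟩,
  ⟨540, 216, 432, -576⟩, ⟨-378, -126, -540, 756⟩, ⟨-270, -108, -540, 720⟩,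
  ⟨-351, 702, 234, 0⟩]

def vectors : List Coord := baseVectors.flatMap fun a ↦ [a, rotate a, rotate (rotate a)]

def vector (j : ℕ) : Coord := vectors.getD j (468, 0, 0, 0)

/-- `(a, k, s)` stands for the inequality `0 ≤ ⟨a, y⟩ + k - s ε`. -/
abbrev Inequality := Coord × ℤ × ℤ

def lowerBound (j : ℕ) (v : ℤ) : Inequality := (vector j, v, 468)

def upperBound (j : ℕ) (v : ℤ) : Inequality := (negate (vector j), 468 - v, 468)

def addMul (m : ℤ) (p q : Inequality) : Inequality :=
  ((m * p.1.1 + q.1.1, m * p.1.2.1 + q.1.2.1, m * p.1.2.2.1 + q.1.2.2.1,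
    m * p.1.2.2.2 + q.1.2.2.2), m * p.2.1 + q.2.1, m * p.2.2 + q.2.2)

def combine (ctx : List Inequality) : List (ℕ × ℕ) → Inequality
  | [] => ((0, 0, 0, 0), 0, 0)
  | (i, m) :: l => addMul m (ctx.getD i ((0, 0, 0, 0), 0, 0)) (combine ctx l)

/-- The combination `l` of the inequalities in `ctx` cannot hold when `ε > 1/5`. -/
def Refutes (ctx : List Inequality) (l : List (ℕ × ℕ)) : Prop :=
  (combine ctx l).1 = (0, 0, 0, 0) ∧ 0 < (combine ctx l).2.2 ∧
    5 * (combine ctx l).2.1 ≤ (combine ctx l).2.2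

instance (ctx : List Inequality) (l : List (ℕ × ℕ)) : Decidable (Refutes ctx l) :=
  inferInstanceAs (Decidable (_ ∧ _ ∧ _))

/-- The sum of integer multiples of vectors, together with that of their integer parts. -/
def relationSum (env : List (ℕ × ℤ)) : List (ℕ × ℤ) → Coord × ℤ
  | [] => ((0, 0, 0, 0), 0)
  | (i, m) :: l =>
    let e := env.getD i (0, 0)
    let a := vector e.1
    let r := relationSum env l
    ((m * a.1 + r.1.1, m * a.2.1 + r.1.2.1, m * a.2.2.1 + r.1.2.2.1, m * a.2.2.2 + r.1.2.2.2),
      m * e.2 + r.2)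

/-- `branch j t l v c r` considers the integer part belonging to the vector with index `j`.
The relation `l` shows that it is congruent to `v` modulo `468 / t`, the combination `c` shows
that it is at least `v`. The admissible values are then treated in turn by the `child` nodes
of `r`, until `done` shows that there are no further ones. -/
inductive ContradictionTree where
  | branch (j : ℕ) (t : ℤ) (l : List (ℕ × ℤ)) (v : ℤ) (c : List (ℕ × ℕ))
      (r : ContradictionTree)
  | child (sub r : ContradictionTree)
  | done (c : List (ℕ × ℕ))

/-- Validity of a tree, where `ctx` lists the available inequalities, `env` the known integer
parts, and the integer part belonging to `j` is one of `v`, `v + S`, `v + 2 S`, …. -/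
def ContradictionTree.check : ContradictionTree → List Inequality → List (ℕ × ℤ) →
    ℕ → ℤ → ℤ → Bool
  | .branch j t l v c r, ctx, env, _, _, _ =>
    let a := vector j
    let s := relationSum env l
    decide (0 < t ∧ t * (468 / t) = 468 ∧
      (t * a.1, t * a.2.1, t * a.2.2.1, t * a.2.2.2) = s.1 ∧ (t * v - s.2) % 468 = 0 ∧
        Refutes (lowerBound j (v - 468 / t) :: ctx) c) &&
    r.check ctx env j (468 / t) v
  | .child sub r, ctx, env, j, S, v =>
    sub.check (lowerBound j v :: upperBound j v :: ctx) ((j, v) :: env) 0 0 0 &&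
    r.check ctx env j S (v + S)
  | .done c, ctx, _, j, _, v => decide (Refutes (upperBound j v :: ctx) c)

def contradictionTree1 : ContradictionTree :=
  .branch 50 2 [(1, 2), (6, 1), (14, -1)] 78 [(0, 2), (27, 312), (32, 1)] (.child (.branch 49 1
  [(0, 1), (8, 1)] 156 [(0, 2), (14, 1), (28, 702), (29, 702)] (.child (.branch 33 3 [(8, -1),
  (11, 1), (12, -1), (14, 5), (15, -3), (16, -2), (17, 1)] 0 [(0, 135), (2, 128), (11, 54), (16,
  71), (30, 19656)] (.child (.branch 31 1 [(0, 1), (9, -1), (10, -1), (15, 1), (16, -1), (17, 1),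
  (18, -1)] 234 [(0, 27), (8, 2), (13, 27), (29, 1), (32, 351)] (.done [(0, 54), (4, 2), (18, 44),
  (32, 8424), (38, 45)])) (.child (.branch 30 1 [(0, -1), (2, -1), (9, -1), (15, 2), (16, -1),
  (17, -1), (18, -1)] 546 [(0, 78), (12, 72), (13, 72), (29, 10), (38, 5)] (.child (.branch 18 3
  [(1, -1), (10, -1), (13, 1), (14, -1), (16, 8), (17, -3), (18, 1), (19, -5)] 260 [(0, 15), (2,
  14), (34, 1872), (35, 936)] (.child (.branch 45 1 [(0, -1), (2, 1), (7, -1), (9, -1), (14, -1),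
  (17, -1), (18, 1), (20, -1)] 130 [(0, 14), (1, 11), (36, 4212), (37, 2106)] (.child (.branch 19
  3 [(3, 1), (12, -1), (15, 1), (16, -1), (18, 3), (19, 1), (20, 4), (21, -4)] (-104) [(0, 2673),
  (10, 522), (16, 232), (19, 2808), (44, 377)] (.child (.branch 47 1 [(0, -1), (2, 1), (4, 1), (9,
  -1), (12, -1), (13, -1), (16, -1), (19, -2), (20, -1), (21, -2)] 637 [(0, 90), (8, 36), (16,
  10), (42, 21), (46, 80)] (.done [(0, 393), (4, 201), (21, 429), (26, 352), (40, 64896)]))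
  (.child (.branch 74 1 [(0, 1), (2, 1), (4, -1), (13, -1), (16, 1), (17, -1), (19, 3), (20, -5),
  (21, -5), (22, 2)] 624 [(0, 57), (20, 18), (26, 15), (40, 2808), (46, 46)] (.child (.branch 54 3
  [(7, -1), (15, -1), (17, -1), (18, -1), (20, -4), (21, 6), (22, 2), (23, 2)] (-208) [(0, 7722),
  (4, 5853), (7, 3453), (20, 4400), (28, 3900)] (.child (.branch 58 1 [(0, 2), (11, 2), (18, -1)]
  754 [(0, 225), (4, 195), (12, 108), (20, 10), (46, 28)] (.child (.branch 57 3 [(15, -1), (16,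
  -1), (19, -1), (20, -1), (23, -3), (24, -6), (25, 3)] 234 [(0, 351), (6, 228), (10, 162), (32,
  75), (52, 68)] (.child (.branch 78 1 [(0, -1), (2, 1), (10, -1), (16, -1), (17, -1), (18, -1),
  (23, 1), (24, -5), (25, -6), (26, 3)] 572 [(0, 3324), (4, 81), (12, 1188), (34, 3043), (54,
  600)] (.done [(0, 609), (4, 348), (10, 351), (29, 322), (48, 61074)])) (.child (.branch 79 1
  [(0, 1), (2, -1), (10, -1), (16, -1), (17, -1), (18, -1), (20, 1), (23, 1), (24, -3), (25, -2),
  (26, 1)] 988 [(0, 42), (4, 36), (24, 6), (34, 25), (48, 8424)] (.done [(0, 7), (10, 8), (13, 4),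
  (49, 52)])) (.done [(0, 159), (2, 18), (22, 84), (27, 182), (46, 12168)])))) (.done [(0, 1992),
  (9, 1971), (17, 98), (25, 1820), (44, 322452)]))) (.child (.branch 57 3 [(14, -1), (15, -1),
  (18, -1), (19, -1), (22, -3), (23, -6), (24, 3)] 234 [(0, 351), (4, 228), (8, 162), (30, 75),
  (50, 68)] (.child (.branch 80 1 [(0, -1), (1, 1), (9, -1), (15, -1), (16, -1), (17, -1), (20,
  1), (22, 2), (23, -5), (24, -5), (25, 1)] 416 [(0, 15), (14, 8), (26, 8), (46, 1612), (47, 104)]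
  (.child (.branch 21 13 [(20, 1), (23, 3), (24, -8), (25, -19), (26, 5)] 276 [(0, 78), (1, 3),
  (34, 28), (48, 8892), (54, 84)] (.child (.branch 29 1 [(0, 3), (24, -2), (25, 2), (26, 4)] 360
  [(0, 65), (3, 54), (26, 16), (52, 9), (56, 12)] (.done [(0, 65), (10, 3), (18, 48), (50, 13104),
  (56, 16)])) (.child (.branch 22 1 [(0, 4), (21, -1), (22, -1), (25, 3), (26, 6), (27, -3)] 780
  [(0, 1287), (10, 225), (18, 930), (26, 460), (56, 773)] (.done [(0, 1352), (3, 1239), (5, 372),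
  (26, 48), (50, 297180)])) (.child (.branch 12 1 [(0, -5), (22, -1), (24, 3), (25, -4), (26, -8),
  (27, 1)] 912 [(0, 1222), (10, 1095), (18, 504), (26, 740), (50, 219804)] (.done [(0, 3016), (3,
  2175), (12, 1620), (31, 576), (50, 67860)])) (.child (.branch 29 1 [(0, 3), (24, -2), (25, 2),
  (26, 4)] 216 [(0, 26), (3, 18), (36, 8), (51, 1092), (52, 5)] (.done [(0, 65), (10, 3), (18,
  48), (50, 13104), (56, 16)])) (.child (.branch 29 1 [(0, 3), (24, -2), (25, 2), (26, 4)] 324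
  [(0, 65), (3, 54), (26, 16), (52, 9), (56, 12)] (.done [(0, 65), (10, 3), (18, 48), (50, 13104),
  (56, 16)])) (.child (.branch 12 1 [(0, -5), (22, -1), (24, 3), (25, -4), (26, -8), (27, 1)] 840
  [(0, 1118), (10, 345), (26, 400), (30, 756), (50, 119964)] (.done [(0, 3016), (3, 2175), (12,
  1620), (31, 576), (50, 67860)])) (.child (.branch 27 1 [(0, 1), (21, -1), (24, -1), (25, 3),
  (26, 3), (27, -1)] 180 [(0, 455), (12, 300), (18, 112), (50, 50076), (51, 54288)] (.done [(0,
  26), (10, 6), (26, 6), (36, 21), (50, 1872)])) (.child (.branch 12 1 [(0, -5), (22, -1), (24,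
  3), (25, -4), (26, -8), (27, 1)] 948 [(0, 1222), (10, 1095), (18, 504), (26, 740), (50, 219804)]
  (.done [(0, 3016), (3, 2175), (12, 1620), (31, 576), (50, 67860)])) (.done [(0, 2704), (1, 561),
  (3, 2604), (24, 336), (48, 182052)])))))))))) (.done [(0, 1351), (1, 200), (4, 728), (11, 972),
  (46, 57564)]))) (.child (.branch 78 1 [(0, -1), (1, 1), (9, -1), (15, -1), (16, -1), (17, -1),
  (22, 1), (23, -5), (24, -6), (25, 3)] 572 [(0, 321), (10, 108), (32, 296), (46, 1404), (52, 66)]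
  (.done [(0, 198), (8, 138), (14, 94), (46, 14040), (52, 29)])) (.done [(0, 1455), (12, 144),
  (20, 720), (25, 1502), (44, 92664)])))) (.done [(0, 5076), (2, 2883), (10, 2832), (18, 3236),
  (42, 1396044)])))) (.done [(0, 996), (5, 495), (13, 346), (21, 924), (40, 49764)]))) (.done [(0,
  342), (18, 78), (24, 331), (38, 44772), (44, 136)])))) (.done [(0, 60), (4, 44), (38, 39)])))
  (.child (.branch 19 3 [(2, 1), (11, -1), (14, 1), (15, -1), (17, 3), (18, 1), (19, 4), (20, -4)]
  (-104) [(0, 2673), (8, 522), (14, 232), (17, 2808), (42, 377)] (.child (.branch 47 1 [(0, -1),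
  (1, 1), (3, 1), (8, -1), (11, -1), (12, -1), (15, -1), (18, -2), (19, -1), (20, -2)] 325 [(0,
  45), (18, 33), (39, 7488), (40, 16)] (.child (.branch 20 1 [(1, 1), (2, -1)] (-52) [(0, 16), (1,
  13), (16, 9), (18, 18)] (.child (.branch 74 1 [(2, 1), (3, 1), (5, -1), (14, -1), (17, 1), (18,
  -1), (20, 3), (21, -5), (22, -5), (23, 2)] 624 [(0, 57), (22, 18), (28, 15), (42, 2808), (48,
  46)] (.child (.branch 54 3 [(8, -1), (16, -1), (18, -1), (19, -1), (21, -4), (22, 6), (23, 2),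
  (24, 2)] (-208) [(0, 126), (4, 99), (45, 11700), (46, 25)] (.child (.branch 58 1 [(0, 2), (12,
  2), (19, -1)] 754 [(0, 225), (4, 195), (14, 108), (22, 10), (48, 28)] (.done [(0, 2103), (6,
  1908), (22, 910), (27, 364), (46, 454272)])) (.child (.branch 57 3 [(15, -1), (16, -1), (19,
  -1), (20, -1), (23, -3), (24, -6), (25, 3)] 234 [(0, 81), (18, 26), (32, 50), (46, 7722), (52,
  63)] (.child (.branch 21 13 [(20, 1), (23, 3), (24, -8), (25, -19), (26, 5)] 276 [(0, 2301), (8,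
  90), (34, 874), (48, 267540), (54, 2500)] (.child (.branch 29 1 [(0, 3), (24, -2), (25, 2), (26,
  4)] 360 [(0, 416), (10, 324), (26, 70), (36, 225), (56, 120)] (.done [(0, 65), (8, 3), (18, 48),
  (50, 13104), (56, 16)])) (.child (.branch 22 1 [(0, 4), (21, -1), (22, -1), (25, 3), (26, 6),
  (27, -3)] 780 [(0, 1287), (8, 225), (18, 930), (26, 460), (56, 773)] (.done [(0, 39), (10, 36),
  (26, 8), (36, 8), (50, 9516)])) (.child (.branch 12 1 [(0, -5), (22, -1), (24, 3), (25, -4),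
  (26, -8), (27, 1)] 912 [(0, 1222), (8, 1095), (18, 504), (26, 740), (50, 219804)] (.done [(0,
  91), (10, 75), (31, 28), (50, 2132), (51, 1144)])) (.child (.branch 29 1 [(0, 3), (24, -2), (25,
  2), (26, 4)] 216 [(0, 182), (10, 108), (36, 140), (51, 13260), (52, 5)] (.done [(0, 65), (8, 3),
  (18, 48), (50, 13104), (56, 16)])) (.child (.branch 29 1 [(0, 3), (24, -2), (25, 2), (26, 4)]
  324 [(0, 416), (10, 324), (26, 70), (36, 225), (56, 120)] (.done [(0, 65), (8, 3), (18, 48),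
  (50, 13104), (56, 16)])) (.child (.branch 12 1 [(0, -5), (22, -1), (24, 3), (25, -4), (26, -8),
  (27, 1)] 840 [(0, 1118), (8, 345), (26, 400), (30, 756), (50, 119964)] (.done [(0, 1963), (10,
  1665), (31, 648), (50, 48360), (56, 110)])) (.child (.branch 27 1 [(0, 1), (21, -1), (24, -1),
  (25, 3), (26, 3), (27, -1)] 180 [(0, 65), (18, 16), (31, 40), (50, 9308), (51, 12064)] (.done
  [(0, 26), (8, 6), (26, 6), (36, 21), (50, 1872)])) (.child (.branch 12 1 [(0, -5), (22, -1),
  (24, 3), (25, -4), (26, -8), (27, 1)] 948 [(0, 1222), (8, 1095), (18, 504), (26, 740), (50,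
  219804)] (.done [(0, 91), (10, 75), (31, 28), (50, 2132), (51, 1144)])) (.done [(0, 15379), (1,
  13548), (8, 3366), (24, 3220), (48, 1153932)])))))))))) (.child (.branch 78 1 [(0, -1), (1, 1),
  (10, -1), (16, -1), (17, -1), (18, -1), (23, 1), (24, -5), (25, -6), (26, 3)] 572 [(0, 9), (20,
  4), (34, 10)] (.done [(0, 15), (16, 8), (29, 8), (48, 1612), (49, 1508)])) (.done [(0, 1455),
  (14, 144), (22, 720), (27, 1502), (46, 92664)])))) (.done [(0, 5076), (2, 2883), (12, 2832),
  (20, 3236), (44, 1396044)])))) (.done [(0, 1053), (2, 223), (3, 644), (23, 324), (39, 297)])))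
  (.done [(0, 15), (20, 14), (39, 2262)]))) (.done [(0, 96), (8, 67), (19, 114), (24, 109), (38,
  11544)]))) (.child (.branch 47 1 [(0, -1), (1, 1), (3, 1), (8, -1), (11, -1), (12, -1), (15,
  -1), (18, -2), (19, -1), (20, -2)] 637 [(0, 90), (6, 36), (14, 10), (40, 21), (44, 80)] (.done
  [(0, 78), (2, 114), (8, 20), (24, 123), (38, 20124)])) (.done [(0, 342), (16, 78), (22, 331),
  (36, 44772), (42, 136)])))) (.done [(0, 492), (4, 293), (12, 270), (15, 180), (20, 720)]))))
  (.done [(0, 22), (2, 1), (18, 18), (33, 3510), (41, 18)]))) (.done [(0, 6), (27, 4), (32, 3),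
  (36, 2)])))) (.done [(0, 18), (4, 8), (25, 13)]))) (.child (.branch 49 1 [(0, 1), (8, 1)] (-78)
  [(0, 2), (14, 1), (28, 702), (29, 702)] (.child (.branch 57 3 [(7, -1), (8, -1), (11, -1), (12,
  -1), (15, -3), (16, -6), (17, 3)] 390 [(0, 3), (4, 48), (6, 48), (11, 26), (30, 12168)] (.child
  (.branch 56 1 [(0, 1), (8, -1), (9, -1), (10, -1), (12, 1), (15, 2), (16, -5), (17, -2), (18,
  1)] 858 [(0, 174), (8, 221), (12, 5), (32, 37518), (38, 98)] (.done [(0, 15), (13, 11), (32,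
  1521), (33, 3042)])) (.done [(0, 195), (1, 48), (6, 48), (11, 182), (30, 12168)]))) (.done [(0,
  18), (4, 8), (25, 13)]))) (.done [(0, 90), (2, 92), (7, 54), (23, 1), (26, 23166)])))

def contradictionTree2 : ContradictionTree :=
  .branch 17 3 [(2, -4), (3, 4), (4, 1), (5, 1)] (-312) [(0, 3), (3, 1), (7, 936), (8, 2), (15,
  2)] (.child (.branch 50 2 [(0, 1), (1, -1), (3, 2), (5, -1), (6, -1)] 234 [(0, 2), (1, 2), (3,
  1), (9, 936)] (.child (.branch 49 2 [(1, -1), (2, 1), (4, -2), (5, 2), (6, -1), (7, 2)] 0 [(0,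
  4), (3, 3), (11, 1248), (16, 1), (19, 3)] (.child (.branch 48 1 [(0, 1), (1, -1)] 234 [(0, 2),
  (12, 312), (21, 1)] (.child (.branch 6 2 [(3, -1), (4, 1), (6, -6), (7, 3), (9, 3)] (-234) [(0,
  4), (15, 780), (16, 5), (23, 4)] (.child (.branch 8 2 [(4, -1), (5, 1), (7, -1), (8, -2), (9,
  -2), (10, 1)] 702 [(0, 8), (9, 10), (11, 5), (22, 3)] (.child (.branch 77 2 [(0, -1), (5, 1),
  (6, 1), (8, 3), (9, -3), (11, -3)] 507 [(0, 8), (1, 2), (11, 13), (15, 9), (19, 3276)] (.child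
  (.branch 92 2 [(1, -1), (2, -1), (6, -1), (7, 1), (9, -5), (10, -1), (11, -2), (12, 3)] 468 [(0,
  24), (8, 2), (13, 13), (15, 23), (22, 6)] (.child (.branch 75 1 [(0, -1), (1, -1), (3, -1), (8,
  -1), (11, -1), (12, -1)] 507 [(0, 32), (3, 16), (15, 26), (17, 13), (28, 27)] (.child (.branch
  76 1 [(0, 1), (2, 1)] 1014 [(0, 8), (17, 20), (25, 4212), (26, 9)] (.child (.branch 30 3 [(8,
  -1), (9, -1), (10, 1), (13, 2), (14, 2), (15, -4)] 390 [(0, 39), (2, 37), (3, 35), (23, 5), (27,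
  507)] (.child (.branch 31 1 [(0, -1), (8, -1), (10, 1), (11, -1), (13, 4), (15, 2), (16, -3)] 78
  [(0, 78), (5, 72), (25, 10), (37, 5)] (.done [(0, 24), (1, 24), (4, 24), (29, 468), (30, 1)]))
  (.child (.branch 32 1 [(0, 1), (8, -1), (9, -1), (13, -2), (14, 2), (15, -1), (16, 3)] (-156)
  [(0, 6), (11, 5), (16, 10), (29, 234), (30, 8)] (.done [(0, 24), (4, 24), (29, 468), (30, 1)]))
  (.done [(0, 24), (2, 24), (14, 120), (27, 15444), (28, 97)])))) (.done [(0, 94), (1, 34), (7,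
  39), (19, 52), (33, 72)]))) (.done [(0, 6), (5, 5), (19, 5), (22, 1014), (23, 78)]))) (.done
  [(0, 18), (3, 9), (5, 13), (8, 8), (21, 2808)]))) (.done [(0, 4), (6, 6), (11, 3), (13, 7), (19,
  1404)]))) (.child (.branch 7 1 [(0, 1), (1, 1)] 702 [(0, 4), (2, 4), (6, 8), (19, 1404), (20,
  9)] (.done [(0, 9), (3, 5), (6, 10), (15, 9), (19, 3510)])) (.done [(0, 1), (13, 1), (17, 390),
  (25, 1)])))) (.child (.branch 75 2 [(0, -1), (4, -1), (7, -3), (9, -3), (10, 3)] 624 [(0, 4),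
  (2, 10), (9, 20), (17, 3276), (18, 3)] (.child (.branch 7 2 [(5, 1), (6, -1), (8, 1), (9, -3),
  (10, -2), (11, 1)] 468 [(0, 4), (4, 8), (11, 12), (19, 1404), (20, 3)] (.child (.branch 90 2
  [(0, -1), (2, -1), (9, -4), (10, 3), (12, 2)] (-234) [(0, 18), (6, 4), (8, 10), (17, 9), (21,
  6318)] (.child (.branch 92 1 [(0, -1), (1, -1), (2, -1), (3, -1), (7, -1), (8, -1), (10, -4),
  (11, 1), (12, -2), (13, 3)] 702 [(0, 84), (6, 10), (8, 59), (15, 76), (24, 66)] (.done [(0, 32),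
  (10, 36), (15, 27), (19, 25), (23, 16848)])) (.done [(0, 84), (4, 2), (6, 37), (13, 116), (22,
  30)]))) (.done [(0, 16), (6, 20), (11, 15), (15, 21), (19, 9360)]))) (.done [(0, 54), (2, 7),
  (4, 76), (13, 90), (17, 18252)]))) (.done [(0, 2), (7, 3), (11, 1), (14, 156), (15, 624)]))))
  (.done [(0, 2), (13, 156), (14, 1), (20, 1)]))) (.done [(0, 12), (3, 3), (7, 7), (12, 8), (19,
  2)]))) (.done [(0, 6), (1, 3), (5, 4), (10, 2), (17, 5)]))) (.child (.branch 16 1 [(0, 1), (1,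
  1)] 0 [(0, 3), (5, 2), (8, 624), (9, 1248), (17, 1)] (.child (.branch 48 2 [(1, 1), (2, -1), (4,
  4), (5, -2)] 78 [(0, 2), (10, 312), (19, 1)] (.child (.branch 8 2 [(2, -1), (3, 1), (5, -1), (6,
  -2), (7, -2), (8, 1)] 624 [(0, 2), (12, 1560), (14, 5), (18, 2)] (.child (.branch 7 2 [(3, 1),
  (4, -1), (6, 1), (7, -3), (8, -2), (9, 1)] 312 [(0, 2), (9, 3), (14, 780), (16, 1), (20, 1)]
  (.child (.branch 6 1 [(0, 1), (1, -1)] (-312) [(0, 16), (3, 5), (11, 15), (17, 1170), (25, 6)]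
  (.child (.branch 76 2 [(1, -1), (6, 1), (9, -3), (10, -3)] 858 [(0, 20), (1, 26), (13, 14), (20,
  3), (24, 12)] (.child (.branch 92 1 [(0, -1), (2, -1), (3, -1), (6, -1), (9, -1), (10, -3), (11,
  -3), (12, 1)] 702 [(0, 20), (3, 18), (15, 30), (22, 5), (29, 8)] (.done [(0, 4), (3, 1), (12,
  3), (20, 390), (21, 156)])) (.done [(0, 120), (5, 78), (15, 22), (20, 65), (27, 122)]))) (.child
  (.branch 75 2 [(1, -1), (2, -1), (5, 1), (6, 1), (9, -6), (10, -6), (11, 3)] 468 [(0, 8), (2,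
  11), (11, 13), (18, 234), (24, 9)] (.child (.branch 76 2 [(2, -1), (7, 1), (10, -3), (11, -3)]
  624 [(0, 16), (13, 13), (17, 9), (26, 18)] (.child (.branch 77 1 [(0, 1), (1, -1)] 624 [(0, 30),
  (7, 13), (19, 37), (22, 5070), (28, 25)] (.done [(0, 16), (6, 31), (15, 13), (22, 3978), (28,
  9)])) (.done [(0, 30), (4, 50), (5, 13), (17, 12), (20, 9360)]))) (.done [(0, 30), (2, 25), (3,
  26), (15, 24), (18, 4680)]))) (.done [(0, 1), (16, 390), (24, 1)])))) (.child (.branch 91 2 [(0,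
  -1), (1, -1), (7, -3), (8, -1), (9, -2), (10, 2)] 117 [(0, 18), (2, 13), (3, 5), (8, 12), (18,
  12)] (.child (.branch 75 1 [(0, -1), (2, -1), (6, 1), (8, -2), (9, -2), (10, -3), (11, 2)] 351
  [(0, 26), (4, 22), (11, 1), (18, 3978), (24, 21)] (.child (.branch 76 2 [(2, -1), (7, 1), (10,
  -3), (11, -3)] 507 [(0, 16), (13, 13), (17, 9), (26, 18)] (.child (.branch 77 1 [(0, 1), (1,
  -1)] 624 [(0, 4), (3, 2), (19, 5), (22, 1014), (28, 5)] (.done [(0, 76), (1, 74), (8, 65), (22,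
  12168), (28, 60)])) (.child (.branch 90 1 [(0, -1), (2, -1), (3, -1), (7, 1), (8, 1), (10, -2),
  (11, -1), (12, -2), (13, 1)] 0 [(0, 2), (9, 1), (23, 312)] (.child (.branch 92 1 [(0, -1), (3,
  1)] 585 [(0, 10), (10, 9), (21, 4)] (.child (contradictionTree1) (.done [(0, 5), (4, 1), (5, 2),
  (24, 1248), (25, 1248)]))) (.done [(0, 20), (8, 9), (15, 15), (19, 4), (21, 1170)]))) (.done
  [(0, 6), (1, 8), (6, 15), (12, 10), (20, 1404)])))) (.done [(0, 22), (5, 18), (10, 1), (15, 18),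
  (18, 3510)]))) (.done [(0, 2), (13, 1), (16, 702), (22, 1)]))) (.done [(0, 1), (11, 1), (14,
  390), (15, 390)])))) (.child (.branch 90 2 [(0, -1), (3, 1), (4, -1), (6, 2), (9, -1)] (-117)
  [(0, 2), (6, 2), (9, 1), (15, 78)] (.child (.branch 6 2 [(4, -1), (5, 1), (7, -6), (8, 3), (10,
  3)] (-312) [(0, 8), (8, 5), (11, 10), (25, 3)] (.child (.branch 7 1 [(0, 1), (2, 1)] 546 [(0,
  16), (6, 8), (13, 15), (24, 3), (27, 6)] (.child (.branch 77 1 [(1, -1), (2, -1), (6, 1), (10,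
  1), (11, 1), (12, -1)] 741 [(0, 76), (3, 80), (12, 50), (17, 30), (22, 51)] (.done [(0, 10), (2,
  15), (3, 1), (12, 10), (29, 6)])) (.done [(0, 16), (1, 5), (10, 15), (15, 6), (18, 1170)])))
  (.child (.branch 7 1 [(0, 1), (2, 1)] 312 [(0, 16), (6, 8), (13, 15), (16, 3), (27, 3)] (.child
  (.branch 77 1 [(1, -1), (2, -1), (6, 1), (10, 1), (11, 1), (12, -1)] 507 [(0, 30), (1, 26), (8,
  13), (17, 24), (26, 12)] (.child (.branch 92 2 [(2, -1), (4, -1), (7, -1), (8, 1), (10, -5),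
  (11, -1), (12, -2), (13, 3)] 468 [(0, 40), (10, 18), (17, 6), (24, 37), (31, 16)] (.child
  (.branch 75 1 [(0, -1), (4, -1), (5, -1), (9, 1), (11, -2), (12, -2), (13, -3), (14, 2)] 351
  [(0, 20), (3, 10), (12, 13), (30, 12)] (.child (.branch 91 1 [(1, 1), (5, 1)] (-117) [(0, 2),
  (10, 1), (27, 156), (28, 1)] (.child (.branch 50 2 [(6, 2), (7, 1), (15, -1)] 78 [(0, 2), (29,
  312), (34, 1)] (.child (.branch 49 1 [(0, 1), (9, 1)] 156 [(0, 20), (9, 6), (30, 5148), (31,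
  4134), (36, 5)] (.child (.branch 33 3 [(5, -2), (13, 2), (15, 1)] (-78) [(0, 27), (2, 16), (20,
  1), (32, 1716), (41, 10)] (.child (.branch 32 1 [(0, -1), (2, -1), (10, -1), (11, -1), (13, -1),
  (14, 1), (16, -2), (17, 1), (18, -1), (19, 3)] (-156) [(0, 270), (9, 140), (18, 142), (29, 25),
  (43, 183)] (.child (.branch 18 3 [(1, -1), (11, -1), (14, 1), (15, -1), (17, 8), (18, -3), (19,
  1), (20, -5)] 416 [(0, 90), (9, 210), (11, 42), (37, 26208), (38, 139)] (.child (.branch 19 3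
  [(2, 1), (12, -1), (15, 1), (16, -1), (18, 3), (19, 1), (20, 4), (21, -4)] (-104) [(0, 441), (8,
  58), (11, 29), (13, 429), (39, 29406)] (.child (.branch 72 1 [(0, 1), (1, 1), (3, 1), (13, -1),
  (16, 1), (17, -1), (19, 1), (20, -4), (21, -3), (22, 2)] 0 [(0, 588), (3, 93), (6, 607), (10,
  267), (28, 300)] (.done [(0, 6), (13, 16), (41, 2340), (42, 15)])) (.child (.branch 47 1 [(0,
  -1), (1, 1), (3, 1), (8, -1), (11, -1), (13, -1), (16, -1), (17, 1), (19, -6), (20, 1), (21,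
  -1), (22, 2)] 754 [(0, 18), (13, 22), (41, 3510), (42, 24), (46, 11)] (.done [(0, 594), (6,
  576), (11, 104), (13, 234), (28, 169)])) (.done [(0, 30), (1, 15), (26, 24), (44, 11)]))))
  (.child (.branch 45 1 [(0, -1), (2, 1), (10, -1), (11, -1), (15, 1), (16, -1), (18, 1), (19, 1),
  (20, 1), (21, -1)] 169 [(0, 216), (4, 153), (8, 221), (26, 136), (33, 39)] (.done [(0, 28), (2,
  22), (40, 27)])) (.done [(0, 135), (2, 72), (6, 104), (24, 64), (31, 147)])))) (.done [(0, 560),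
  (1, 25), (14, 270), (22, 336), (40, 364)]))) (.child (.branch 34 1 [(0, -1), (8, -1), (10, -1),
  (13, -1), (14, 1), (16, -3), (17, 1), (18, -2), (19, 3)] 390 [(0, 12), (4, 8), (35, 780), (36,
  1), (40, 4)] (.done [(0, 45), (5, 28), (9, 18), (22, 14), (36, 21)])) (.done [(0, 15), (5, 15),
  (7, 3), (33, 1872), (34, 26)])))) (.done [(0, 18), (1, 4), (18, 2), (27, 9), (32, 9)]))) (.child
  (.branch 30 3 [(0, -1), (11, -1), (12, 1), (15, 2), (16, 2), (17, -4)] 468 [(0, 492), (2, 480),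
  (3, 990), (5, 390), (32, 833)] (.child (.branch 33 1 [(0, -1), (1, -1), (9, -1), (15, 2), (16,
  -1), (17, -1), (18, -1)] 234 [(0, 16), (1, 1), (4, 9), (32, 2808), (41, 9)] (.done [(0, 123),
  (4, 48), (5, 99), (7, 39), (34, 194)])) (.child (.branch 32 1 [(0, 1), (10, -1), (12, -1), (13,
  1), (15, -4), (16, 2), (18, 4)] (-78) [(0, 450), (4, 142), (7, 328), (27, 302), (41, 447)]
  (.done [(0, 18), (2, 9), (4, 13), (20, 16)])) (.done [(0, 108), (2, 70), (18, 28), (25, 81),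
  (39, 126)])))) (.done [(0, 20), (3, 6), (28, 9282), (30, 33), (37, 5)])))) (.done [(0, 100), (6,
  30), (14, 13), (26, 24960), (32, 12)]))) (.done [(0, 16), (16, 13), (21, 18), (33, 9)]))) (.done
  [(0, 2), (3, 1), (22, 312), (23, 312)]))) (.done [(0, 16), (15, 13), (26, 9), (29, 18)])))
  (.done [(0, 16), (1, 5), (10, 15), (15, 6), (18, 1170)]))) (.done [(0, 11), (4, 16), (8, 15),
  (13, 6), (16, 1170)])))) (.done [(0, 2), (2, 1), (14, 624), (16, 2)]))) (.done [(0, 12), (4,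
  15), (9, 2), (14, 10), (21, 7)])))) (.done [(0, 12), (2, 3), (7, 5), (12, 8), (16, 7)]))) (.done
  [(0, 1), (1, 1), (3, 1)]))) (.child (.branch 16 1 [(0, 1), (1, 1)] (-312) [(0, 3), (5, 1), (8,
  624), (9, 1248), (15, 1)] (.child (.branch 48 2 [(1, 1), (2, -1), (4, 4), (5, -2)] 156 [(0, 2),
  (1, 1), (4, 2), (10, 936)] (.child (.branch 50 2 [(2, 1), (3, -1), (5, 2), (7, -1), (8, -1)] 156
  [(0, 2), (13, 312), (18, 1)] (.child (.branch 49 1 [(0, 1), (1, 1)] 312 [(0, 2), (5, 2), (8, 1),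
  (14, 936), (15, 936)] (.done [(0, 4), (5, 2), (8, 1), (11, 3)])) (.done [(0, 4), (3, 4), (6, 5),
  (9, 3), (12, 1872)]))) (.done [(0, 4), (1, 3), (7, 3), (11, 1248), (16, 1)]))) (.child (.branch
  48 2 [(1, 1), (2, -1), (4, 4), (5, -2)] 156 [(0, 2), (2, 1), (5, 2), (10, 936)] (.child (.branch
  50 2 [(2, 1), (3, -1), (5, 2), (7, -1), (8, -1)] 156 [(0, 4), (4, 2), (7, 1), (18, 3)] (.child
  (.branch 49 1 [(0, 1), (1, 1)] 312 [(0, 4), (6, 4), (9, 5), (14, 1872), (20, 3)] (.done [(0, 2),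
  (11, 1), (14, 312), (16, 2)])) (.done [(0, 2), (4, 2), (7, 1), (12, 1872), (14, 6)]))) (.done
  [(0, 12), (2, 3), (7, 5), (12, 8), (16, 7)]))) (.done [(0, 6), (3, 3), (7, 1872), (12, 4), (14,
  3)])))) (.done [(0, 3), (3, 1), (6, 1872), (8, 4), (12, 2)]))))

def contradictionTree3 : ContradictionTree :=
  .branch 92 1 [(0, -1), (3, 1)] 585 [(0, 10), (10, 9), (21, 4)] (.child (.branch 50 2 [(1, 2),
  (6, 1), (14, -1)] 78 [(0, 2), (27, 312), (32, 1)] (.child (.branch 49 1 [(0, 1), (8, 1)] 156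
  [(0, 2), (14, 1), (28, 702), (29, 702)] (.child (.branch 30 3 [(1, -1), (11, -1), (12, 1), (15,
  2), (16, 2), (17, -4)] 390 [(0, 12), (10, 12), (32, 1)] (.child (.branch 33 1 [(0, -1), (2, -1),
  (9, -1), (15, 2), (16, -1), (17, -1), (18, -1)] 312 [(0, 270), (4, 184), (13, 54), (18, 43),
  (32, 39312)] (.done [(0, 15), (12, 6), (34, 14)])) (.child (.branch 33 1 [(0, -1), (2, -1), (9,
  -1), (15, 2), (16, -1), (17, -1), (18, -1)] 156 [(0, 270), (4, 184), (13, 54), (18, 43), (32,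
  39312)] (.child (.branch 18 3 [(1, 1), (3, -1), (13, -1), (14, 1), (17, 2), (18, 1), (19, -2)]
  260 [(0, 15), (14, 14), (34, 1508), (35, 754)] (.child (.branch 45 1 [(0, -1), (2, -1), (4, -1),
  (8, -1), (9, -1), (11, -1), (14, -1), (17, 1), (19, -1), (20, -2)] 130 [(0, 14), (1, 11), (36,
  4212), (37, 2106)] (.child (.branch 54 3 [(5, -1), (13, -1), (15, -1), (16, -1), (18, -4), (19,
  6), (20, 2), (21, 2)] (-312) [(0, 5376), (3, 702), (16, 3276), (19, 2632), (40, 1521)] (.child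
  (.branch 57 3 [(12, -1), (13, -1), (16, -1), (17, -1), (20, -3), (21, -6), (22, 3)] 286 [(0,
  963), (4, 234), (26, 463), (40, 94848), (46, 892)] (.child (.branch 59 1 [(0, -1), (1, -1), (7,
  -1), (13, -1), (15, -1), (17, 1), (21, -1), (22, -2), (23, 1)] 728 [(0, 15), (22, 14), (44, 6)]
  (.done [(0, 243), (6, 182), (7, 100)])) (.child (.branch 79 1 [(0, 1), (1, -1), (7, -1), (13,
  -1), (14, -1), (15, -1), (17, 1), (20, 1), (21, -3), (22, -2), (23, 1)] 832 [(0, 321), (3, 252),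
  (28, 154), (42, 3276), (48, 120)] (.child (.branch 72 3 [(21, -2), (22, 1), (24, 4)] (-156) [(0,
  1215), (8, 232), (9, 512), (25, 648), (44, 138996)] (.child (.branch 47 1 [(0, -1), (5, -1), (7,
  -1), (9, -1), (13, -1), (15, -1), (20, -1), (22, 3), (23, -1), (24, -1), (25, -3)] 637 [(0,
  2520), (4, 135), (26, 924), (48, 896), (52, 2130)] (.child (.branch 22 13 [(21, -1), (23, 8),
  (24, -5), (25, -5), (26, -14)] 480 [(0, 1924), (2, 1809), (24, 471), (28, 662), (48, 110448)]
  (.child (.branch 14 1 [(0, 6), (21, 1), (22, -1), (25, 2), (26, 4), (27, 4)] 228 [(0, 52), (28,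
  15), (30, 53), (31, 34), (50, 2808)] (.done [(0, 1859), (4, 984), (14, 798), (36, 1771), (50,
  163254)])) (.child (.branch 23 1 [(0, 4), (21, -1), (24, -3), (25, 3), (26, 3), (27, 3)] 660
  [(0, 7956), (4, 738), (28, 721), (30, 3267), (47, 5528)] (.done [(0, 27378), (4, 7290), (14,
  27268), (15, 4472), (36, 3483)])) (.child (.branch 12 1 [(0, 2), (19, 2), (22, -1)] 948 [(0,
  14014), (4, 4212), (8, 8085), (11, 4608), (50, 252252)] (.done [(0, 676), (28, 195), (30, 121),
  (31, 626), (47, 60)])) (.child (.branch 12 1 [(0, 2), (19, 2), (22, -1)] 1020 [(0, 7696), (4,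
  9675), (26, 5965), (30, 18), (50, 2700672)] (.done [(0, 676), (28, 195), (30, 121), (31, 626),
  (47, 60)])) (.child (.branch 13 1 [(0, -5), (21, -1), (22, -1), (24, 4), (25, -1), (26, -1),
  (27, -7)] 780 [(0, 7007), (4, 1998), (11, 942), (30, 5390), (50, 630630)] (.done [(0, 1053),
  (14, 38), (15, 838), (31, 324), (51, 18954)])) (.child (.branch 84 1 [(0, 2), (17, -1), (21,
  -1), (24, -4), (25, 1), (26, -1), (27, 5)] 306 [(0, 4563), (4, 972), (14, 3140), (15, 1768),
  (36, 1377)] (.done [(0, 2704), (4, 117), (30, 2688), (31, 681), (47, 384)])) (.child (.branch 21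
  1 [(0, -3), (21, 1), (24, 3), (25, -3), (26, -3), (27, -3)] 720 [(0, 11154), (4, 13170), (14,
  7620), (36, 3311), (50, 872040)] (.done [(0, 169), (30, 24), (31, 116), (47, 126), (50,
  18252)])) (.child (.branch 27 1 [(0, -3), (24, 2), (27, -4)] 144 [(0, 130), (28, 95), (30, 93),
  (31, 42), (50, 17784)] (.done [(0, 143), (4, 36), (26, 8), (36, 150), (50, 14508)])) (.done [(0,
  2132), (12, 414), (24, 553), (29, 1685), (48, 276432)])))))))))) (.done [(0, 441), (19, 128),
  (22, 64), (27, 285), (46, 64896)]))) (.child (.branch 19 1 [(0, 1), (5, -1), (7, 1), (9, -1),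
  (19, -1), (20, 1), (22, -2), (23, 3), (24, 1), (25, -1)] 52 [(0, 360), (24, 145), (26, 307),
  (27, 278), (46, 18096)] (.child (.branch 9 13 [(20, -1), (23, -8), (24, 3), (25, -5), (26, 19)]
  (-180) [(0, 3939), (2, 2130), (12, 3900), (34, 2546), (48, 99840)] (.child (.branch 68 1 [(0,
  -5), (17, -1), (22, 1), (24, -5), (25, -1), (26, -5), (27, 10)] 666 [(0, 2366), (8, 591), (14,
  1260), (36, 1190), (56, 1074)] (.done [(0, 4303), (4, 2907), (30, 330), (47, 2154), (50,
  187434)])) (.child (.branch 26 1 [(0, 2), (19, -2), (21, -1)] 492 [(0, 1755), (14, 512), (15,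
  778), (36, 864), (56, 243)] (.done [(0, 91), (4, 30), (30, 70), (50, 5044), (51, 1898)]))
  (.child (.branch 24 1 [(0, 6), (21, -1), (22, 1), (25, 2), (26, 4), (27, -8)] 132 [(0, 429), (4,
  511), (6, 44), (15, 50), (36, 96)] (.done [(0, 702), (8, 648), (14, 16), (15, 161), (56, 81)]))
  (.child (.branch 25 1 [(0, -5), (21, -1), (22, -1), (24, -4), (25, 3), (26, -1), (27, 8)] 48
  [(0, 14703), (4, 5703), (15, 10749), (28, 928), (31, 5616)] (.done [(0, 364), (8, 213), (30,
  252), (50, 19656), (56, 66)])) (.child (.branch 24 1 [(0, 6), (21, -1), (22, 1), (25, 2), (26,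
  4), (27, -8)] 96 [(0, 14703), (4, 14205), (15, 1590), (26, 1160), (31, 2808)] (.done [(0, 2704),
  (8, 2151), (14, 324), (36, 644), (56, 450)])) (.child (.branch 66 1 [(0, -2), (18, -1), (21,
  -1), (22, -1), (24, -1), (25, 1), (27, 3)] 0 [(0, 1807), (4, 738), (26, 471), (31, 1407), (50,
  97812)] (.done [(0, 65), (8, 45), (30, 18), (52, 2), (56, 30)])) (.child (.branch 24 1 [(0, 6),
  (21, -1), (22, 1), (25, 2), (26, 4), (27, -8)] 60 [(0, 16341), (4, 13455), (28, 60), (31, 5016),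
  (52, 1225)] (.done [(0, 2704), (8, 2151), (14, 324), (36, 644), (56, 450)])) (.child (.branch 26
  1 [(0, 2), (19, -2), (21, -1)] 456 [(0, 1755), (14, 512), (15, 778), (36, 864), (56, 243)]
  (.done [(0, 91), (4, 30), (30, 70), (50, 5044), (51, 1898)])) (.done [(0, 10647), (2, 27342),
  (6, 18549), (24, 11956), (54, 7454)])))))))))) (.done [(0, 675), (4, 273), (6, 207), (32, 364),
  (46, 21294)]))) (.done [(0, 210), (2, 45), (24, 168), (46, 77), (50, 80)])))) (.done [(0, 6),
  (22, 2), (23, 4), (29, 3)]))) (.done [(0, 195), (20, 86), (21, 134), (37, 120), (40, 12168)]))))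
  (.child (.branch 58 1 [(0, 2), (10, 2), (16, -1)] 858 [(0, 231), (16, 134), (20, 148), (40,
  19032), (46, 236)] (.done [(0, 147), (13, 24), (16, 12), (21, 130), (40, 12168)])) (.done [(0,
  462), (14, 442), (18, 302), (38, 157170), (44, 313)])))) (.done [(0, 60), (6, 44), (38, 39)])))
  (.child (.branch 54 3 [(4, -1), (12, -1), (14, -1), (15, -1), (17, -4), (18, 6), (19, 2), (20,
  2)] (-312) [(0, 120), (17, 88), (37, 18252), (38, 39)] (.child (.branch 57 3 [(11, -1), (12,
  -1), (15, -1), (16, -1), (19, -3), (20, -6), (21, 3)] 286 [(0, 81), (10, 26), (24, 50), (38,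
  7722), (44, 63)] (.child (.branch 59 1 [(0, -1), (1, -1), (6, -1), (12, -1), (14, -1), (16, 1),
  (20, -1), (21, -2), (22, 1)] 728 [(0, 15), (20, 14), (42, 6)] (.done [(0, 63), (8, 27), (12,
  32), (21, 24), (26, 44)])) (.child (.branch 79 1 [(0, 1), (1, -1), (6, -1), (12, -1), (13, -1),
  (14, -1), (16, 1), (19, 1), (20, -3), (21, -2), (22, 1)] 832 [(0, 321), (3, 252), (26, 154),
  (40, 3276), (46, 120)] (.child (.branch 72 3 [(20, -2), (21, 1), (23, 4)] (-156) [(0, 69), (10,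
  36), (23, 48), (28, 28), (42, 2652)] (.child (.branch 46 1 [(0, -1), (4, 1), (13, -1), (15, -1),
  (18, 1), (19, -1), (22, -2), (23, -3), (24, 3)] 455 [(0, 2268), (4, 81), (16, 1456), (30, 658),
  (50, 1278)] (.done [(0, 810), (20, 83), (25, 297), (41, 784), (44, 89856)])) (.child (.branch 20
  1 [(0, 1), (4, 1), (21, -2), (22, 1), (24, 1)] (-52) [(0, 180), (25, 168), (45, 13572), (46,
  29)] (.done [(0, 1260), (4, 993), (24, 588), (44, 63336), (50, 146)])) (.done [(0, 210), (2,
  45), (22, 168), (44, 77), (48, 80)])))) (.done [(0, 6), (20, 2), (21, 4), (27, 3)]))) (.done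
  [(0, 195), (18, 86), (19, 134), (35, 120), (38, 12168)])))) (.child (.branch 58 1 [(0, 2), (9,
  2), (15, -1)] 858 [(0, 231), (14, 134), (18, 148), (38, 19032), (44, 236)] (.done [(0, 147),
  (11, 24), (14, 12), (19, 130), (38, 12168)])) (.done [(0, 462), (12, 442), (16, 302), (36,
  157170), (42, 313)])))) (.done [(0, 5184), (6, 1880), (12, 1044), (15, 2106), (20, 5369)]))))
  (.done [(0, 10), (2, 4), (34, 9)]))) (.done [(0, 108), (2, 76), (11, 54), (16, 97), (30,
  1404)])))) (.done [(0, 18), (4, 8), (25, 13)]))) (.child (.branch 49 1 [(0, 1), (8, 1)] (-78)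
  [(0, 2), (14, 1), (28, 702), (29, 702)] (.child (.branch 30 3 [(1, -1), (11, -1), (12, 1), (15,
  2), (16, 2), (17, -4)] 312 [(0, 12), (10, 12), (32, 1)] (.child (.branch 32 1 [(0, 1), (10, -1),
  (12, -1), (13, 1), (15, -4), (16, 2), (18, 4)] 78 [(0, 39), (3, 1), (8, 1), (13, 39), (32,
  1014)] (.done [(0, 462), (8, 370), (12, 342), (32, 86346), (38, 485)])) (.child (.branch 31 1
  [(0, -1), (2, -1), (10, -1), (12, 1), (13, -1), (15, 4), (17, 2), (18, -3)] 234 [(0, 99), (3,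
  10), (12, 95), (13, 97), (32, 1287)] (.done [(0, 24), (6, 2), (18, 20), (32, 4056), (38, 19)]))
  (.done [(0, 234), (4, 190), (11, 174), (16, 245), (30, 51948)])))) (.done [(0, 18), (4, 8), (25,
  13)]))) (.done [(0, 90), (2, 53), (7, 27), (23, 49), (26, 23166)])))) (.done [(0, 20), (4, 6),
  (11, 5), (24, 4992), (25, 4056)]))

def contradictionTree4 : ContradictionTree :=
  .branch 30 3 [(1, -1), (11, -1), (12, 1), (15, 2), (16, 2), (17, -4)] 312 [(0, 225), (4, 91),
  (12, 56), (26, 146), (27, 231)] (.child (.branch 32 1 [(0, 1), (10, -1), (12, -1), (13, 1), (15,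
  -4), (16, 2), (18, 4)] (-390) [(0, 97), (1, 2), (3, 5), (13, 96), (32, 2496)] (.child (.branch
  18 3 [(1, 1), (3, -1), (13, -1), (14, 1), (17, 2), (18, 1), (19, -2)] 260 [(0, 63), (1, 24), (9,
  32), (30, 27), (31, 44)] (.child (.branch 19 3 [(2, -1), (4, -1), (14, -1), (15, 1), (17, -2),
  (18, 6), (19, 5), (20, -3)] (-260) [(0, 81), (11, 26), (23, 63), (33, 50), (36, 7722)] (.child
  (.branch 20 1 [(0, 1), (1, -1)] (-52) [(0, 231), (7, 148), (9, 134), (25, 236), (38, 19032)]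
  (.done [(0, 102), (1, 9), (5, 91), (9, 21), (38, 12168)])) (.child (.branch 47 1 [(0, -1), (1,
  1), (3, -1), (5, -1), (9, -1), (11, -1), (16, -1), (18, 1), (20, -1), (21, -2)] 403 [(0, 120),
  (5, 88), (39, 18252), (40, 39)] (.child (.branch 74 1 [(1, 1), (2, 1), (4, 1), (6, -1), (16,
  -1), (17, 1), (19, -5), (21, -5), (22, 5)] 468 [(0, 6), (7, 4), (9, 2), (46, 3)] (.child
  (.branch 55 3 [(7, -1), (17, -1), (20, -6), (21, 2), (22, -2), (23, 4)] 52 [(0, 126), (7, 99),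
  (44, 50)] (.child (.branch 59 1 [(0, 2), (11, 2), (19, 1)] 572 [(0, 454), (1, 136), (11, 162),
  (41, 405), (45, 37908)] (.child (.branch 78 3 [(10, 2), (15, 1), (21, 2)] 260 [(0, 39), (13,
  12), (15, 24), (32, 22)] (.child (.branch 54 1 [(0, -1), (2, -1), (18, -1), (20, 1), (21, 1),
  (23, -3), (24, -1), (25, -2), (26, 4)] (-78) [(0, 1344), (7, 297), (13, 378), (35, 486), (42,
  700)] (.child (.branch 12 13 [(21, 1), (22, -1), (24, 16), (25, -20), (26, -15), (27, -6)] 624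
  [(0, 169), (17, 158), (19, 4), (36, 60), (50, 16224)] (.child (.branch 13 1 [(0, 4), (22, 1),
  (23, -1), (26, 4), (27, 5), (28, -1)] 780 [(0, 1053), (8, 508), (9, 458), (19, 324), (52,
  50544)] (.done [(0, 21), (1, 6), (17, 15), (21, 4)])) (.child (.branch 21 1 [(0, 5), (22, -1),
  (23, -1), (25, -5), (26, 8), (27, 5), (28, 2)] 648 [(0, 1560), (19, 1214), (21, 991), (26, 805),
  (52, 57408)] (.done [(0, 286), (4, 240), (23, 90), (49, 219), (52, 79560)])) (.child (.branch 28
  1 [(0, -6), (25, 5), (26, -7), (27, -6), (28, -2)] 36 [(0, 429), (4, 464), (5, 55), (9, 64),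
  (52, 9360)] (.done [(0, 689), (19, 420), (29, 296), (38, 138), (52, 62712)])) (.child (.branch
  29 1 [(0, 2), (22, 1), (23, -1), (25, -1), (26, 2), (27, 2), (28, 1)] 216 [(0, 6019), (4, 3744),
  (17, 1260), (38, 3160), (53, 780)] (.done [(0, 5265), (8, 1174), (9, 2924), (19, 1296), (52,
  530712)])) (.child (.branch 21 1 [(0, 5), (22, -1), (23, -1), (25, -5), (26, 8), (27, 5), (28,
  2)] 720 [(0, 1560), (19, 1214), (21, 991), (26, 805), (52, 57408)] (.done [(0, 273), (5, 15),
  (11, 210), (49, 92), (52, 5460)])) (.child (.branch 14 1 [(0, 3), (22, 1), (23, -1), (26, 4),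
  (27, 5), (28, -1)] 228 [(0, 1846), (4, 306), (5, 1650), (11, 252), (49, 117)] (.done [(0, 169),
  (19, 98), (21, 118), (38, 80), (52, 4056)])) (.child (.branch 27 1 [(0, 5), (22, 1), (23, -1),
  (25, -2), (26, 7), (27, 7)] 144 [(0, 286), (4, 72), (5, 231), (52, 24804), (53, 23244)] (.done
  [(0, 845), (19, 184), (21, 56), (38, 840), (52, 42588)])) (.child (.branch 23 1 [(0, 2), (23,
  1), (25, -3), (26, 3), (27, 3)] 660 [(0, 819), (4, 28), (5, 83), (8, 476), (49, 342)] (.done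
  [(0, 1560), (19, 154), (21, 1421), (26, 575), (52, 200928)])) (.done [(0, 1001), (2, 1260), (3,
  12), (47, 369), (50, 183456)])))))))))) (.done [(0, 441), (15, 285), (19, 64), (25, 128), (48,
  64896)]))) (.child (.branch 57 1 [(0, 1), (2, -1), (10, -1), (16, -1), (17, -1), (20, 1), (21,
  1), (23, -1), (24, -3), (25, -4), (26, 2)] 598 [(0, 360), (15, 278), (17, 307), (22, 145), (48,
  18096)] (.child (.branch 9 13 [(21, -1), (24, -8), (25, 3), (26, -5), (27, 19)] (-180) [(0,
  1339), (2, 2544), (9, 2514), (25, 112), (50, 15756)] (.child (.branch 66 1 [(0, -2), (19, -1),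
  (22, -1), (23, -1), (25, -1), (26, 1), (28, 3)] (-108) [(0, 910), (11, 717), (21, 252), (39,
  304), (52, 2184)] (.done [(0, 2626), (4, 4431), (9, 1302), (49, 3067), (52, 56238)])) (.child
  (.branch 24 1 [(0, 6), (22, -1), (23, 1), (26, 2), (27, 4), (28, -8)] (-84) [(0, 338), (9, 72),
  (11, 153), (39, 230), (49, 42)] (.done [(0, 182), (4, 270), (23, 118), (49, 81), (52, 26676)]))
  (.child (.branch 81 1 [(0, 1), (22, 1), (25, 3), (26, -1), (27, 1), (28, -3)] 360 [(0, 2366),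
  (9, 2268), (11, 3), (39, 654), (49, 140)] (.done [(0, 9126), (4, 3672), (17, 4413), (21, 2678),
  (23, 5904)])) (.child (.branch 25 1 [(0, -5), (22, -1), (23, -1), (25, -4), (26, 3), (27, -1),
  (28, 8)] 48 [(0, 1183), (4, 2268), (11, 1998), (23, 798), (39, 920)] (.done [(0, 3991), (8,
  1260), (19, 3096), (23, 130), (52, 446472)])) (.child (.branch 81 1 [(0, 1), (22, 1), (25, 3),
  (26, -1), (27, 1), (28, -3)] 432 [(0, 2366), (9, 2268), (11, 3), (39, 654), (49, 140)] (.done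
  [(0, 3276), (4, 126), (17, 1422), (38, 1722), (54, 449)])) (.child (.branch 66 1 [(0, -2), (19,
  -1), (22, -1), (23, -1), (25, -1), (26, 1), (28, 3)] 0 [(0, 910), (11, 717), (21, 252), (39,
  304), (52, 2184)] (.done [(0, 27547), (4, 8874), (19, 22308), (23, 2052), (29, 834)])) (.child
  (.branch 25 1 [(0, -5), (22, -1), (23, -1), (25, -4), (26, 3), (27, -1), (28, 8)] (-24) [(0,
  364), (11, 135), (17, 210), (21, 56), (39, 170)] (.done [(0, 1261), (8, 360), (19, 996), (49,
  65), (52, 139152)])) (.child (.branch 26 1 [(0, 2), (20, -2), (22, -1)] 456 [(0, 208), (4, 36),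
  (17, 51), (21, 82), (38, 76)] (.done [(0, 585), (8, 124), (9, 446), (39, 144), (49, 162)]))
  (.done [(0, 1859), (2, 630), (6, 1680), (24, 220), (47, 546)])))))))))) (.done [(0, 675), (7,
  273), (12, 207), (45, 364), (48, 21294)]))) (.done [(0, 312), (3, 252), (5, 9), (33, 142), (43,
  108)])))) (.done [(0, 15), (13, 14), (44, 1508), (45, 754)]))) (.child (.branch 78 3 [(9, 2),
  (14, 1), (20, 2)] 260 [(0, 39), (11, 12), (13, 24), (30, 22)] (.child (.branch 56 1 [(0, 1), (1,
  -1), (9, -1), (17, -1), (19, -1), (20, 1), (22, -3), (23, 1), (24, -1), (25, 2)] 910 [(0, 810),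
  (13, 297), (17, 83), (32, 784), (46, 89856)] (.done [(0, 72), (1, 33), (33, 44), (46, 4212),
  (47, 3276)])) (.child (.branch 58 1 [(0, 1), (1, 1), (9, -1), (15, -1), (20, -1), (22, 3), (25,
  -3)] 858 [(0, 180), (13, 168), (47, 13572), (48, 29)] (.done [(0, 1260), (5, 993), (15, 588),
  (33, 146), (46, 63336)])) (.done [(0, 27), (19, 28), (41, 22)])))) (.done [(0, 84), (9, 18),
  (17, 24), (38, 64), (39, 33)])))) (.done [(0, 321), (1, 252), (27, 120), (37, 154), (40,
  3276)]))) (.done [(0, 462), (7, 302), (9, 442), (25, 313), (38, 157170)]))) (.done [(0, 195),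
  (3, 134), (5, 86), (22, 120), (36, 12168)])))) (.child (.branch 45 1 [(0, -1), (2, -1), (4, -1),
  (8, -1), (9, -1), (11, -1), (14, -1), (17, 1), (19, -1), (20, -2)] 208 [(0, 15), (5, 11), (36,
  3042), (37, 1521)] (.done [(0, 192), (3, 47), (7, 15), (10, 78), (33, 188)])) (.done [(0, 15),
  (3, 14), (36, 6)])))) (.done [(0, 24), (14, 24), (33, 468), (34, 1)]))) (.child (.branch 31 1
  [(0, -1), (2, -1), (10, -1), (12, 1), (13, -1), (15, 4), (17, 2), (18, -3)] (-234) [(0, 222),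
  (13, 6), (19, 175), (29, 190), (32, 35646)] (.child (.branch 18 3 [(1, 1), (3, -1), (13, -1),
  (14, 1), (17, 2), (18, 1), (19, -2)] 312 [(0, 123), (1, 32), (8, 48), (30, 135), (31, 128)]
  (.child (.branch 45 1 [(0, -1), (2, -1), (4, -1), (8, -1), (9, -1), (11, -1), (14, -1), (17, 1),
  (19, -1), (20, -2)] 156 [(0, 15), (15, 11), (36, 3328), (37, 1664)] (.child (.branch 19 3 [(3,
  -1), (5, -1), (15, -1), (16, 1), (18, -2), (19, 6), (20, 5), (21, -3)] (-312) [(0, 81), (13,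
  26), (25, 63), (35, 50), (38, 7722)] (.child (.branch 73 1 [(0, -1), (2, -1), (19, 1), (20, 1),
  (21, 1), (22, -1)] 468 [(0, 960), (4, 465), (7, 512), (19, 171), (41, 44928)] (.done [(0, 9),
  (15, 4), (37, 10)])) (.child (.branch 47 1 [(0, -1), (2, 1), (4, -1), (6, -1), (10, -1), (12,
  -1), (17, -1), (19, 1), (21, -1), (22, -2)] 819 [(0, 288), (7, 282), (14, 234), (15, 136), (37,
  343)] (.done [(0, 876), (4, 906), (11, 1144), (27, 517), (40, 190632)])) (.done [(0, 939), (2,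
  144), (5, 982), (9, 528), (38, 43992)])))) (.done [(0, 720), (18, 264), (33, 660), (37, 66924),
  (38, 83)]))) (.child (.branch 19 3 [(2, -1), (4, -1), (14, -1), (15, 1), (17, -2), (18, 6), (19,
  5), (20, -3)] (-312) [(0, 177), (2, 39), (23, 168), (33, 77), (36, 20592)] (.child (.branch 47 1
  [(0, -1), (1, 1), (3, -1), (5, -1), (9, -1), (11, -1), (16, -1), (18, 1), (20, -1), (21, -2)]
  663 [(0, 297), (9, 128), (12, 256), (20, 141)] (.child (.branch 72 1 [(1, 1), (2, 1), (4, -1),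
  (6, -1), (16, -1), (17, 1), (19, -4), (20, 1), (21, -2), (22, 3)] (-312) [(0, 15), (19, 8), (21,
  8), (40, 1716)] (.child (.branch 54 3 [(7, -1), (15, -1), (17, -1), (18, -1), (20, -4), (21, 6),
  (22, 2), (23, 2)] (-390) [(0, 30), (13, 8), (21, 12), (29, 22), (36, 7)] (.child (.branch 58 1
  [(0, 2), (12, 2), (18, -1)] 858 [(0, 120), (3, 105), (11, 56), (44, 3796), (45, 6032)] (.child
  (.branch 57 3 [(15, -1), (16, -1), (19, -1), (20, -1), (23, -3), (24, -6), (25, 3)] 442 [(0,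
  453), (2, 87), (13, 504), (33, 203), (46, 27144)] (.child (.branch 79 1 [(0, 1), (2, -1), (10,
  -1), (16, -1), (17, -1), (18, -1), (20, 1), (23, 1), (24, -3), (25, -2), (26, 1)] 676 [(0,
  2106), (4, 452), (5, 949), (11, 1215), (19, 27)] (.child (.branch 9 13 [(21, -1), (24, -8), (25,
  3), (26, -5), (27, 19)] (-216) [(0, 65), (1, 6), (29, 56), (37, 12), (50, 9828)] (.child
  (.branch 24 1 [(0, 6), (22, -1), (23, 1), (26, 2), (27, 4), (28, -8)] (-48) [(0, 78), (3, 33),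
  (39, 46), (49, 30), (52, 7488)] (.done [(0, 7371), (8, 2056), (9, 476), (15, 6075), (52,
  252720)])) (.child (.branch 66 1 [(0, -2), (19, -1), (22, -1), (23, -1), (25, -1), (26, 1), (28,
  3)] (-108) [(0, 1833), (3, 1752), (23, 808), (31, 750), (52, 225576)] (.done [(0, 2197), (8,
  1953), (15, 657), (23, 12), (52, 136890)])) (.child (.branch 24 1 [(0, 6), (22, -1), (23, 1),
  (26, 2), (27, 4), (28, -8)] (-84) [(0, 78), (3, 33), (39, 46), (49, 30), (52, 7488)] (.done [(0,
  15379), (8, 4968), (15, 12879), (23, 476), (52, 803088)])) (.child (.branch 81 1 [(0, 1), (22,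
  1), (25, 3), (26, -1), (27, 1), (28, -3)] 360 [(0, 130), (11, 111), (39, 108), (49, 12), (52,
  38844)] (.done [(0, 2535), (8, 948), (15, 54), (23, 1556), (31, 2756)])) (.child (.branch 24 1
  [(0, 6), (22, -1), (23, 1), (26, 2), (27, 4), (28, -8)] (-120) [(0, 1261), (3, 1212), (18, 207),
  (49, 163), (52, 34944)] (.done [(0, 15379), (8, 4968), (15, 12879), (23, 476), (52, 803088)]))
  (.child (.branch 25 1 [(0, -5), (22, -1), (23, -1), (25, -4), (26, 3), (27, -1), (28, 8)] (-132)
  [(0, 65), (3, 45), (23, 10), (31, 48), (54, 3)] (.done [(0, 182), (8, 180), (23, 2), (49, 69),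
  (52, 35568)])) (.child (.branch 81 1 [(0, 1), (22, 1), (25, 3), (26, -1), (27, 1), (28, -3)] 468
  [(0, 767), (8, 666), (39, 800), (49, 426), (52, 267852)] (.done [(0, 429), (15, 36), (31, 192),
  (38, 180), (54, 137)])) (.child (.branch 25 1 [(0, -5), (22, -1), (23, -1), (25, -4), (26, 3),
  (27, -1), (28, 8)] (-24) [(0, 143), (3, 90), (23, 30), (31, 108), (39, 10)] (.done [(0, 234),
  (8, 56), (9, 76), (11, 135), (52, 23868)])) (.done [(0, 39), (9, 33), (37, 4), (47, 12), (50,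
  312)])))))))))) (.done [(0, 39), (19, 20), (27, 6), (35, 47), (48, 5148)]))) (.child (.branch 55
  1 [(0, 1), (2, 1), (16, -1), (17, -1), (18, -1), (20, 1), (23, 2), (24, -5), (25, -2), (26, 1)]
  364 [(0, 60), (27, 44), (50, 39)] (.done [(0, 360), (7, 321), (35, 208), (45, 12), (48,
  112164)])) (.done [(0, 36), (17, 26), (33, 28), (43, 15), (46, 7488)])))) (.done [(0, 165), (15,
  40), (23, 16), (25, 146), (44, 20592)]))) (.child (.branch 57 3 [(14, -1), (15, -1), (18, -1),
  (19, -1), (22, -3), (23, -6), (24, 3)] 442 [(0, 2673), (11, 2808), (18, 232), (19, 522), (31,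
  377)] (.child (.branch 55 1 [(0, 1), (1, 1), (15, -1), (16, -1), (17, -1), (19, 1), (22, 2),
  (23, -5), (24, -2), (25, 1)] 364 [(0, 60), (25, 44), (48, 39)] (.done [(0, 360), (5, 321), (33,
  208), (43, 12), (46, 112164)])) (.child (.branch 79 1 [(0, 1), (1, -1), (9, -1), (15, -1), (16,
  -1), (17, -1), (19, 1), (22, 1), (23, -3), (24, -2), (25, 1)] 676 [(0, 468), (5, 231), (9, 396),
  (23, 16), (46, 46332)] (.child (.branch 9 13 [(20, -1), (23, -8), (24, 3), (25, -5), (26, 19)]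
  (-216) [(0, 65), (1, 6), (27, 56), (35, 12), (48, 9828)] (.child (.branch 24 1 [(0, 6), (21,
  -1), (22, 1), (25, 2), (26, 4), (27, -8)] (-48) [(0, 78), (3, 33), (37, 46), (47, 30), (50,
  7488)] (.done [(0, 156), (9, 45), (13, 120), (17, 32), (50, 7956)])) (.child (.branch 66 1 [(0,
  -2), (18, -1), (21, -1), (22, -1), (24, -1), (25, 1), (27, 3)] (-108) [(0, 1833), (3, 1752),
  (21, 808), (29, 750), (50, 225576)] (.done [(0, 3016), (6, 180), (9, 2349), (17, 1920), (50,
  203580)])) (.child (.branch 24 1 [(0, 6), (21, -1), (22, 1), (25, 2), (26, 4), (27, -8)] (-84)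
  [(0, 78), (3, 33), (37, 46), (47, 30), (50, 7488)] (.done [(0, 156), (9, 45), (13, 120), (17,
  32), (50, 7956)])) (.child (.branch 81 1 [(0, 1), (21, 1), (24, 3), (25, -1), (26, 1), (27, -3)]
  360 [(0, 130), (9, 111), (37, 108), (47, 12), (50, 38844)] (.done [(0, 1014), (13, 306), (21,
  180), (29, 660), (52, 395)])) (.child (.branch 24 1 [(0, 6), (21, -1), (22, 1), (25, 2), (26,
  4), (27, -8)] (-120) [(0, 1261), (3, 1212), (16, 207), (47, 163), (50, 34944)] (.done [(0, 156),
  (9, 45), (13, 120), (17, 32), (50, 7956)])) (.child (.branch 81 1 [(0, 1), (21, 1), (24, 3),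
  (25, -1), (26, 1), (27, -3)] 432 [(0, 130), (9, 111), (37, 108), (47, 12), (50, 38844)] (.done
  [(0, 429), (13, 36), (29, 192), (36, 180), (52, 137)])) (.child (.branch 81 1 [(0, 1), (21, 1),
  (24, 3), (25, -1), (26, 1), (27, -3)] 468 [(0, 130), (9, 111), (37, 108), (47, 12), (50, 38844)]
  (.done [(0, 429), (13, 36), (29, 192), (36, 180), (52, 137)])) (.child (.branch 25 1 [(0, -5),
  (21, -1), (22, -1), (24, -4), (25, 3), (26, -1), (27, 8)] (-24) [(0, 143), (3, 90), (21, 30),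
  (29, 108), (37, 10)] (.done [(0, 312), (9, 315), (13, 60), (17, 16), (50, 55692)])) (.done [(0,
  39), (7, 33), (35, 4), (45, 12), (48, 312)])))))))))) (.done [(0, 39), (17, 20), (25, 6), (33,
  47), (46, 5148)]))) (.done [(0, 36), (15, 26), (31, 28), (41, 15), (44, 7488)])))) (.done [(0,
  468), (1, 303), (5, 216), (13, 100), (42, 118716)])))) (.done [(0, 61), (2, 64), (6, 4), (37,
  36), (40, 7020)]))) (.done [(0, 1485), (9, 640), (17, 256), (19, 961), (38, 329472)]))) (.child
  (.branch 46 1 [(0, -1), (3, 1), (5, -1), (10, -1), (12, -1), (18, -2), (19, 1), (20, -2), (21,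
  2)] 507 [(0, 15), (5, 11), (38, 1521), (39, 3042)] (.done [(0, 1404), (9, 1816), (17, 30), (25,
  833), (38, 311688)])) (.done [(0, 1455), (3, 1502), (7, 720), (15, 144), (36, 92664)])))) (.done
  [(0, 90), (13, 84), (36, 29)])))) (.done [(0, 468), (6, 400), (14, 114), (18, 485), (32,
  96876)]))) (.done [(0, 54), (4, 2), (9, 54), (17, 1), (30, 1404)])))

def contradictionTree5 : ContradictionTree :=
  .branch 7 2 [(3, 1), (4, -1), (6, 1), (7, -3), (8, -2), (9, 1)] 312 [(0, 24), (5, 15), (16, 20),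
  (20, 14), (23, 19)] (.child (.branch 6 1 [(0, 1), (1, -1)] (-312) [(0, 38), (2, 10), (10, 30),
  (18, 15), (25, 18)] (.child (.branch 91 2 [(0, 1), (3, -2), (11, 1)] 0 [(0, 16), (12, 9), (20,
  12), (24, 3), (27, 5)] (.child (.branch 75 1 [(0, -1), (3, -1), (7, 1), (9, -2), (10, -2), (11,
  -3), (12, 2)] 624 [(0, 16), (11, 13), (26, 18), (29, 9)] (.child (.branch 77 2 [(4, -1), (7, 1),
  (8, 1), (10, 3), (11, -3), (13, -3)] 546 [(0, 6), (5, 10), (9, 5), (24, 6)] (.child (.branch 92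
  1 [(0, -1), (2, -1), (5, -1), (8, 1), (11, 1), (12, -3), (13, -1), (14, -1)] 702 [(0, 100), (4,
  30), (7, 51), (26, 160), (33, 76)] (.done [(0, 2), (7, 1), (11, 1), (24, 312), (25, 312)]))
  (.done [(0, 268), (2, 160), (16, 130), (24, 117), (31, 270)]))) (.done [(0, 30), (5, 1), (7,
  25), (17, 24), (20, 4680)]))) (.done [(0, 2), (1, 1), (18, 312)]))) (.child (.branch 92 2 [(1,
  -1), (5, -1), (6, 1), (8, -5), (9, -1), (10, -2), (11, 3)] 468 [(0, 116), (2, 30), (9, 84), (20,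
  37), (24, 2)] (.child (.branch 76 1 [(0, -1), (2, -1), (3, -1), (6, -1), (9, -1), (10, -3), (11,
  -3), (12, 1)] 468 [(0, 30), (8, 13), (20, 5070), (26, 12), (28, 25)] (.child (.branch 75 2 [(3,
  -1), (4, -1), (7, 1), (8, 1), (11, -6), (12, -6), (13, 3)] 390 [(0, 16), (6, 9), (13, 13), (22,
  3510), (28, 18)] (.child (.branch 77 1 [(0, -1), (1, 1)] 546 [(0, 16), (20, 13), (21, 18), (30,
  9)] (.child (.branch 90 1 [(1, -1), (3, -1), (6, -1), (10, 1), (12, -2), (13, -2), (14, -3),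
  (15, 2)] 234 [(0, 13), (2, 9), (5, 18), (32, 16)] (.done [(0, 49), (2, 9), (17, 45), (26, 6318),
  (32, 2)])) (.done [(0, 4), (2, 2), (8, 5), (24, 936)]))) (.child (.branch 50 2 [(8, 1), (9, -1),
  (11, 2), (13, -1), (14, -1)] 78 [(0, 2), (25, 312), (30, 1)] (.child (.branch 30 3 [(0, -1), (9,
  -1), (10, 1), (13, 2), (14, 2), (15, -4)] 234 [(0, 12), (22, 9), (23, 14), (32, 7)] (.child
  (.branch 31 1 [(0, -1), (1, -1), (8, -1), (10, 1), (11, -1), (13, 4), (15, 2), (16, -3)] 234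
  [(0, 12), (7, 6), (13, 7), (25, 8), (28, 156)] (.done [(0, 40), (1, 2), (6, 36), (28, 468), (34,
  5)])) (.child (.branch 32 1 [(0, 1), (8, -1), (10, -1), (11, 1), (13, -4), (14, 2), (16, 4)] 156
  [(0, 78), (6, 4), (7, 80), (25, 5), (28, 2028)] (.done [(0, 78), (6, 36), (25, 95), (28, 18252),
  (34, 100)])) (.done [(0, 78), (4, 76), (5, 80), (26, 2028), (32, 5)])))) (.child (.branch 49 1
  [(0, 1), (7, 1)] 390 [(0, 5), (2, 5), (4, 1), (5, 2), (26, 1287)] (.done [(0, 134), (5, 8), (17,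
  40), (23, 87), (28, 36)])) (.done [(0, 98), (3, 40), (15, 53), (21, 51), (24, 17784)])))) (.done
  [(0, 20), (1, 10), (7, 13), (19, 12)])))) (.done [(0, 30), (4, 50), (5, 13), (17, 12), (20,
  9360)]))) (.done [(0, 2), (3, 1), (18, 312), (19, 312)]))) (.done [(0, 1), (16, 390), (24,
  1)])))) (.child (.branch 91 2 [(0, -1), (1, -1), (7, -3), (8, -1), (9, -2), (10, 2)] 117 [(0,
  18), (2, 5), (3, 1), (10, 12), (18, 6)] (.child (.branch 76 2 [(1, -1), (6, 1), (9, -3), (10,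
  -3)] 585 [(0, 30), (4, 13), (15, 38), (18, 10140), (24, 50)] (.child (.branch 77 1 [(0, -1), (1,
  -1), (6, -1), (7, 1), (9, -2), (10, 1), (12, -1)] 546 [(0, 16), (16, 13), (17, 18), (26, 9)]
  (.child (.branch 90 1 [(1, -1), (2, -1), (3, -1), (7, 1), (8, 1), (10, -2), (11, -1), (12, -2),
  (13, 1)] 0 [(0, 2), (9, 1), (23, 312)] (.child (contradictionTree3) (.done [(0, 12), (2, 2),
  (10, 1), (13, 10), (22, 1404)]))) (.done [(0, 4), (1, 2), (6, 5), (20, 936), (21, 936)])))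
  (.child (.branch 77 1 [(0, -1), (1, -1), (6, -1), (7, 1), (9, -2), (10, 1), (12, -1)] 312 [(0,
  98), (2, 36), (16, 65), (17, 90), (21, 9126)] (.child (.branch 90 1 [(1, -1), (2, -1), (3, -1),
  (7, 1), (8, 1), (10, -2), (11, -1), (12, -2), (13, 1)] (-234) [(0, 2), (9, 1), (23, 312)]
  (.child (.branch 92 1 [(0, -1), (3, 1)] 351 [(0, 10), (10, 9), (21, 4)] (.child (.branch 50 2
  [(1, 2), (6, 1), (14, -1)] 78 [(0, 2), (27, 312), (32, 1)] (.child (.branch 49 1 [(0, 1), (8,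
  1)] 156 [(0, 20), (7, 6), (28, 5148), (29, 4134), (34, 5)] (.child (.branch 33 3 [(4, -2), (12,
  2), (14, 1)] 0 [(0, 117), (2, 56), (9, 30), (17, 14), (30, 19656)] (.child (.branch 30 1 [(0,
  -1), (2, -1), (9, -1), (15, 2), (16, -1), (17, -1), (18, -1)] 234 [(0, 4), (14, 2), (29, 5),
  (32, 910), (33, 962)] (.child (.branch 32 1 [(1, -1), (3, -1), (10, -1), (11, -1), (13, -1),
  (14, 1), (16, -2), (17, 1), (18, -1), (19, 3)] 0 [(0, 74), (1, 76), (21, 60), (31, 65), (34,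
  12168)] (.done [(0, 24), (16, 24), (35, 468), (36, 1)])) (.done [(0, 1), (11, 1), (32, 26), (33,
  13)]))) (.child (.branch 30 1 [(0, -1), (2, -1), (9, -1), (15, 2), (16, -1), (17, -1), (18, -1)]
  546 [(0, 42), (14, 16), (28, 25), (29, 40), (33, 4056)] (.child (.branch 32 1 [(1, -1), (3, -1),
  (10, -1), (11, -1), (13, -1), (14, 1), (16, -2), (17, 1), (18, -1), (19, 3)] (-156) [(0, 108),
  (7, 76), (13, 54), (21, 97), (34, 1404)] (.child (.branch 35 1 [(2, 1), (10, -1), (11, -1), (17,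
  -1), (18, -2), (19, -2)] 390 [(0, 15), (18, 6), (37, 3276), (38, 7)] (.child (.branch 18 3 [(3,
  -1), (12, -1), (15, 1), (16, -1), (18, 8), (19, -3), (20, 1), (21, -5)] 260 [(0, 15), (6, 14),
  (38, 1872), (39, 936)] (.child (.branch 45 1 [(0, -1), (4, 1), (10, -1), (11, -1), (16, -1),
  (19, -1), (20, 1), (22, -1)] (-104) [(0, 15), (19, 11), (40, 3328), (41, 1664)] (.child (.branch
  54 3 [(7, -1), (15, -1), (17, -1), (18, -1), (20, -4), (21, 6), (22, 2), (23, 2)] (-312) [(0,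
  21), (8, 9), (36, 16)] (.child (.branch 58 1 [(0, 2), (12, 2), (18, -1)] 546 [(0, 15), (26, 14),
  (45, 1404), (46, 3)] (.child (.branch 47 3 [(7, 1), (13, -1), (16, -1), (20, -1), (22, 3), (23,
  -3), (24, -3), (25, -4)] 403 [(0, 21), (10, 16), (28, 9)] (.child (.branch 20 1 [(0, 2), (5,
  -1), (6, 2)] (-364) [(0, 15), (14, 14), (49, 1404), (50, 3)] (.child (.branch 73 1 [(1, 1), (5,
  1), (15, -1), (21, -1), (24, -2), (26, -2), (27, 3)] 312 [(0, 111), (29, 84), (36, 8), (50,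
  14196), (56, 70)] (.child (.branch 74 1 [(2, -1), (6, -1), (10, -1), (16, -1), (18, -1), (19,
  -1), (22, -1), (25, 2), (26, -3), (27, -4), (28, -1)] 468 [(0, 273), (2, 54), (34, 126), (38,
  33), (58, 154)] (.child (.branch 55 3 [(13, -1), (23, -1), (26, -6), (27, 2), (28, -2), (29, 4)]
  130 [(0, 126), (15, 99), (56, 50)] (.child (.branch 59 1 [(0, 2), (17, 2), (25, 1)] 728 [(0,
  351), (15, 174), (24, 200)] (.done [(0, 15), (35, 14), (56, 1872), (57, 936)])) (.child (.branch
  78 1 [(0, -1), (6, -1), (22, -1), (24, 1), (25, 1), (27, -3), (28, -1), (29, -2), (30, 4)] 260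
  [(0, 21), (6, 9), (42, 16)] (.child (.branch 59 1 [(1, 2), (18, 2), (26, 1)] 572 [(0, 351), (17,
  174), (26, 200)] (.child (.branch 79 1 [(2, 1), (8, 1), (24, -1), (26, -1), (29, 3), (30, -2),
  (31, -1), (32, -1)] 832 [(0, 147), (10, 30), (11, 126), (46, 58), (60, 1092)] (.child (.branch 9
  13 [(27, -1), (30, -8), (31, 3), (32, -5), (33, 19)] (-216) [(0, 455), (28, 112), (32, 145),
  (41, 278), (62, 25116)] (.child (.branch 66 1 [(0, -2), (25, -1), (28, -1), (29, -1), (31, -1),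
  (32, 1), (34, 3)] (-36) [(0, 455), (11, 183), (30, 252), (51, 71), (64, 1092)] (.done [(0, 152),
  (1, 177), (4, 48), (14, 138), (64, 9516)])) (.child (.branch 68 1 [(0, -5), (24, -1), (29, 1),
  (31, -5), (32, -1), (33, -5), (34, 10)] 666 [(0, 91), (4, 21), (14, 60), (50, 25), (70, 14)]
  (.done [(0, 182), (7, 105), (11, 48), (51, 20), (61, 70)])) (.child (.branch 26 1 [(0, 2), (26,
  -2), (28, -1)] 492 [(0, 2639), (14, 783), (25, 945), (43, 336), (50, 986)] (.done [(0, 26), (7,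
  15), (32, 12), (64, 780), (65, 156)])) (.child (.branch 81 1 [(0, 1), (28, 1), (31, 3), (32,
  -1), (33, 1), (34, -3)] 360 [(0, 65), (7, 30), (32, 24), (64, 9672), (65, 6396)] (.done [(0,
  910), (10, 378), (14, 60), (25, 63), (50, 480)])) (.child (.branch 25 1 [(0, -5), (28, -1), (29,
  -1), (31, -4), (32, 3), (33, -1), (34, 8)] 48 [(0, 8450), (10, 1026), (25, 3051), (30, 4500),
  (51, 2500)] (.done [(0, 377), (15, 105), (32, 116), (46, 192), (64, 18096)])) (.child (.branch
  81 1 [(0, 1), (28, 1), (31, 3), (32, -1), (33, 1), (34, -3)] 432 [(0, 715), (7, 207), (32, 264),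
  (39, 328), (64, 36036)] (.done [(0, 910), (10, 378), (14, 60), (25, 63), (50, 480)])) (.child
  (.branch 66 1 [(0, -2), (25, -1), (28, -1), (29, -1), (31, -1), (32, 1), (34, 3)] 0 [(0, 143),
  (7, 3), (11, 54), (30, 84), (51, 19)] (.done [(0, 546), (4, 129), (46, 336), (50, 28), (70,
  150)])) (.child (.branch 25 1 [(0, -5), (28, -1), (29, -1), (31, -4), (32, 3), (33, -1), (34,
  8)] (-24) [(0, 650), (10, 162), (25, 87), (30, 500), (65, 39000)] (.done [(0, 377), (15, 105),
  (32, 116), (46, 192), (64, 18096)])) (.child (.branch 26 1 [(0, 2), (26, -2), (28, -1)] 456 [(0,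
  2639), (14, 783), (25, 945), (43, 336), (50, 986)] (.done [(0, 143), (7, 81), (32, 66), (39, 4),
  (64, 3432)])) (.child (.branch 24 1 [(0, 6), (28, -1), (29, 1), (32, 2), (33, 4), (34, -8)] 24
  [(0, 350), (2, 189), (7, 165), (51, 210), (61, 186)] (.done [(0, 182), (4, 144), (14, 27), (50,
  34), (70, 18)])) (.done [(0, 4550), (4, 2709), (21, 1134), (26, 675), (44, 850)]))))))))))))
  (.done [(0, 1), (7, 1), (61, 208)]))) (.done [(0, 15), (37, 14), (58, 1872), (59, 936)])))
  (.done [(0, 105), (3, 6), (24, 84), (43, 62), (56, 12012)]))) (.done [(0, 15), (22, 11), (54,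
  3328), (55, 1664)])))) (.done [(0, 57), (18, 42), (39, 6), (49, 35), (52, 6552)]))) (.done [(0,
  111), (18, 36), (37, 30), (47, 88), (50, 6084)]))) (.done [(0, 351), (5, 174), (30, 200)])))
  (.child (.branch 72 1 [(0, -1), (4, -1), (8, 1), (14, -1), (16, -1), (17, -1), (20, -1), (24,
  -2), (25, -2), (26, -1)] 156 [(0, 105), (14, 56), (18, 5), (27, 54), (48, 9828)] (.done [(0,
  1755), (7, 870), (16, 298), (30, 936), (49, 100386)])) (.done [(0, 546), (1, 369), (7, 30), (19,
  140), (46, 40560)])))) (.done [(0, 2124), (5, 87), (10, 1820), (17, 406), (44, 117624)])))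
  (.child (.branch 58 1 [(0, 2), (12, 2), (18, -1)] 858 [(0, 21), (8, 9), (26, 16)] (.done [(0,
  2124), (5, 87), (10, 1820), (17, 406), (44, 117624)])) (.done [(0, 1455), (10, 117), (19, 585),
  (24, 833), (42, 150579)])))) (.done [(0, 60), (8, 44), (42, 39)]))) (.child (.branch 45 1 [(0,
  -1), (4, 1), (10, -1), (11, -1), (16, -1), (19, -1), (20, 1), (22, -1)] 208 [(0, 15), (19, 11),
  (40, 3328), (41, 1664)] (.done [(0, 60), (8, 44), (42, 39)])) (.done [(0, 90), (17, 84), (40,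
  29)])))) (.done [(0, 485), (2, 86), (9, 270), (15, 54), (36, 69498)]))) (.done [(0, 24), (16,
  24), (35, 468), (36, 1)]))) (.done [(0, 1), (11, 1), (32, 26), (33, 13)]))) (.done [(0, 120),
  (12, 24), (27, 60), (31, 6084), (32, 73)])))) (.done [(0, 10), (14, 4), (25, 9)]))) (.child
  (.branch 49 1 [(0, 1), (8, 1)] (-78) [(0, 20), (7, 6), (28, 5148), (29, 4134), (34, 5)] (.child
  (contradictionTree4) (.done [(0, 10), (14, 4), (25, 9)]))) (.done [(0, 50), (5, 30), (12, 7),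
  (23, 57), (26, 12870)])))) (.done [(0, 2), (21, 1), (24, 702), (25, 702)]))) (.done [(0, 100),
  (4, 30), (8, 77), (19, 52), (22, 24960)]))) (.done [(0, 26), (6, 22), (14, 1), (21, 3978), (29,
  21)]))) (.done [(0, 30), (4, 37), (5, 50), (15, 12), (18, 9360)])))) (.done [(0, 2), (13, 1),
  (16, 702), (22, 1)]))) (.done [(0, 16), (1, 5), (10, 15), (11, 6), (15, 1170)])))

def contradictionTree6 : ContradictionTree :=
  .branch 17 3 [(2, -4), (3, 4), (4, 1), (5, 1)] (-312) [(0, 3), (3, 1), (7, 936), (8, 2), (15,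
  2)] (.child (.branch 16 1 [(0, 1), (1, 1)] 0 [(0, 3), (5, 2), (8, 624), (9, 1248), (17, 1)]
  (.child (.branch 6 2 [(1, -1), (2, 1), (4, -6), (5, 3), (7, 3)] (-156) [(0, 4), (11, 780), (12,
  5), (19, 4)] (.child (.branch 8 2 [(2, -1), (3, 1), (5, -1), (6, -2), (7, -2), (8, 1)] 780 [(0,
  12), (5, 15), (14, 10), (18, 7), (21, 5)] (.child (.branch 7 1 [(0, 1), (1, 1)] 156 [(0, 1), (2,
  1), (4, 1)] (.child (.branch 75 2 [(2, -1), (4, -1), (7, -3), (9, -3), (10, 3)] 468 [(0, 48),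
  (9, 39), (18, 52), (22, 67), (25, 53)] (.child (.branch 76 2 [(2, -1), (3, -1), (6, 1), (9, -3),
  (10, -3)] 780 [(0, 8), (11, 20), (19, 4212), (20, 9)] (.child (.branch 90 1 [(0, -1), (1, -1),
  (6, 1), (7, -1), (9, 3), (10, -2), (11, -2), (12, -1)] 0 [(0, 20), (1, 6), (5, 5), (21, 4524),
  (22, 3)] (.done [(0, 8), (13, 9), (22, 6), (26, 1), (29, 3)])) (.done [(0, 12), (3, 10), (19,
  1092), (20, 19), (27, 20)]))) (.done [(0, 76), (1, 134), (9, 22), (18, 141), (25, 78)]))) (.done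
  [(0, 8), (6, 10), (7, 5), (11, 3)]))) (.done [(0, 12), (4, 15), (9, 2), (14, 10), (21, 7)])))
  (.done [(0, 8), (2, 2), (3, 13), (7, 3), (11, 1872)]))) (.done [(0, 3), (1, 3), (10, 4), (14,
  1), (17, 2)]))) (.child (.branch 49 2 [(0, -1), (1, 1), (3, -2), (4, 2), (5, -1), (6, 2)] 0 [(0,
  2), (8, 312), (9, 312), (14, 1), (17, 1)] (.child (.branch 16 1 [(1, 1), (2, 1)] (-312) [(0, 3),
  (7, 1), (10, 624), (11, 1248), (17, 1)] (.child (.branch 7 2 [(2, 1), (3, -1), (5, 1), (6, -3),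
  (7, -2), (8, 1)] 468 [(0, 4), (1, 6), (13, 1092), (14, 1), (21, 2)] (.child (.branch 50 2 [(3,
  1), (4, -1), (6, 2), (8, -1), (9, -1)] 234 [(0, 2), (3, 2), (10, 1), (15, 936)] (.child (.branch
  48 1 [(0, -1), (3, 1)] 234 [(0, 2), (16, 312), (25, 1)] (.child (.branch 92 2 [(2, 1), (4, -2),
  (7, 1)] 468 [(0, 8), (7, 6), (19, 468), (20, 5), (27, 2)] (.child (.branch 6 2 [(6, -1), (7, 1),
  (9, -6), (10, 3), (12, 3)] (-234) [(0, 4), (21, 780), (22, 5), (29, 4)] (.child (.branch 8 1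
  [(0, -1), (4, 1)] 702 [(0, 16), (1, 5), (11, 15), (22, 1170), (28, 6)] (.child (.branch 75 2
  [(1, -1), (8, -1), (11, -3), (13, -3), (14, 3)] 663 [(0, 2), (3, 1), (8, 2), (13, 5), (25,
  1404)] (.child (.branch 77 1 [(0, -1), (2, -1), (3, -1), (10, -1), (13, -1), (14, -1)] 663 [(0,
  6), (5, 5), (23, 5), (26, 78), (27, 1014)] (.done [(0, 4), (10, 10), (15, 5), (27, 2340), (28,
  6)])) (.done [(0, 6), (1, 5), (21, 5), (24, 1014), (25, 78)]))) (.done [(0, 1), (19, 1), (23,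
  390), (31, 1)]))) (.child (.branch 8 1 [(0, -1), (4, 1)] 936 [(0, 8), (11, 10), (18, 5), (28,
  3)] (.child (.branch 76 1 [(1, -1), (2, -1), (9, -1), (12, -1), (13, -1)] 1092 [(0, 32), (2,
  49), (20, 13), (21, 18), (25, 10998)] (.done [(0, 54), (4, 53), (8, 74), (21, 45), (25, 9126)]))
  (.done [(0, 1), (23, 390), (29, 1)]))) (.done [(0, 8), (9, 5), (16, 10), (17, 3), (26, 3)]))))
  (.done [(0, 40), (2, 18), (14, 27), (15, 11), (19, 8424)]))) (.done [(0, 2), (17, 156), (18, 1),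
  (24, 1)]))) (.done [(0, 8), (3, 3), (11, 6), (14, 624), (23, 5)]))) (.done [(0, 1), (9, 1), (12,
  390), (13, 390)]))) (.child (.branch 48 2 [(2, 1), (3, -1), (5, 4), (6, -2)] 0 [(0, 2), (12,
  312), (21, 1)] (.child (.branch 50 1 [(0, -1), (2, 1)] 468 [(0, 6), (4, 3), (16, 2), (20, 5),
  (23, 1)] (.done [(0, 4), (4, 3), (14, 3120), (16, 12), (23, 1)])) (.done [(0, 8), (2, 7), (5,
  5), (14, 12), (18, 3)]))) (.done [(0, 3), (3, 3), (12, 4), (16, 1), (19, 2)])))) (.done [(0, 2),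
  (5, 1), (8, 312), (10, 2)]))) (.child (.branch 16 1 [(0, 1), (1, 1)] (-156) [(0, 2), (2, 1), (5,
  1), (8, 624), (9, 624)] (.child (.branch 48 2 [(1, 1), (2, -1), (4, 4), (5, -2)] 78 [(0, 2),
  (10, 312), (19, 1)] (.child (.branch 8 2 [(2, -1), (3, 1), (5, -1), (6, -2), (7, -2), (8, 1)]
  624 [(0, 16), (3, 15), (9, 5), (12, 3120), (18, 11)] (.child (contradictionTree5) (.child
  (.branch 90 2 [(0, -1), (3, 1), (4, -1), (6, 2), (9, -1)] (-117) [(0, 2), (8, 2), (10, 1), (15,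
  78)] (.child (.branch 6 2 [(4, -1), (5, 1), (7, -6), (8, 3), (10, 3)] (-312) [(0, 28), (4, 10),
  (10, 30), (18, 15), (25, 18)] (.child (.branch 7 1 [(0, 1), (2, 1)] 546 [(0, 28), (6, 38), (12,
  30), (20, 15), (27, 18)] (.done [(0, 8), (1, 16), (12, 15), (15, 3), (27, 6)])) (.child (.branch
  7 1 [(0, 1), (2, 1)] 312 [(0, 1), (2, 1), (6, 1)] (.child (.branch 77 1 [(1, -1), (2, -1), (6,
  1), (10, 1), (11, 1), (12, -1)] 663 [(0, 30), (1, 26), (8, 13), (17, 24), (26, 12)] (.child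
  (.branch 92 2 [(2, -1), (4, -1), (7, -1), (8, 1), (10, -5), (11, -1), (12, -2), (13, 3)] 468
  [(0, 56), (10, 30), (16, 6), (24, 59), (31, 26)] (.child (.branch 76 1 [(0, -1), (3, -1), (9,
  -1), (12, -1), (13, -1)] 702 [(0, 20), (4, 10), (12, 13), (30, 12)] (.child (.branch 91 1 [(1,
  1), (5, 1)] (-117) [(0, 2), (10, 1), (27, 156), (28, 1)] (.child (.branch 50 2 [(6, 2), (7, 1),
  (15, -1)] 78 [(0, 2), (29, 312), (34, 1)] (.child (.branch 49 1 [(0, 1), (9, 1)] 156 [(0, 2),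
  (30, 312), (31, 312), (36, 1), (39, 1)] (.child (.branch 30 3 [(1, -1), (12, -1), (13, 1), (16,
  2), (17, 2), (18, -4)] 546 [(0, 12), (12, 12), (34, 1)] (.child (.branch 32 1 [(0, 1), (11, -1),
  (13, -1), (14, 1), (16, -4), (17, 2), (19, 4)] (-156) [(0, 198), (5, 10), (9, 192), (34, 1560),
  (43, 5)] (.child (.branch 18 3 [(1, 1), (3, -1), (14, -1), (15, 1), (18, 2), (19, 1), (20, -2)]
  416 [(0, 1455), (2, 116), (9, 580), (16, 1242), (37, 74646)] (.child (.branch 19 3 [(2, -1), (4,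
  -1), (15, -1), (16, 1), (18, -2), (19, 6), (20, 5), (21, -3)] (-104) [(0, 2688), (4, 1990), (11,
  1624), (18, 2184), (32, 2109)] (.child (.branch 72 1 [(0, 1), (1, 1), (3, -1), (5, -1), (16,
  -1), (17, 1), (19, -4), (20, 1), (21, -2), (22, 3)] 0 [(0, 588), (3, 93), (6, 607), (10, 267),
  (28, 300)] (.done [(0, 30), (20, 24), (28, 6), (42, 11), (46, 14)])) (.child (.branch 47 1 [(0,
  -1), (1, 1), (3, -1), (5, -1), (8, -1), (11, -1), (19, -3), (20, 2)] 754 [(0, 180), (20, 66),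
  (28, 9), (42, 64), (46, 156)] (.done [(0, 594), (6, 576), (11, 104), (13, 234), (28, 169)]))
  (.done [(0, 30), (1, 15), (26, 24), (44, 11)])))) (.child (.branch 45 1 [(0, -1), (2, -1), (4,
  -1), (10, -1), (11, -1), (12, -1), (15, 1), (16, -1), (18, 3), (21, -2)] 169 [(0, 252), (4,
  198), (8, 286), (26, 176), (40, 65)] (.done [(0, 45), (18, 33), (40, 32)])) (.done [(0, 9), (2,
  9), (6, 13), (24, 8), (38, 14)])))) (.done [(0, 120), (14, 60), (22, 72), (36, 5), (40, 78)])))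
  (.child (.branch 33 1 [(0, -1), (2, -1), (10, -1), (16, 2), (17, -1), (18, -1), (19, -1)] 234
  [(0, 27), (4, 16), (22, 1), (34, 1716), (43, 10)] (.done [(0, 10), (2, 4), (36, 9)])) (.done
  [(0, 42), (2, 50), (20, 10), (34, 67), (41, 45)])))) (.done [(0, 18), (1, 4), (18, 2), (27, 9),
  (32, 9)]))) (.child (.branch 30 3 [(0, -1), (11, -1), (12, 1), (15, 2), (16, 2), (17, -4)] 468
  [(0, 12), (10, 12), (32, 1)] (.child (.branch 33 1 [(0, -1), (1, -1), (9, -1), (15, 2), (16,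
  -1), (17, -1), (18, -1)] 234 [(0, 16), (1, 1), (4, 9), (32, 2808), (41, 9)] (.done [(0, 15),
  (12, 6), (34, 14)])) (.child (.branch 32 1 [(0, 1), (10, -1), (12, -1), (13, 1), (15, -4), (16,
  2), (18, 4)] (-78) [(0, 336), (5, 30), (7, 354), (20, 15), (34, 10)] (.done [(0, 72), (4, 52),
  (12, 36), (20, 64), (34, 3)])) (.done [(0, 54), (2, 8), (18, 68), (24, 81), (39, 63)])))) (.done
  [(0, 40), (3, 12), (25, 10), (28, 18564), (30, 53)])))) (.done [(0, 100), (6, 30), (14, 13),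
  (26, 24960), (32, 12)]))) (.done [(0, 16), (18, 13), (21, 9), (33, 18)]))) (.done [(0, 2), (3,
  1), (22, 312), (23, 312)]))) (.done [(0, 30), (4, 26), (8, 13), (26, 12), (29, 24)]))) (.done
  [(0, 1), (15, 1), (18, 390), (19, 390)]))) (.done [(0, 16), (4, 8), (12, 15), (13, 6), (22,
  3)])))) (.done [(0, 2), (2, 1), (14, 624), (16, 2)]))) (.done [(0, 2), (6, 3), (9, 1), (12,
  624), (13, 156)])))) (.done [(0, 2), (7, 1), (11, 156), (12, 1), (16, 1)]))) (.done [(0, 3), (8,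
  1872), (10, 8), (14, 2), (17, 1)]))) (.done [(0, 3), (3, 1), (6, 1872), (8, 4), (12, 2)]))))

def contradictionTree7 : ContradictionTree :=
  .branch 50 2 [(0, 2), (4, 1), (14, -1)] 156 [(0, 2), (10, 1), (27, 702)] (.child (.branch 49 1
  [(0, 1), (8, 1)] 312 [(0, 2), (26, 1), (28, 312), (29, 312)] (.child (.branch 33 3 [(3, -2),
  (12, 2), (14, 1)] 78 [(0, 495), (2, 280), (7, 142), (11, 56), (30, 72072)] (.child (.branch 31 1
  [(0, 1), (7, -1), (10, -1), (15, 1), (16, -1), (17, 1), (18, -1)] (-156) [(0, 312), (5, 12), (7,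
  12), (13, 312), (34, 13)] (.done [(0, 18), (4, 26), (16, 16), (27, 3), (34, 18)])) (.child
  (.branch 30 1 [(0, -1), (2, -1), (7, -1), (15, 2), (16, -1), (17, -1), (18, -1)] 0 [(0, 1248),
  (7, 65), (10, 1107), (13, 90), (40, 160)] (.child (.branch 32 1 [(1, -1), (3, -1), (8, -1), (11,
  -1), (13, -1), (14, 1), (16, -2), (17, 1), (18, -1), (19, 3)] 0 [(0, 256), (1, 260), (9, 20),
  (15, 264), (36, 11)] (.done [(0, 24), (14, 24), (35, 468), (36, 1)])) (.done [(0, 99), (4, 5),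
  (9, 98), (13, 1), (32, 1287)]))) (.done [(0, 183), (11, 60), (14, 39), (32, 124), (38, 72)]))))
  (.done [(0, 564), (3, 316), (9, 264), (30, 425), (36, 62)]))) (.child (.branch 33 3 [(2, -2),
  (11, 2), (13, 1)] 78 [(0, 195), (5, 22), (9, 56), (26, 140), (28, 28392)] (.child (.branch 31 1
  [(0, 1), (6, -1), (9, -1), (14, 1), (15, -1), (16, 1), (17, -1)] (-156) [(0, 72), (5, 4), (11,
  72), (32, 3), (37, 2)] (.done [(0, 216), (4, 86), (14, 164), (25, 81), (28, 126)])) (.child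
  (.branch 32 1 [(0, -1), (1, -1), (6, -1), (9, -1), (11, -1), (12, 1), (14, -2), (15, 1), (16,
  -1), (17, 3)] (-234) [(0, 78), (7, 76), (11, 74), (30, 1014), (37, 5)] (.child (.branch 35 1
  [(1, 1), (9, -1), (12, 1), (13, -1), (18, -1)] 468 [(0, 12), (6, 8), (33, 156), (34, 3), (40,
  4)] (.child (.branch 19 3 [(2, 1), (8, -1), (13, 1), (14, -1), (16, 3), (17, 1), (18, 4), (19,
  -4)] (-468) [(0, 207), (8, 58), (15, 228), (32, 29), (34, 4524)] (.child (.branch 57 3 [(11,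
  -1), (15, 1), (17, -3), (18, -1), (19, -5), (20, 4)] 598 [(0, 57), (4, 27), (20, 29), (31, 8),
  (34, 48)] (.child (.branch 56 1 [(0, 1), (12, -1), (13, -1), (15, -1), (16, -1), (18, -1), (19,
  1), (20, 1), (21, 1)] 988 [(0, 30), (15, 4), (22, 26), (33, 13), (36, 3)] (.child (.branch 47 3
  [(5, 1), (9, -1), (11, -1), (17, -1), (19, 3), (20, -3), (21, -3), (22, -4)] 546 [(0, 96), (8,
  131), (21, 18), (24, 45), (40, 8424)] (.child (.branch 18 1 [(0, 1), (3, 1), (6, -1), (10, -1),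
  (12, -1), (18, -1), (20, 5), (21, -4), (22, -2), (23, -1)] 312 [(0, 192), (10, 281), (23, 246),
  (26, 167), (42, 60216)] (.child (.branch 45 1 [(1, -1), (4, -1), (7, -1), (14, -1), (21, -1),
  (22, 2), (24, 1)] 39 [(0, 15), (21, 11), (44, 3328), (45, 1664)] (.child (.branch 73 1 [(2, -1),
  (5, 1), (12, -1), (14, -1), (16, -1), (19, 1), (20, 1), (23, -5), (24, -6), (25, 2)] 624 [(0,
  78), (8, 18), (23, 8), (41, 13), (44, 71)] (.child (.branch 25 13 [(20, 1), (21, -1), (23, -16),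
  (24, 12), (25, 5), (26, 14)] (-372) [(0, 5057), (2, 702), (18, 4698), (22, 1084), (43, 1476)]
  (.child (.branch 24 1 [(0, 4), (21, 1), (22, -1), (24, 8), (25, -4), (27, -6)] (-240) [(0, 13),
  (20, 4), (31, 10), (50, 182), (51, 988)] (.done [(0, 1260), (1, 503), (4, 378), (12, 918), (24,
  238)])) (.child (.branch 26 1 [(0, -3), (21, -1), (22, 1), (24, -8), (25, 4), (27, 6)] 696 [(0,
  1079), (4, 684), (12, 348), (20, 288), (45, 443)] (.done [(0, 1053), (5, 38), (8, 838), (31,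
  324), (51, 18954)])) (.child (.branch 9 1 [(0, 5), (22, -1), (24, 8), (25, -5), (26, -2), (27,
  -5)] 372 [(0, 5499), (4, 3702), (20, 3552), (25, 560), (50, 361764)] (.done [(0, 8424), (5,
  5482), (8, 2948), (18, 2430), (34, 1377)])) (.child (.branch 24 1 [(0, 4), (21, 1), (22, -1),
  (24, 8), (25, -4), (27, -6)] (-276) [(0, 13), (20, 4), (31, 10), (50, 182), (51, 988)] (.done
  [(0, 2769), (4, 378), (12, 918), (24, 1244), (34, 2012)])) (.child (.branch 9 1 [(0, 5), (22,
  -1), (24, 8), (25, -5), (26, -2), (27, -5)] 264 [(0, 403), (4, 174), (20, 192), (27, 112), (50,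
  38532)] (.done [(0, 8424), (5, 5482), (8, 2948), (18, 2430), (34, 1377)])) (.child (.branch 68 1
  [(0, 1), (16, -1), (18, -1), (21, 1), (22, -1), (24, 3), (25, -4), (26, -3)] 900 [(0, 16614),
  (4, 10665), (12, 8100), (24, 4244), (34, 596)] (.done [(0, 351), (5, 46), (8, 68), (13, 81),
  (31, 216)])) (.child (.branch 24 1 [(0, 4), (21, 1), (22, -1), (24, 8), (25, -4), (27, -6)]
  (-312) [(0, 13), (20, 4), (31, 10), (50, 182), (51, 988)] (.done [(0, 2769), (4, 378), (12,
  918), (24, 1244), (34, 2012)])) (.child (.branch 9 1 [(0, 5), (22, -1), (24, 8), (25, -5), (26,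
  -2), (27, -5)] 336 [(0, 17173), (4, 10734), (12, 1680), (20, 11184), (50, 1393548)] (.done [(0,
  8424), (5, 5482), (8, 2948), (18, 2430), (34, 1377)])) (.done [(0, 1170), (6, 837), (16, 144),
  (22, 322), (32, 892)])))))))))) (.done [(0, 1701), (1, 812), (4, 334), (9, 972), (46, 12636)])))
  (.done [(0, 28), (2, 22), (46, 27)]))) (.done [(0, 81), (19, 64), (37, 29)]))) (.child (.branch
  45 1 [(0, -1), (3, -1), (6, -1), (13, -1), (20, -1), (21, 2), (23, 1)] 351 [(0, 285), (12, 64),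
  (19, 81), (40, 160), (42, 29952)] (.done [(0, 2826), (2, 2376), (5, 2574), (26, 825), (44,
  650)])) (.done [(0, 90), (10, 66), (15, 26), (40, 9126), (47, 13)])))) (.done [(0, 15), (19,
  11), (38, 1521), (39, 3042)]))) (.child (.branch 56 1 [(0, 1), (12, -1), (13, -1), (15, -1),
  (16, -1), (18, -1), (19, 1), (20, 1), (21, 1)] 1144 [(0, 96), (13, 18), (22, 67), (33, 52), (36,
  24)] (.done [(0, 15), (19, 11), (38, 1521), (39, 3042)])) (.done [(0, 975), (6, 72), (11, 360),
  (17, 982), (38, 198)])))) (.child (.branch 57 3 [(11, -1), (15, 1), (17, -3), (18, -1), (19,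
  -5), (20, 4)] 598 [(0, 57), (4, 27), (20, 29), (31, 8), (34, 48)] (.child (.branch 56 1 [(0, 1),
  (12, -1), (13, -1), (15, -1), (16, -1), (18, -1), (19, 1), (20, 1), (21, 1)] 988 [(0, 30), (15,
  4), (22, 26), (33, 13), (36, 3)] (.child (.branch 47 3 [(5, 1), (9, -1), (11, -1), (17, -1),
  (19, 3), (20, -3), (21, -3), (22, -4)] 546 [(0, 78), (6, 18), (8, 101), (24, 42), (40, 5148)]
  (.child (.branch 72 1 [(0, 1), (3, -1), (6, 1), (10, -1), (12, -1), (18, -1), (20, 2), (21, -1),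
  (22, 1), (23, -1)] 156 [(0, 285), (12, 156), (19, 144), (40, 10), (42, 28548)] (.done [(0, 174),
  (8, 192), (10, 203), (23, 18), (26, 261)])) (.child (.branch 73 1 [(0, -1), (3, 1), (10, -1),
  (12, -1), (14, -1), (17, 1), (18, 1), (21, -5), (22, -6), (23, 2)] 624 [(0, 78), (4, 18), (19,
  8), (37, 13), (40, 71)] (.child (.branch 55 3 [(8, -1), (18, -1), (21, -6), (22, 2), (23, -2),
  (24, 4)] 234 [(0, 2739), (2, 864), (6, 243), (14, 639), (39, 2272)] (.child (.branch 80 1 [(0,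
  1), (4, 1), (9, -1), (16, -1), (19, 1), (20, 1), (22, 1), (24, 1), (25, -2)] 676 [(0, 4262), (1,
  3208), (6, 1782), (9, 865), (30, 2217)] (.child (.branch 25 13 [(20, 1), (21, -1), (23, -16),
  (24, 12), (25, 5), (26, 14)] (-372) [(0, 5057), (6, 702), (18, 4698), (22, 1084), (43, 1476)]
  (.child (.branch 24 1 [(0, 4), (21, 1), (22, -1), (24, 8), (25, -4), (27, -6)] (-240) [(0, 91),
  (16, 75), (20, 28), (51, 624), (52, 8)] (.done [(0, 94939), (8, 34209), (10, 33588), (12,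
  18702), (34, 57064)])) (.child (.branch 26 1 [(0, -3), (21, -1), (22, 1), (24, -8), (25, 4),
  (27, 6)] 696 [(0, 1079), (8, 684), (12, 348), (20, 288), (45, 443)] (.done [(0, 107068), (4,
  70035), (10, 10440), (16, 45990), (31, 35028)])) (.child (.branch 9 1 [(0, 5), (22, -1), (24,
  8), (25, -5), (26, -2), (27, -5)] 372 [(0, 5499), (8, 3702), (20, 3552), (25, 560), (50,
  361764)] (.done [(0, 9061), (4, 4503), (10, 5616), (13, 4596), (52, 2826)])) (.child (.branch 24
  1 [(0, 4), (21, 1), (22, -1), (24, 8), (25, -4), (27, -6)] (-276) [(0, 377), (16, 105), (20,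
  116), (31, 192), (51, 18096)] (.done [(0, 94939), (8, 34209), (10, 33588), (12, 18702), (34,
  57064)])) (.child (.branch 9 1 [(0, 5), (22, -1), (24, 8), (25, -5), (26, -2), (27, -5)] 264
  [(0, 403), (8, 174), (20, 192), (27, 112), (50, 38532)] (.done [(0, 9061), (4, 4503), (10,
  5616), (13, 4596), (52, 2826)])) (.child (.branch 26 1 [(0, -3), (21, -1), (22, 1), (24, -8),
  (25, 4), (27, 6)] 732 [(0, 1079), (8, 684), (12, 348), (20, 288), (45, 443)] (.done [(0,
  107068), (4, 70035), (10, 10440), (16, 45990), (31, 35028)])) (.child (.branch 24 1 [(0, 4),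
  (21, 1), (22, -1), (24, 8), (25, -4), (27, -6)] (-312) [(0, 377), (16, 105), (20, 116), (31,
  192), (51, 18096)] (.done [(0, 94939), (8, 34209), (10, 33588), (12, 18702), (34, 57064)]))
  (.child (.branch 9 1 [(0, 5), (22, -1), (24, 8), (25, -5), (26, -2), (27, -5)] 336 [(0, 17173),
  (8, 10734), (12, 1680), (20, 11184), (50, 1393548)] (.done [(0, 9061), (4, 4503), (10, 5616),
  (13, 4596), (52, 2826)])) (.done [(0, 9347), (2, 7326), (8, 1944), (32, 2236), (46,
  171)])))))))))) (.done [(0, 111), (16, 36), (23, 36), (34, 58), (47, 468)]))) (.child (.branch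
  79 1 [(0, -1), (4, -1), (9, -1), (16, -1), (19, 1), (20, -1), (23, -2), (24, -4), (25, 2)] 1196
  [(0, 312), (4, 9), (6, 108), (30, 284), (44, 54)] (.done [(0, 105), (12, 60), (16, 56), (47,
  6396), (48, 12)])) (.done [(0, 432), (4, 432), (7, 33), (25, 286), (44, 137592)])))) (.done [(0,
  468), (5, 429), (20, 46), (22, 98), (50, 132)]))) (.done [(0, 90), (10, 66), (15, 26), (40,
  9126), (47, 13)])))) (.done [(0, 42), (4, 33), (38, 2600), (39, 5200)]))) (.child (.branch 56 1
  [(0, 1), (12, -1), (13, -1), (15, -1), (16, -1), (18, -1), (19, 1), (20, 1), (21, 1)] 1144 [(0,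
  96), (13, 18), (22, 67), (33, 52), (36, 24)] (.done [(0, 42), (4, 33), (38, 2600), (39, 5200)]))
  (.done [(0, 975), (6, 72), (11, 360), (17, 982), (38, 198)])))) (.done [(0, 57), (2, 8), (18,
  48), (29, 27), (32, 29)])))) (.done [(0, 5), (2, 2), (31, 2106)]))) (.done [(0, 24), (10, 24),
  (31, 468), (32, 1)]))) (.done [(0, 15), (2, 8), (9, 12), (12, 11), (30, 14)])))) (.done [(0,
  18), (1, 8), (33, 13)])))

def contradictionTree8 : ContradictionTree :=
  .branch 17 3 [(2, -4), (3, 4), (4, 1), (5, 1)] (-312) [(0, 2), (1, 1), (7, 624), (13, 1)]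
  (.child (.branch 50 2 [(0, 1), (1, -1), (3, 2), (5, -1), (6, -1)] 312 [(0, 4), (1, 3), (6, 1),
  (9, 1560), (10, 2)] (.child (.branch 49 2 [(1, -1), (2, 1), (4, -2), (5, 2), (6, -1), (7, 2)]
  156 [(0, 2), (8, 1), (10, 312), (11, 312)] (.child (.branch 48 1 [(0, 1), (1, -1)] 312 [(0, 2),
  (10, 1), (12, 312), (19, 1)] (.child (.branch 6 2 [(3, -1), (4, 1), (6, -6), (7, 3), (9, 3)]
  (-78) [(0, 8), (2, 4), (9, 9), (15, 1872), (21, 3)] (.child (.branch 91 2 [(0, 1), (1, -2), (10,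
  1)] 117 [(0, 8), (4, 8), (17, 2028), (18, 13)] (.child (.branch 8 2 [(5, -1), (6, 1), (8, -1),
  (9, -2), (10, -2), (11, 1)] 858 [(0, 2), (11, 3), (16, 1), (19, 156), (20, 2)] (.child (.branch
  75 1 [(0, -1), (1, -1), (7, 1), (9, -2), (10, -2), (11, -3), (12, 2)] 897 [(0, 8), (13, 10),
  (18, 10), (21, 1092), (22, 11)] (.child (.branch 77 2 [(1, -1), (7, 1), (8, 1), (10, 3), (11,
  -3), (13, -3)] 117 [(0, 8), (1, 8), (15, 20), (23, 4212), (24, 9)] (.child (.branch 76 1 [(0,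
  1), (1, 1)] 1014 [(0, 8), (17, 20), (25, 4212), (26, 9)] (.child (.branch 92 1 [(1, -1), (3,
  -1), (4, -1), (9, 1), (12, 1), (13, -3), (14, -1), (15, -1)] 468 [(0, 32), (19, 18), (21, 33),
  (28, 4), (33, 1)] (.child (.branch 30 3 [(9, -1), (10, -1), (11, 1), (14, 2), (15, 2), (16, -4)]
  0 [(0, 12), (4, 12), (7, 12), (30, 1)] (.child (.branch 35 1 [(0, -1), (5, -1), (7, -1), (10,
  -1), (11, 1), (12, -1), (14, 2), (15, -1), (16, -1), (17, -2)] 468 [(0, 15), (6, 6), (31, 3276),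
  (32, 7)] (.child (.branch 18 3 [(1, 1), (11, -1), (12, -1), (13, 1), (16, 2), (17, 1), (18, -2)]
  0 [(0, 936), (5, 377), (8, 891), (11, 630), (39, 232)] (.child (.branch 19 3 [(2, -1), (12, -1),
  (13, -1), (14, 1), (16, -2), (17, 6), (18, 5), (19, -3)] (-624) [(0, 288), (7, 58), (13, 234),
  (15, 29), (35, 9048)] (.child (.branch 47 1 [(0, -1), (1, 1), (3, -1), (6, -1), (9, -1), (13,
  -1), (14, -1), (15, -1), (17, -1), (18, 4), (19, 2), (20, -3)] 858 [(0, 21), (6, 16), (12, 9)]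
  (.done [(0, 1920), (7, 470), (17, 252), (24, 780), (43, 1313)])) (.child (.branch 73 1 [(0, -1),
  (1, -1), (17, 1), (18, 1), (19, 1), (20, -1)] 468 [(0, 15), (7, 16), (12, 8), (36, 1300), (37,
  1508)] (.child (.branch 54 3 [(13, -1), (15, -1), (16, -1), (18, -4), (19, 6), (20, 2), (21, 2)]
  (-416) [(0, 180), (9, 66), (19, 156), (40, 64), (45, 9)] (.child (.branch 58 1 [(0, 2), (7, 2),
  (16, -1)] 1040 [(0, 21), (10, 9), (16, 16)] (.done [(0, 2880), (11, 1170), (21, 1172), (28,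
  580), (47, 2043)])) (.child (.branch 57 3 [(12, -1), (17, 1), (19, -3), (20, -1), (21, -5), (22,
  4)] 806 [(0, 2688), (10, 2109), (11, 2184), (16, 1990), (28, 1624)] (.child (.branch 55 1 [(0,
  1), (1, 1), (13, -1), (15, -1), (16, -1), (18, 1), (20, -3), (21, 1), (22, -1), (23, 2)] 624
  [(0, 45), (13, 33), (44, 32)] (.done [(0, 360), (5, 141), (15, 284), (18, 80), (35, 130)]))
  (.child (.branch 59 1 [(0, -1), (1, -1), (11, -1), (13, -1), (15, -1), (17, 1), (21, -1), (22,
  -2), (23, 1)] 390 [(0, 336), (5, 294), (12, 57), (18, 134), (43, 4368)] (.done [(0, 2103), (2,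
  174), (13, 1638), (30, 812), (43, 88218)])) (.done [(0, 165), (3, 90), (19, 10), (21, 36), (47,
  84)])))) (.done [(0, 18), (14, 8), (31, 13)])))) (.done [(0, 390), (12, 252), (15, 372), (38,
  143), (43, 110)]))) (.done [(0, 405), (5, 378), (10, 320), (27, 145), (36, 162)])))) (.child
  (.branch 19 3 [(2, -1), (12, -1), (13, -1), (14, 1), (16, -2), (17, 6), (18, 5), (19, -3)]
  (-624) [(0, 288), (7, 58), (13, 234), (15, 29), (35, 9048)] (.child (.branch 73 1 [(0, -1), (1,
  -1), (17, 1), (18, 1), (19, 1), (20, -1)] 468 [(0, 105), (1, 60), (7, 56), (36, 13572), (37,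
  17316)] (.child (.branch 46 1 [(1, -1), (4, 1), (9, -1), (10, -1), (14, -1), (18, -2), (19, 1),
  (20, -2), (21, 2)] 741 [(0, 15), (9, 11), (14, 11), (38, 1378), (39, 3185)] (.done [(0, 12), (1,
  15), (8, 16), (26, 36), (40, 21)])) (.done [(0, 390), (12, 252), (15, 372), (38, 143), (43,
  110)]))) (.child (.branch 47 1 [(0, -1), (1, 1), (3, -1), (6, -1), (9, -1), (13, -1), (14, -1),
  (15, -1), (17, -1), (18, 4), (19, 2), (20, -3)] 858 [(0, 21), (6, 16), (12, 9)] (.done [(0,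
  1920), (7, 470), (17, 252), (24, 780), (43, 1313)])) (.done [(0, 405), (5, 378), (10, 320), (27,
  145), (36, 162)])))) (.done [(0, 15), (3, 14), (34, 6)])))) (.done [(0, 10), (1, 2), (29, 1404),
  (30, 936), (37, 5)]))) (.child (.branch 31 1 [(0, -1), (9, -1), (11, 1), (12, -1), (14, 4), (16,
  2), (17, -3)] (-624) [(0, 307), (2, 5), (9, 288), (19, 15), (37, 20)] (.child (.branch 18 3 [(1,
  1), (11, -1), (12, -1), (13, 1), (16, 2), (17, 1), (18, -2)] 52 [(0, 18), (5, 26), (8, 18), (34,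
  15), (39, 16)] (.child (.branch 19 3 [(2, -1), (12, -1), (13, -1), (14, 1), (16, -2), (17, 6),
  (18, 5), (19, -3)] (-676) [(0, 288), (7, 58), (13, 234), (15, 29), (35, 9048)] (.child (.branch
  47 1 [(0, -1), (1, 1), (3, -1), (6, -1), (9, -1), (13, -1), (14, -1), (15, -1), (17, -1), (18,
  4), (19, 2), (20, -3)] 806 [(0, 45), (12, 33), (37, 7488), (38, 16)] (.done [(0, 2160), (17,
  448), (24, 1700), (31, 705), (43, 1107)])) (.child (.branch 74 1 [(0, 1), (1, 1), (3, 1), (13,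
  -1), (14, -1), (15, 1), (17, -5), (19, -5), (20, 5)] 1092 [(0, 45), (5, 24), (12, 24), (37,
  4680), (38, 1)] (.done [(0, 15), (17, 6), (43, 14)])) (.done [(0, 33), (3, 29), (22, 9), (27,
  9), (36, 18)])))) (.child (.branch 45 1 [(0, -1), (2, -1), (5, -1), (12, -1), (13, -1), (14,
  -1), (16, 3), (17, 2), (18, 2), (19, -4)] 455 [(0, 312), (3, 85), (22, 425), (29, 147), (35,
  53040)] (.done [(0, 28), (2, 22), (36, 27)])) (.done [(0, 39), (1, 8), (20, 40), (27, 51), (33,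
  4992)])))) (.done [(0, 171), (6, 136), (18, 71), (25, 146), (28, 123)]))) (.done [(0, 24), (4,
  24), (16, 120), (29, 15444), (30, 97)])))) (.done [(0, 5), (2, 1), (5, 2), (26, 1248), (27,
  1248)]))) (.done [(0, 20), (1, 10), (5, 13), (31, 12)]))) (.done [(0, 20), (10, 18), (17, 23),
  (20, 9), (23, 1404)]))) (.done [(0, 30), (1, 26), (5, 13), (27, 24), (28, 12)]))) (.child
  (.branch 7 1 [(0, 1), (2, 1)] 1014 [(0, 4), (2, 4), (8, 8), (21, 1404), (22, 9)] (.done [(0, 1),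
  (5, 1), (21, 390), (27, 1)])) (.done [(0, 1), (19, 390), (25, 1)])))) (.done [(0, 2), (1, 1),
  (16, 312)]))) (.child (.branch 75 2 [(0, -1), (4, -1), (7, -3), (9, -3), (10, 3)] 1014 [(0, 4),
  (2, 10), (9, 20), (17, 3276), (18, 3)] (.child (.branch 7 2 [(5, 1), (6, -1), (8, 1), (9, -3),
  (10, -2), (11, 1)] 780 [(0, 4), (4, 8), (11, 12), (19, 1404), (20, 3)] (.child (.branch 90 2
  [(0, -1), (2, -1), (9, -4), (10, 3), (12, 2)] (-234) [(0, 2), (21, 702), (27, 1)] (.child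
  (.branch 92 1 [(0, -1), (1, -1), (2, -1), (3, -1), (7, -1), (8, -1), (10, -4), (11, 1), (12,
  -2), (13, 3)] 936 [(0, 8), (8, 8), (15, 12), (23, 780), (24, 7)] (.done [(0, 2), (3, 1), (22,
  312), (23, 312)])) (.done [(0, 18), (2, 1), (6, 7), (13, 24), (22, 6)]))) (.done [(0, 8), (11,
  15), (19, 6240), (25, 13), (26, 3)]))) (.done [(0, 16), (9, 13), (17, 8112), (23, 31), (24,
  9)]))) (.done [(0, 1), (14, 390), (22, 1)])))) (.done [(0, 2), (13, 156), (14, 1), (20, 1)])))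
  (.done [(0, 12), (3, 3), (12, 8), (17, 7), (18, 5)]))) (.done [(0, 4), (1, 2), (3, 1), (15,
  3)]))) (.child (.branch 16 1 [(0, 1), (1, 1)] (-156) [(0, 3), (8, 624), (9, 1248), (15, 2), (16,
  1)] (.child (.branch 48 2 [(1, 1), (2, -1), (4, 4), (5, -2)] 156 [(0, 2), (8, 1), (10, 312),
  (17, 1)] (.child (.branch 6 2 [(2, -1), (3, 1), (5, -6), (6, 3), (8, 3)] (-156) [(0, 16), (7,
  15), (10, 6), (13, 3120), (19, 11)] (.child (.branch 7 2 [(3, 1), (4, -1), (6, 1), (7, -3), (8,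
  -2), (9, 1)] 624 [(0, 8), (1, 5), (9, 15), (12, 3), (14, 1170)] (.child (.branch 8 1 [(0, 1),
  (1, -1)] 780 [(0, 1), (2, 1), (3, 1)] (.child (.branch 75 2 [(2, -1), (5, -1), (8, -3), (10,
  -3), (11, 3)] 858 [(0, 10), (5, 13), (13, 14), (16, 12), (20, 3)] (.child (.branch 91 1 [(0,
  -1), (2, -1), (3, -1), (6, -1), (7, -1), (9, -4), (10, 1), (11, -2), (12, 3)] 234 [(0, 8), (3,
  2), (15, 6), (21, 624), (22, 1)] (.child (.branch 76 2 [(3, -1), (8, 1), (11, -3), (12, -3)] 858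
  [(0, 24), (2, 22), (9, 51), (20, 20), (24, 26)] (.child (.branch 77 1 [(0, 1), (2, -1)] 468 [(0,
  6), (7, 5), (11, 10), (26, 6)] (.done [(0, 16), (19, 13), (22, 18), (31, 9)])) (.done [(0, 270),
  (2, 130), (5, 117), (20, 160), (29, 268)]))) (.done [(0, 2), (7, 1), (20, 312)]))) (.done [(0,
  30), (1, 32), (5, 25), (20, 15), (25, 18)]))) (.done [(0, 1), (17, 390), (23, 1)]))) (.done [(0,
  58), (1, 38), (6, 60), (16, 15), (21, 18)]))) (.child (.branch 91 2 [(0, 1), (1, -2), (9, 1)]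
  117 [(0, 2), (2, 1), (15, 156), (16, 1)] (.child (.branch 8 2 [(4, -1), (5, 1), (7, -1), (8,
  -2), (9, -2), (10, 1)] 780 [(0, 12), (9, 15), (14, 7), (18, 10), (24, 2)] (.child (.branch 75 1
  [(0, -1), (1, -1), (6, 1), (8, -2), (9, -2), (10, -3), (11, 2)] 975 [(0, 48), (11, 39), (16,
  67), (20, 52), (26, 14)] (.child (.branch 7 1 [(1, 1), (3, 1)] 858 [(0, 10), (2, 4), (15, 10),
  (20, 1872), (22, 3)] (.child (.branch 90 2 [(2, -1), (7, 1), (8, -1), (10, 2), (13, -1)] (-234)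
  [(0, 2), (5, 1), (23, 312)] (.child (.branch 92 1 [(0, -1), (4, 1)] 819 [(0, 2), (4, 1), (24,
  312), (26, 2)] (.done [(0, 4), (16, 3), (24, 780), (25, 156), (32, 1)])) (.done [(0, 2), (2, 1),
  (22, 1014), (24, 2), (30, 1)]))) (.done [(0, 6), (1, 2), (12, 4), (20, 1170), (28, 3)]))) (.done
  [(0, 16), (10, 13), (25, 18), (26, 9)]))) (.child (.branch 75 1 [(0, -1), (1, -1), (6, 1), (8,
  -2), (9, -2), (10, -3), (11, 2)] 741 [(0, 32), (2, 31), (13, 13), (16, 18), (19, 3978)] (.child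
  (.branch 76 2 [(1, -1), (3, -1), (7, 1), (10, -3), (11, -3)] 624 [(0, 6), (4, 5), (20, 1014),
  (21, 936), (28, 5)] (.child (.branch 77 1 [(0, 1), (1, -1)] 351 [(0, 2), (3, 4), (6, 5), (23,
  936)] (.done [(0, 122), (1, 100), (6, 65), (20, 120), (24, 78)])) (.child (.branch 77 1 [(0, 1),
  (1, -1)] 117 [(0, 1), (2, 1), (3, 1)] (.child (.branch 90 1 [(1, -1), (3, -1), (4, -1), (5, -1),
  (8, 1), (9, 1), (11, -2), (12, -1), (13, -2), (14, 1)] (-351) [(0, 5), (3, 1), (5, 1), (25,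
  1248)] (.child (contradictionTree7) (.done [(0, 10), (8, 9), (31, 4)]))) (.done [(0, 16), (10,
  9), (17, 13), (20, 9), (22, 3510)]))) (.done [(0, 20), (1, 10), (8, 13), (18, 12), (27, 12)]))))
  (.done [(0, 16), (10, 13), (25, 18), (26, 9)]))) (.done [(0, 1), (17, 390), (23, 1)])))) (.done
  [(0, 2), (14, 702), (22, 1)]))) (.done [(0, 1), (12, 390), (20, 1)])))) (.done [(0, 2), (11,
  156), (12, 1), (18, 1)]))) (.done [(0, 1), (1, 1), (3, 1)]))) (.child (.branch 50 2 [(0, 1), (1,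
  -1), (3, 2), (5, -1), (6, -1)] 234 [(0, 2), (6, 1), (9, 312), (16, 1)] (.child (.branch 16 1
  [(1, 1), (2, 1)] (-468) [(0, 3), (7, 1), (10, 624), (11, 1248), (17, 1)] (.child (.branch 48 2
  [(2, 1), (3, -1), (5, 4), (6, -2)] 234 [(0, 2), (1, 1), (6, 2), (12, 936)] (.child (.branch 49 1
  [(0, 1), (2, 1)] 468 [(0, 2), (3, 2), (8, 1), (14, 936), (15, 936)] (.done [(0, 12), (3, 3),
  (16, 4), (21, 8), (22, 7)])) (.done [(0, 2), (13, 156), (14, 1), (20, 1)]))) (.child (.branch 48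
  2 [(2, 1), (3, -1), (5, 4), (6, -2)] 234 [(0, 2), (2, 1), (7, 2), (12, 936)] (.child (.branch 49
  1 [(0, 1), (2, 1)] 468 [(0, 8), (4, 3), (12, 6), (14, 624), (22, 1)] (.done [(0, 4), (4, 3),
  (14, 2496), (16, 12), (22, 1)])) (.done [(0, 2), (13, 156), (14, 1), (20, 1)]))) (.done [(0, 6),
  (3, 3), (8, 3), (12, 4), (14, 4)])))) (.done [(0, 2), (8, 624), (10, 2), (15, 1)]))) (.done [(0,
  3), (4, 1), (6, 1872), (8, 4), (14, 2)]))))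

def contradictionTree9 : ContradictionTree :=
  .branch 16 1 [(0, 1), (1, 1)] (-468) [(0, 3), (5, 1), (8, 624), (9, 1248), (15, 1)] (.child
  (.branch 7 2 [(1, 1), (2, -1), (4, 1), (5, -3), (6, -2), (7, 1)] 780 [(0, 8), (1, 15), (8, 3),
  (11, 3120), (17, 5)] (.child (.branch 50 2 [(2, 1), (3, -1), (5, 2), (7, -1), (8, -1)] 312 [(0,
  2), (3, 2), (8, 1), (13, 936)] (.child (.branch 92 2 [(1, -1), (3, -1), (4, 1), (6, -5), (7,
  -1), (8, -2), (9, 3)] 702 [(0, 8), (5, 12), (15, 2340), (16, 1), (21, 4)] (.child (.branch 6 2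
  [(4, -1), (5, 1), (7, -6), (8, 3), (10, 3)] (-78) [(0, 8), (7, 15), (14, 3), (17, 6240), (23,
  13)] (.child (.branch 76 1 [(0, -1), (1, -1), (6, -1), (9, -1), (10, -1)] 1092 [(0, 20), (1,
  22), (9, 25), (19, 7020), (26, 3)] (.child (.branch 48 2 [(6, 1), (7, -1), (9, 4), (10, -2)] 78
  [(0, 2), (18, 1), (20, 312), (27, 1)] (.child (.branch 49 1 [(0, 1), (4, 1)] 390 [(0, 2), (20,
  1), (22, 312), (23, 312)] (.done [(0, 40), (4, 24), (23, 2964), (24, 33), (29, 40)])) (.done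
  [(0, 40), (2, 24), (21, 9204), (22, 33), (27, 20)]))) (.done [(0, 30), (2, 13), (19, 5070), (25,
  25), (27, 12)]))) (.child (.branch 8 1 [(0, -1), (3, 1)] 1092 [(0, 2), (9, 3), (18, 624), (19,
  468), (26, 1)] (.child (.branch 90 2 [(0, -1), (3, 2), (11, 1)] (-234) [(0, 2), (21, 702), (27,
  1)] (.child (.branch 75 1 [(0, -1), (2, -1), (3, -1), (5, -1), (7, -1), (8, -1), (10, -4), (11,
  1), (12, -2), (13, 3)] 936 [(0, 16), (4, 9), (13, 13), (20, 9), (23, 3510)] (.child (.branch 77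
  1 [(1, -1), (3, -1), (8, 1), (12, 1), (13, 1), (14, -1)] (-78) [(0, 4), (1, 2), (24, 1014), (32,
  5)] (.child (.branch 91 1 [(2, 1), (5, 1)] 0 [(0, 2), (10, 1), (27, 156), (28, 1)] (.child
  (.branch 48 2 [(0, -2), (5, 1), (16, 1)] 78 [(0, 20), (3, 6), (28, 5148), (29, 1014), (35, 5)]
  (.child (.branch 49 1 [(0, 1), (8, 1)] 390 [(0, 20), (5, 6), (12, 5), (30, 5148), (31, 6084)]
  (.child (.branch 35 3 [(10, -1), (12, -1), (13, 1), (15, -5), (16, 2), (17, -2), (18, 1)] 312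
  [(0, 474), (2, 516), (9, 60), (34, 409), (40, 366)] (.child (.branch 30 1 [(0, -1), (10, -1),
  (11, -1), (13, 1), (14, -1), (16, 2), (17, -1), (18, -1), (19, -2)] 156 [(0, 78), (7, 52), (11,
  36), (41, 5), (42, 74)] (.done [(0, 42), (4, 120), (25, 30), (36, 82), (41, 45)])) (.done [(0,
  636), (2, 378), (5, 128), (23, 261), (39, 575)]))) (.done [(0, 12), (21, 3), (27, 7), (32, 4),
  (37, 1)]))) (.child (.branch 33 3 [(2, -2), (12, 2), (14, 1)] 156 [(0, 99), (2, 112), (5, 6),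
  (12, 28), (31, 19656)] (.child (.branch 31 1 [(0, 1), (1, -1), (7, -1), (10, -1), (12, -1), (13,
  1), (15, -5), (16, 2), (17, 1), (18, 2)] (-312) [(0, 78), (9, 72), (39, 10), (40, 5)] (.done
  [(0, 99), (4, 5), (7, 48), (14, 125), (33, 25974)])) (.child (.branch 30 1 [(0, -1), (7, -1),
  (9, -1), (10, -1), (12, -1), (13, 1), (15, -4), (16, 2), (17, -1), (18, 2)] 156 [(0, 78), (5,
  52), (9, 36), (39, 5), (40, 74)] (.child (.branch 34 1 [(1, -1), (11, -1), (13, -1), (14, 1),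
  (16, -3), (17, 1), (18, -2), (19, 3)] 156 [(0, 10), (9, 2), (16, 5), (34, 1456), (35, 3848)]
  (.child (.branch 18 3 [(2, -1), (9, -1), (12, -1), (17, 2), (19, 1), (20, -2)] (-104) [(0, 15),
  (4, 14), (36, 1872), (37, 936)] (.child (.branch 45 1 [(0, -1), (3, 1), (8, -1), (10, -1), (15,
  1), (16, -1), (18, 1), (19, 1), (20, 1), (21, -1)] 182 [(0, 15), (13, 11), (38, 3328), (39,
  1664)] (.child (.branch 19 3 [(4, 1), (11, -1), (14, -1), (19, -3), (20, 4), (21, 4), (22, -1)]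
  (-676) [(0, 15), (17, 14), (40, 754), (41, 1508)] (.child (.branch 20 1 [(0, 1), (2, -1)] (-104)
  [(0, 6), (5, 3), (43, 1872), (49, 7)] (.done [(0, 66), (10, 26), (15, 16), (24, 73), (43,
  10686)])) (.child (.branch 72 1 [(0, 1), (2, 1), (5, 1), (12, -1), (15, -1), (20, -5), (21, -1),
  (22, -3), (23, 5)] 156 [(0, 9), (14, 4), (17, 6), (43, 1014), (49, 5)] (.child (.branch 54 3
  [(7, -1), (15, -1), (18, -1), (19, -1), (21, -4), (22, 6), (23, 2), (24, 2)] (-364) [(0, 252),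
  (2, 9), (28, 142), (45, 56784), (51, 154)] (.child (.branch 57 3 [(14, -1), (20, 1), (22, -3),
  (23, -1), (24, -5), (25, 4)] 780 [(0, 42), (16, 9), (21, 16), (28, 49), (47, 13104)] (.child
  (.branch 78 1 [(0, -1), (1, 1), (9, -1), (15, -1), (17, -1), (20, 1), (21, -1), (23, 2), (24,
  -3), (25, -4), (26, 2)] 1040 [(0, 96), (11, 81), (30, 61), (39, 6), (49, 8190)] (.done [(0, 9),
  (16, 6), (21, 4), (49, 2340), (55, 7)])) (.child (.branch 55 1 [(0, 1), (1, 1), (9, -1), (15,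
  -1), (20, -1), (21, -1), (23, -1), (24, 1), (25, 1), (26, 1)] 572 [(0, 126), (11, 99), (50, 50)]
  (.child (.branch 59 1 [(0, 2), (12, 2), (22, 1)] 208 [(0, 351), (11, 174), (18, 200)] (.child
  (.branch 80 1 [(2, -1), (3, 1), (11, -1), (17, -1), (19, -1), (22, 1), (25, 3), (26, -3), (27,
  -3)] 572 [(0, 9), (20, 6), (25, 4), (34, 5), (53, 1014)] (.child (.branch 21 13 [(23, 1), (26,
  3), (27, -8), (28, -19), (29, 5)] 672 [(0, 143), (26, 24), (29, 28), (36, 182), (55, 55692)]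
  (.child (.branch 12 1 [(0, -5), (25, -1), (27, 3), (28, -4), (29, -8), (30, 1)] 1164 [(0, 91),
  (4, 24), (38, 105), (57, 14742), (64, 3)] (.done [(0, 3080), (1, 2787), (14, 1074), (19, 576),
  (57, 616668)])) (.child (.branch 84 1 [(0, -5), (22, -1), (24, 1), (25, 1), (27, -1), (28, -5),
  (29, -10), (30, 5)] 828 [(0, 429), (10, 111), (31, 364), (38, 19), (56, 7488)] (.done [(0, 160),
  (1, 45), (24, 144), (56, 312), (57, 4836)])) (.child (.branch 12 1 [(0, -5), (25, -1), (27, 3),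
  (28, -4), (29, -8), (30, 1)] 1272 [(0, 1846), (4, 483), (17, 54), (38, 2163), (57, 311220)]
  (.done [(0, 182), (14, 27), (40, 34), (57, 52416), (63, 210)])) (.child (.branch 29 1 [(0, 3),
  (27, -2), (28, 2), (29, 4)] 468 [(0, 1001), (8, 504), (14, 96), (40, 488), (57, 5460)] (.done
  [(0, 715), (4, 144), (24, 264), (29, 496), (57, 36036)])) (.child (.branch 13 1 [(0, 6), (24,
  -1), (25, 1), (27, -2), (28, 4), (29, 9), (30, -3)] 528 [(0, 143), (4, 75), (24, 66), (29, 20),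
  (57, 3432)] (.done [(0, 1001), (8, 630), (14, 549), (40, 38), (57, 45864)])) (.child (.branch 12
  1 [(0, -5), (25, -1), (27, 3), (28, -4), (29, -8), (30, 1)] 1200 [(0, 91), (4, 24), (38, 105),
  (57, 14742), (64, 3)] (.done [(0, 182), (14, 27), (40, 34), (57, 52416), (63, 210)])) (.child
  (.branch 22 1 [(0, 4), (24, -1), (25, -1), (28, 3), (29, 6), (30, -3)] 744 [(0, 273), (4, 75),
  (38, 112), (57, 32760), (64, 180)] (.done [(0, 429), (14, 315), (28, 40), (57, 17160), (63,
  176)])) (.child (.branch 29 1 [(0, 3), (27, -2), (28, 2), (29, 4)] 432 [(0, 1001), (8, 504),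
  (14, 96), (40, 488), (57, 5460)] (.done [(0, 715), (4, 144), (24, 264), (29, 496), (57,
  36036)])) (.child (.branch 27 1 [(0, 1), (24, -1), (27, -1), (28, 3), (29, 3), (30, -1)] (-288)
  [(0, 65), (24, 16), (33, 40), (56, 9308), (57, 12064)] (.done [(0, 1080), (2, 350), (8, 102),
  (19, 297), (47, 800)])) (.done [(0, 208), (4, 51), (19, 18), (55, 27066), (61, 247)])))))))))))
  (.done [(0, 21), (10, 9), (36, 16)]))) (.done [(0, 15), (25, 14), (50, 1872), (51, 936)])))
  (.done [(0, 15), (16, 11), (48, 3328), (49, 1664)]))) (.done [(0, 21), (11, 9), (23, 16)]))))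
  (.child (.branch 58 1 [(0, -1), (8, -1), (16, -1), (17, -1), (19, 1), (23, -1), (24, -2), (25,
  1)] 988 [(0, 702), (7, 174), (14, 200), (28, 819), (47, 219024)] (.done [(0, 142), (2, 4), (4,
  81), (47, 12636), (53, 108)])) (.done [(0, 1188), (12, 282), (17, 512), (26, 961), (45,
  63102)])))) (.done [(0, 12), (10, 6), (24, 5), (43, 1014), (50, 6)]))) (.done [(0, 6), (3, 3),
  (22, 7), (41, 858)])))) (.done [(0, 60), (6, 44), (40, 39)]))) (.child (.branch 45 1 [(0, -1),
  (3, 1), (8, -1), (10, -1), (15, 1), (16, -1), (18, 1), (19, 1), (20, 1), (21, -1)] 494 [(0, 15),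
  (13, 11), (38, 3328), (39, 1664)] (.done [(0, 60), (6, 44), (40, 39)])) (.done [(0, 90), (11,
  84), (38, 29)])))) (.done [(0, 80), (2, 22), (25, 30), (36, 22), (41, 55)]))) (.done [(0, 1),
  (7, 1), (32, 26), (33, 13)]))) (.done [(0, 6), (32, 3), (37, 2), (38, 4)])))) (.done [(0, 2),
  (29, 156), (30, 1), (36, 1)])))) (.done [(0, 2), (26, 702), (34, 1)]))) (.done [(0, 32), (8,
  31), (15, 13), (22, 18), (24, 3978)]))) (.done [(0, 32), (18, 13), (23, 8112), (29, 49), (30,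
  18)]))) (.done [(0, 10), (2, 9), (27, 4)]))) (.done [(0, 1), (19, 390), (25, 1)]))) (.done [(0,
  1), (16, 390), (24, 1)])))) (.done [(0, 4), (10, 3), (14, 156), (15, 780), (21, 1)]))) (.done
  [(0, 8), (3, 3), (12, 624), (19, 6), (20, 1)]))) (.done [(0, 16), (6, 15), (11, 3120), (17, 11),
  (18, 6)]))) (.child (.branch 7 2 [(1, 1), (2, -1), (4, 1), (5, -3), (6, -2), (7, 1)] 546 [(0,
  2), (8, 2), (10, 780), (12, 5)] (.child (.branch 50 2 [(2, 1), (3, -1), (5, 2), (7, -1), (8,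
  -1)] 312 [(0, 6), (4, 3), (10, 5), (14, 2), (20, 4)] (.child (.branch 49 2 [(3, -1), (4, 1), (6,
  -2), (7, 2), (8, -1), (9, 2)] 156 [(0, 8), (6, 3), (12, 6), (14, 624), (22, 1)] (.child (.branch
  48 1 [(0, 1), (1, -1)] 312 [(0, 2), (14, 1), (16, 312), (23, 1)] (.child (.branch 6 2 [(5, -1),
  (6, 1), (8, -6), (9, 3), (11, 3)] 156 [(0, 28), (2, 38), (10, 27), (16, 18), (20, 72)] (.child
  (.branch 8 1 [(0, -1), (4, 1)] 858 [(0, 12), (13, 15), (18, 7), (22, 10), (28, 2)] (.done [(0,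
  2), (4, 2), (12, 3), (22, 3)])) (.done [(0, 1), (18, 390), (26, 1)]))) (.done [(0, 2), (17,
  156), (18, 1), (24, 1)]))) (.done [(0, 2), (6, 2), (7, 1), (14, 936), (16, 6)]))) (.done [(0,
  2), (12, 624), (14, 2), (19, 1)]))) (.done [(0, 2), (2, 4), (3, 2), (10, 468), (12, 3)])))
  (.done [(0, 6), (1, 3), (6, 3), (10, 4), (12, 4)])))

def contradictionTree10 : ContradictionTree :=
  .branch 32 3 [(1, -1), (11, -1), (13, 1), (14, -1), (17, 2), (18, 2), (19, 2)] (-468) [(0, 186),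
  (9, 56), (28, 185), (34, 28392), (41, 140)] (.child (.branch 30 1 [(0, 1), (12, -1), (14, -1),
  (15, 1), (20, -1)] 0 [(0, 78), (12, 72), (33, 5), (44, 5)] (.child (.branch 35 1 [(1, -1), (3,
  -1), (10, -1), (12, -1), (13, -1), (18, -2), (19, 1), (20, -1), (21, 2)] 468 [(0, 20), (3, 8),
  (39, 4212), (40, 9)] (.child (.branch 18 3 [(2, 1), (4, -1), (14, -1), (16, 1), (17, -1), (19,
  8), (20, -2), (21, 1), (22, -6)] 0 [(0, 183), (5, 140), (19, 168), (42, 36), (47, 91)] (.child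
  (.branch 45 1 [(0, -1), (3, -1), (5, -1), (9, -1), (12, -1), (13, -1), (15, -1), (17, 1), (18,
  1), (20, 1), (21, -2), (22, -2), (23, 1)] 117 [(0, 15), (5, 11), (42, 3042), (43, 1521)] (.child
  (.branch 19 3 [(4, -1), (6, -1), (16, -1), (18, 1), (19, -1), (21, 2), (22, 4), (23, 5), (24,
  -2)] (-624) [(0, 468), (1, 99), (18, 281), (23, 243), (51, 284)] (.child (.branch 20 1 [(0, 1),
  (2, -1)] (-156) [(0, 69), (9, 16), (40, 81), (46, 7488), (53, 40)] (.done [(0, 45), (11, 42),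
  (15, 8), (30, 4), (46, 2808)])) (.child (.branch 73 1 [(0, -1), (2, -1), (22, 1), (23, 1), (24,
  1), (25, -1)] 468 [(0, 6), (9, 4), (11, 2), (44, 3)] (.child (.branch 54 3 [(8, -1), (18, -1),
  (20, -1), (21, -1), (23, -4), (24, 6), (25, 2), (26, 2)] (-312) [(0, 138), (11, 18), (42, 163),
  (48, 8424), (55, 45)] (.child (.branch 78 3 [(10, 2), (14, 1), (23, 2)] 676 [(0, 9), (13, 8),
  (15, 4), (22, 4)] (.child (.branch 59 1 [(0, 1), (1, 1), (10, -1), (17, -1), (20, -1), (25, 4),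
  (26, -2), (28, -3)] 442 [(0, 1134), (5, 972), (14, 203), (17, 448), (31, 27)] (.done [(0, 15),
  (15, 14), (52, 1508), (53, 754)])) (.child (.branch 56 1 [(0, -1), (1, 1), (10, -1), (23, 1),
  (25, -1), (26, -3), (27, -4), (28, 2)] 1196 [(0, 3861), (15, 1321), (17, 809), (24, 1664), (36,
  2112)] (.done [(0, 648), (5, 297), (26, 700), (52, 99684), (59, 46)])) (.done [(0, 21), (3, 9),
  (29, 16)])))) (.child (.branch 78 3 [(10, 2), (14, 1), (23, 2)] 676 [(0, 9), (13, 8), (15, 4),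
  (22, 4)] (.child (.branch 57 1 [(0, -1), (1, 1), (10, -1), (19, -1), (20, -1), (22, 1), (23,
  -1), (25, 2), (26, -3), (27, -4), (28, 2)] 962 [(0, 720), (15, 614), (17, 643), (20, 145), (53,
  36192)] (.child (.branch 9 13 [(23, -1), (26, -8), (27, 3), (28, -5), (29, 19)] 36 [(0, 1313),
  (2, 1566), (6, 1092), (54, 211536), (61, 1230)] (.child (.branch 66 1 [(0, -2), (19, -1), (24,
  -1), (25, -1), (27, -1), (28, 1), (30, 3)] (-306) [(0, 3562), (8, 3168), (9, 219), (56, 380484),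
  (63, 1882)] (.done [(0, 2054), (4, 4608), (9, 3399), (25, 532), (56, 81588)])) (.child (.branch
  24 1 [(0, 6), (24, -1), (25, 1), (28, 2), (29, 4), (30, -8)] (-348) [(0, 4004), (8, 3780), (9,
  2241), (35, 862), (56, 550368)] (.done [(0, 23764), (4, 15057), (13, 3186), (28, 2646), (40,
  13762)])) (.child (.branch 81 1 [(0, 1), (24, 1), (27, 3), (28, -1), (29, 1), (30, -3)] 108 [(0,
  65), (9, 12), (21, 12), (35, 54), (56, 3276)] (.done [(0, 1690), (4, 270), (19, 876), (28, 820),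
  (58, 459)])) (.child (.branch 24 1 [(0, 6), (24, -1), (25, 1), (28, 2), (29, 4), (30, -8)]
  (-384) [(0, 4004), (8, 3780), (9, 2241), (35, 862), (56, 550368)] (.done [(0, 14417), (4,
  19260), (13, 6480), (21, 1818), (25, 10670)])) (.child (.branch 67 1 [(0, 6), (21, -1), (24, 1),
  (25, -1), (27, 3), (28, -1), (29, 2), (30, -7)] 378 [(0, 4238), (8, 1008), (19, 3738), (56,
  147420), (63, 543)] (.done [(0, 1638), (9, 972), (18, 35), (21, 1120), (35, 405)])) (.child
  (.branch 24 1 [(0, 6), (24, -1), (25, 1), (28, 2), (29, 4), (30, -8)] (-420) [(0, 4004), (8,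
  3780), (9, 2241), (35, 862), (56, 550368)] (.done [(0, 53534), (4, 90594), (9, 19089), (13,
  19980), (25, 41804)])) (.child (.branch 25 1 [(0, -5), (24, -1), (25, -1), (27, -4), (28, 3),
  (29, -1), (30, 8)] (-12) [(0, 2119), (8, 1530), (19, 906), (56, 17160), (63, 635)] (.done [(0,
  559), (4, 90), (9, 240), (21, 474), (56, 58188)])) (.child (.branch 12 13 [(24, 1), (25, -1),
  (27, 16), (28, -20), (29, -15), (30, -6)] 852 [(0, 1027), (4, 2439), (9, 1719), (25, 634), (56,
  62946)] (.child (.branch 27 1 [(0, 5), (25, 1), (26, -1), (28, -2), (29, 7), (30, 7)] (-108)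
  [(0, 1339), (6, 324), (11, 1116), (32, 1328), (58, 290628)] (.done [(0, 27547), (6, 17874), (21,
  1014), (27, 9162), (30, 19672)])) (.child (.branch 21 1 [(0, 5), (25, -1), (26, -1), (28, -5),
  (29, 8), (30, 5), (31, 2)] 1008 [(0, 2457), (6, 1944), (20, 52), (23, 584), (59, 113724)] (.done
  [(0, 1781), (10, 552), (11, 801), (58, 70668), (65, 1152)])) (.child (.branch 27 1 [(0, 5), (25,
  1), (26, -1), (28, -2), (29, 7), (30, 7)] (-216) [(0, 1001), (10, 252), (11, 123), (37, 914),
  (58, 5460)] (.done [(0, 14313), (6, 15978), (10, 1284), (27, 12908), (60, 9054)])) (.child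
  (.branch 29 1 [(0, 2), (25, 1), (26, -1), (28, -1), (29, 2), (30, 2), (31, 1)] 360 [(0, 611),
  (10, 216), (21, 360), (30, 40), (60, 285)] (.done [(0, 1339), (6, 1836), (11, 2307), (32, 384),
  (58, 393588)])) (.child (.branch 21 1 [(0, 5), (25, -1), (26, -1), (28, -5), (29, 8), (30, 5),
  (31, 2)] 1080 [(0, 2808), (6, 2430), (20, 485), (23, 400), (37, 243)] (.done [(0, 1781), (10,
  552), (11, 801), (58, 70668), (65, 1152)])) (.child (.branch 27 1 [(0, 5), (25, 1), (26, -1),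
  (28, -2), (29, 7), (30, 7)] (-144) [(0, 91), (11, 36), (32, 56), (37, 36), (58, 9828)] (.done
  [(0, 60333), (4, 2197), (6, 39144), (27, 19256), (30, 44184)])) (.child (.branch 21 1 [(0, 5),
  (25, -1), (26, -1), (28, -5), (29, 8), (30, 5), (31, 2)] 972 [(0, 2457), (6, 1944), (20, 52),
  (23, 584), (59, 113724)] (.done [(0, 1781), (10, 552), (11, 801), (58, 70668), (65, 1152)]))
  (.child (.branch 13 1 [(0, 4), (25, 1), (26, -1), (29, 4), (30, 5), (31, -1)] 516 [(0, 364),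
  (11, 171), (23, 252), (37, 122), (58, 26208)] (.done [(0, 34554), (4, 31421), (6, 3618), (10,
  8556), (60, 21144)])) (.done [(0, 1781), (8, 1998), (9, 402), (56, 216528), (63, 298)]))))))))))
  (.done [(0, 5382), (2, 6237), (7, 8742), (11, 642), (16, 415)])))))))))) (.done [(0, 2067), (4,
  216), (5, 936), (33, 590), (59, 852)]))) (.child (.branch 55 1 [(0, -1), (1, -1), (20, -1), (22,
  1), (23, 1), (25, -3), (26, -1), (27, -2), (28, 4)] 260 [(0, 126), (11, 99), (54, 50)] (.child
  (.branch 52 13 [(9, 1), (11, -1), (21, -1), (23, 1), (24, -1), (26, 24), (27, -7), (28, 4), (29,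
  -20)] 144 [(0, 112112), (1, 91935), (11, 16992), (19, 33418), (23, 14553)] (.child (.branch 71 1
  [(0, 2), (10, 1), (12, -1), (22, -1), (24, 1), (25, -1), (29, -1), (30, 2)] (-180) [(0, 1859),
  (3, 192), (8, 1788), (56, 137904), (63, 935)] (.done [(0, 845), (19, 194), (21, 856), (40, 100),
  (56, 8112)])) (.child (.branch 51 1 [(0, 4), (10, 1), (12, -1), (22, -1), (24, 1), (25, -1),
  (27, -1), (28, -2), (29, -4), (30, 4)] 1188 [(0, 845), (19, 28), (21, 472), (40, 450), (56,
  36504)] (.done [(0, 5343), (8, 6264), (9, 1227), (56, 578916), (63, 16)])) (.child (.branch 42 1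
  [(0, -3), (24, -1), (25, 1), (27, 2), (30, -3)] 912 [(0, 624), (18, 304), (19, 270), (21, 359),
  (24, 285)] (.done [(0, 4485), (8, 288), (9, 1167), (58, 203), (63, 3788)])) (.child (.branch 44
  1 [(0, -1), (10, 1), (12, -1), (22, -1), (27, 3), (28, -1), (30, -3)] 372 [(0, 1573), (9, 594),
  (13, 936), (25, 176), (58, 133)] (.done [(0, 520), (19, 334), (21, 71), (24, 285), (56,
  23712)])) (.child (.branch 51 1 [(0, 4), (10, 1), (12, -1), (22, -1), (24, 1), (25, -1), (27,
  -1), (28, -2), (29, -4), (30, 4)] 1152 [(0, 845), (19, 28), (21, 472), (40, 450), (56, 36504)]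
  (.done [(0, 5343), (8, 6264), (9, 1227), (56, 578916), (63, 16)])) (.child (.branch 44 1 [(0,
  -1), (10, 1), (12, -1), (22, -1), (27, 3), (28, -1), (30, -3)] 300 [(0, 1573), (9, 594), (13,
  936), (25, 176), (58, 133)] (.done [(0, 520), (19, 334), (21, 71), (24, 285), (56, 23712)]))
  (.child (.branch 71 1 [(0, 2), (10, 1), (12, -1), (22, -1), (24, 1), (25, -1), (29, -1), (30,
  2)] (-216) [(0, 1859), (3, 192), (8, 1788), (56, 137904), (63, 935)] (.done [(0, 845), (19,
  194), (21, 856), (40, 100), (56, 8112)])) (.child (.branch 42 1 [(0, -3), (24, -1), (25, 1),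
  (27, 2), (30, -3)] 840 [(0, 624), (18, 304), (19, 270), (21, 359), (24, 285)] (.done [(0, 4485),
  (8, 288), (9, 1167), (58, 203), (63, 3788)])) (.done [(0, 9360), (6, 2790), (17, 7041), (23,
  645), (56, 3544)])))))))))) (.done [(0, 2520), (5, 519), (17, 924), (31, 1618), (52, 279552)])))
  (.done [(0, 21), (3, 9), (29, 16)])))) (.done [(0, 819), (5, 192), (13, 319), (32, 352), (48,
  129792)])))) (.done [(0, 1671), (3, 1332), (27, 720), (46, 104364), (53, 214)]))) (.done [(0,
  429), (7, 306), (9, 274), (16, 104), (28, 132)])))) (.done [(0, 1500), (7, 1144), (23, 1056),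
  (44, 1019), (49, 110)]))) (.child (.branch 45 1 [(0, -1), (3, -1), (5, -1), (9, -1), (12, -1),
  (13, -1), (15, -1), (17, 1), (18, 1), (20, 1), (21, -2), (22, -2), (23, 1)] 429 [(0, 15), (5,
  11), (42, 3042), (43, 1521)] (.child (.branch 19 3 [(4, -1), (6, -1), (16, -1), (18, 1), (19,
  -1), (21, 2), (22, 4), (23, 5), (24, -2)] (-624) [(0, 972), (18, 290), (23, 261), (25, 594),
  (51, 116)] (.child (.branch 47 1 [(0, -1), (2, 1), (5, -1), (7, -1), (11, -1), (14, -1), (16,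
  -1), (17, -1), (19, -1), (22, -3), (23, 2), (24, -1), (25, 2)] 780 [(0, 18), (8, 13), (11, 8)]
  (.done [(0, 18), (4, 9), (20, 1), (53, 16)])) (.child (.branch 20 1 [(0, 1), (2, -1)] (-156)
  [(0, 765), (4, 288), (20, 32), (40, 729), (53, 512)] (.done [(0, 939), (4, 72), (11, 982), (15,
  264), (46, 43992)])) (.done [(0, 726), (2, 636), (9, 572), (16, 528), (46, 123)])))) (.done [(0,
  16), (2, 1), (39, 9), (50, 9)]))) (.done [(0, 15), (3, 14), (42, 6)])))) (.done [(0, 20), (1,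
  4), (7, 6), (38, 2808), (45, 7)]))) (.done [(0, 1), (11, 1), (36, 26), (37, 13)]))) (.child
  (.branch 33 1 [(0, -1), (2, -1), (9, -1), (12, -1), (14, -1), (15, 1), (17, -2), (18, 1), (19,
  -1), (20, 3)] 78 [(0, 5), (11, 2), (36, 1456), (37, 728)] (.child (.branch 31 1 [(1, -1), (3,
  -1), (15, -1), (16, 1), (18, -4), (19, 4), (20, 2), (21, 1)] (-624) [(0, 448), (1, 20), (7, 30),
  (19, 432), (45, 5)] (.child (.branch 19 3 [(2, -1), (4, -1), (14, -1), (16, 1), (17, -1), (19,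
  2), (20, 4), (21, 5), (22, -2)] (-676) [(0, 972), (14, 290), (19, 261), (21, 594), (47, 116)]
  (.child (.branch 46 1 [(0, -1), (3, 1), (5, -1), (12, -1), (13, -1), (15, -1), (17, -1), (18,
  1), (20, -2), (21, 1), (22, -2), (23, 1)] 481 [(0, 15), (3, 11), (42, 1521), (43, 3042)] (.child
  (.branch 45 3 [(4, -1), (6, -1), (10, -1), (14, -1), (16, -1), (19, -1), (22, 1), (23, -2), (24,
  4)] 221 [(0, 384), (5, 358), (38, 513), (44, 152568), (51, 191)] (.child (.branch 74 1 [(0, -1),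
  (2, 1), (11, -1), (14, -1), (15, -1), (20, -1), (22, 2), (23, -4), (24, -5), (25, 1)] 1092 [(0,
  45), (7, 24), (24, 24), (47, 4680), (48, 1)] (.done [(0, 9), (20, 4), (53, 10)])) (.child
  (.branch 72 1 [(0, -1), (2, 1), (5, 1), (7, -1), (11, -1), (14, -1), (15, -1), (17, -1), (19,
  1), (20, 1), (22, 1), (23, -5), (24, -6), (25, 3)] 156 [(0, 1536), (2, 1035), (21, 393), (40,
  384), (53, 832)] (.child (.branch 54 3 [(8, -1), (18, -1), (20, -1), (21, -1), (23, -4), (24,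
  6), (25, 2), (26, 2)] (-312) [(0, 78), (2, 18), (22, 8), (42, 71), (55, 20)] (.child (.branch 57
  3 [(18, -1), (22, 1), (24, -3), (25, -1), (26, -5), (27, 4)] 806 [(0, 207), (11, 228), (24, 58),
  (29, 29), (50, 4524)] (.child (.branch 55 1 [(0, 1), (1, 1), (19, -1), (20, -1), (22, -1), (23,
  -1), (25, -1), (26, 1), (27, 1), (28, 1)] 572 [(0, 2790), (6, 1584), (11, 1287), (46, 891), (54,
  1786)] (.child (.branch 78 1 [(1, -1), (2, 1), (11, -1), (20, -1), (21, -1), (23, 1), (24, -1),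
  (26, 2), (27, -3), (28, -4), (29, 2)] 676 [(0, 1188), (2, 864), (13, 321), (15, 334), (54,
  75816)] (.child (.branch 59 1 [(1, 2), (15, 2), (25, 1)] (-26) [(0, 2739), (1, 1536), (13, 432),
  (19, 1503), (34, 1136)] (.child (.branch 27 13 [(28, 6), (29, 15), (30, 16), (31, -12)] (-540)
  [(0, 338), (1, 81), (3, 294), (32, 82), (37, 46)] (.child (.branch 12 1 [(0, -5), (26, 1), (27,
  -1), (29, 6), (30, 3), (31, 5), (32, -6)] 1140 [(0, 2522), (19, 675), (38, 1794), (44, 365),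
  (60, 79326)] (.done [(0, 1521), (14, 324), (34, 976), (54, 459), (67, 1114)])) (.child (.branch
  28 1 [(0, 4), (29, -3), (30, -3), (31, -4), (32, 4)] (-144) [(0, 507), (14, 63), (34, 340), (54,
  216), (67, 226)] (.done [(0, 65), (29, 4), (38, 24), (44, 42), (60, 2964)])) (.child (.branch 12
  1 [(0, -5), (26, 1), (27, -1), (29, 6), (30, 3), (31, 5), (32, -6)] 1248 [(0, 9763), (19, 3375),
  (29, 730), (38, 7656), (60, 345384)] (.done [(0, 1521), (14, 324), (34, 976), (54, 459), (67,
  1114)])) (.child (.branch 21 1 [(0, 1), (26, 1), (29, 1), (30, -3), (31, -3), (32, 1)] 972 [(0,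
  65), (21, 48), (38, 16), (60, 2184), (61, 8580)] (.done [(0, 24921), (5, 2322), (17, 11664),
  (34, 6668), (67, 15098)])) (.child (.branch 21 1 [(0, 1), (26, 1), (29, 1), (30, -3), (31, -3),
  (32, 1)] 1008 [(0, 65), (21, 48), (38, 16), (60, 2184), (61, 8580)] (.done [(0, 24921), (5,
  2322), (17, 11664), (34, 6668), (67, 15098)])) (.child (.branch 12 1 [(0, -5), (26, 1), (27,
  -1), (29, 6), (30, 3), (31, 5), (32, -6)] 1176 [(0, 9763), (19, 3375), (29, 730), (38, 7656),
  (60, 345384)] (.done [(0, 1521), (14, 324), (34, 976), (54, 459), (67, 1114)])) (.child (.branch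
  21 1 [(0, 1), (26, 1), (29, 1), (30, -3), (31, -3), (32, 1)] 1080 [(0, 7982), (21, 7560), (34,
  3060), (38, 2050), (39, 1317)] (.done [(0, 3328), (17, 891), (41, 1113), (54, 320), (67,
  1728)])) (.child (.branch 29 1 [(0, 3), (29, -3), (30, -3), (31, -4), (32, 4)] 540 [(0, 135),
  (2, 54), (3, 10), (8, 164)] (.done [(0, 17173), (5, 9561), (17, 504), (38, 9696), (60,
  2293356)])) (.done [(0, 5746), (6, 1917), (17, 4335), (21, 616), (27, 1275)])))))))))) (.done
  [(0, 120), (10, 105), (17, 56), (56, 2236), (57, 6032)]))) (.done [(0, 930), (11, 252), (17,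
  192), (32, 54), (33, 913)]))) (.done [(0, 120), (28, 36), (30, 26), (31, 65), (52, 12168)])))
  (.child (.branch 55 1 [(0, 1), (1, 1), (19, -1), (20, -1), (22, -1), (23, -1), (25, -1), (26,
  1), (27, 1), (28, 1)] 728 [(0, 2790), (6, 1584), (11, 1287), (46, 891), (54, 1786)] (.done [(0,
  5448), (9, 972), (30, 2354), (31, 4103), (52, 444600)])) (.done [(0, 48), (7, 27), (31, 25)]))))
  (.child (.branch 57 3 [(18, -1), (22, 1), (24, -3), (25, -1), (26, -5), (27, 4)] 806 [(0, 207),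
  (11, 228), (24, 58), (29, 29), (50, 4524)] (.child (.branch 55 1 [(0, 1), (1, 1), (19, -1), (20,
  -1), (22, -1), (23, -1), (25, -1), (26, 1), (27, 1), (28, 1)] 728 [(0, 12546), (4, 5346), (6,
  4950), (11, 7029), (54, 7100)] (.done [(0, 5448), (9, 972), (30, 2354), (31, 4103), (52,
  444600)])) (.child (.branch 78 1 [(0, -1), (1, 1), (10, -1), (19, -1), (20, -1), (22, 1), (23,
  -1), (25, 2), (26, -3), (27, -4), (28, 2)] 676 [(0, 1929), (11, 990), (24, 524), (27, 924), (53,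
  49764)] (.child (.branch 27 13 [(26, 6), (27, 15), (28, 16), (29, -12)] (-540) [(0, 1352), (1,
  339), (6, 324), (33, 994), (61, 20)] (.child (.branch 12 1 [(0, -5), (24, 1), (25, -1), (27, 6),
  (28, 3), (29, 5), (30, -6)] 1140 [(0, 2522), (15, 675), (34, 1794), (40, 365), (56, 79326)]
  (.done [(0, 9347), (8, 7578), (10, 1116), (35, 2524), (63, 3630)])) (.child (.branch 28 1 [(0,
  4), (27, -3), (28, -3), (29, -4), (30, 4)] (-144) [(0, 1014), (3, 3), (8, 972), (35, 278), (63,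
  60)] (.done [(0, 65), (25, 4), (34, 24), (40, 42), (56, 2964)])) (.child (.branch 12 1 [(0, -5),
  (24, 1), (25, -1), (27, 6), (28, 3), (29, 5), (30, -6)] 1248 [(0, 9763), (15, 3375), (25, 730),
  (34, 7656), (56, 345384)] (.done [(0, 2353), (3, 402), (8, 2358), (56, 159120), (63, 738)]))
  (.child (.branch 21 1 [(0, 1), (24, 1), (27, 1), (28, -3), (29, -3), (30, 1)] 972 [(0, 1885),
  (6, 1260), (17, 216), (34, 464), (57, 122148)] (.done [(0, 94939), (3, 21501), (8, 20004), (13,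
  36828), (63, 50418)])) (.child (.branch 21 1 [(0, 1), (24, 1), (27, 1), (28, -3), (29, -3), (30,
  1)] 1008 [(0, 1885), (6, 1260), (17, 216), (34, 464), (57, 122148)] (.done [(0, 94939), (3,
  21501), (8, 20004), (13, 36828), (63, 50418)])) (.child (.branch 12 1 [(0, -5), (24, 1), (25,
  -1), (27, 6), (28, 3), (29, 5), (30, -6)] 1176 [(0, 9763), (15, 3375), (25, 730), (34, 7656),
  (56, 345384)] (.done [(0, 9347), (8, 7578), (10, 1116), (35, 2524), (63, 3630)])) (.child
  (.branch 21 1 [(0, 1), (24, 1), (27, 1), (28, -3), (29, -3), (30, 1)] 1080 [(0, 91), (6, 72),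
  (34, 24), (50, 4), (57, 4212)] (.done [(0, 94939), (3, 21501), (8, 20004), (13, 36828), (63,
  50418)])) (.child (.branch 28 1 [(0, 4), (27, -3), (28, -3), (29, -4), (30, 4)] (-216) [(0,
  1476), (2, 431), (8, 1296), (10, 45), (63, 40)] (.done [(0, 9763), (15, 3402), (25, 3860), (34,
  6780), (56, 616200)])) (.done [(0, 5057), (8, 1023), (13, 4248), (23, 768), (56,
  1908)])))))))))) (.done [(0, 930), (9, 252), (15, 192), (30, 54), (31, 913)]))) (.done [(0, 48),
  (7, 27), (31, 25)])))) (.done [(0, 90), (17, 26), (26, 66), (32, 13), (48, 9126)])))) (.done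
  [(0, 39), (22, 12), (24, 12), (54, 22)]))) (.done [(0, 465), (1, 81), (7, 416), (22, 117), (23,
  144)])))) (.done [(0, 21), (5, 8), (11, 12), (23, 9), (49, 2)]))) (.child (.branch 46 1 [(0,
  -1), (3, 1), (5, -1), (12, -1), (13, -1), (15, -1), (17, -1), (18, 1), (20, -2), (21, 1), (22,
  -2), (23, 1)] 793 [(0, 15), (3, 11), (42, 1521), (43, 3042)] (.done [(0, 96), (5, 52), (11, 18),
  (21, 24), (49, 67)])) (.done [(0, 975), (1, 982), (9, 360), (18, 72), (42, 198)])))) (.done [(0,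
  99), (6, 5), (13, 97), (16, 98), (39, 1287)]))) (.done [(0, 714), (5, 156), (17, 96), (38, 409),
  (44, 396)]))) (.done [(0, 54), (12, 56), (28, 5)])))

def contradictionTree11 : ContradictionTree :=
  .branch 77 1 [(0, 1), (2, -1)] 39 [(0, 1), (2, 1), (5, 1)] (.child (.branch 90 1 [(1, -1), (4,
  -1), (5, -1), (6, -1), (9, 1), (10, 1), (12, -2), (13, -1), (14, -2), (15, 1)] (-117) [(0, 2),
  (27, 702), (33, 1)] (.child (.branch 92 1 [(0, -1), (6, 1)] 702 [(0, 20), (3, 6), (12, 9), (30,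
  16), (35, 4)] (.child (.branch 50 2 [(1, 2), (6, 1), (16, -1)] 156 [(0, 5), (5, 1), (8, 2), (31,
  1287)] (.child (.branch 49 1 [(0, 1), (10, 1)] 312 [(0, 2), (30, 1), (32, 312), (33, 312)]
  (.child (contradictionTree10) (.done [(0, 4), (1, 2), (29, 1), (34, 2), (40, 1)]))) (.child
  (.branch 49 1 [(0, 1), (10, 1)] 78 [(0, 2), (30, 1), (32, 312), (33, 312)] (.child (.branch 32 3
  [(1, -1), (11, -1), (13, 1), (14, -1), (17, 2), (18, 2), (19, 2)] (-390) [(0, 186), (9, 56),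
  (28, 185), (34, 28392), (41, 140)] (.child (.branch 33 1 [(0, -1), (2, -1), (9, -1), (12, -1),
  (14, -1), (15, 1), (17, -2), (18, 1), (19, -1), (20, 3)] 390 [(0, 5), (11, 2), (36, 1456), (37,
  728)] (.done [(0, 351), (3, 324), (10, 54), (14, 140), (30, 134)])) (.child (.branch 30 1 [(0,
  1), (12, -1), (14, -1), (15, 1), (20, -1)] 234 [(0, 702), (3, 482), (14, 324), (15, 614), (44,
  45)] (.child (.branch 35 1 [(1, -1), (3, -1), (10, -1), (12, -1), (13, -1), (18, -2), (19, 1),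
  (20, -1), (21, 2)] 468 [(0, 15), (16, 6), (39, 3276), (40, 7)] (.child (.branch 18 3 [(2, 1),
  (4, -1), (14, -1), (16, 1), (17, -1), (19, 8), (20, -2), (21, 1), (22, -6)] 0 [(0, 15), (4, 14),
  (40, 1872), (41, 936)] (.child (.branch 45 1 [(0, -1), (3, -1), (5, -1), (9, -1), (12, -1), (13,
  -1), (15, -1), (17, 1), (18, 1), (20, 1), (21, -2), (22, -2), (23, 1)] 117 [(0, 15), (17, 11),
  (42, 3328), (43, 1664)] (.child (.branch 54 3 [(6, -1), (16, -1), (18, -1), (19, -1), (21, -4),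
  (22, 6), (23, 2), (24, 2)] (-390) [(0, 21), (10, 9), (38, 16)] (.child (.branch 58 1 [(0, 2),
  (11, 2), (19, -1)] 624 [(0, 21), (8, 9), (24, 16)] (.child (.branch 47 3 [(6, -1), (8, -1), (12,
  -1), (18, -1), (21, -1), (23, 2), (25, -2), (26, -2)] 468 [(0, 21), (10, 16), (26, 9)] (.child
  (.branch 73 1 [(0, 1), (4, 1), (13, -1), (21, -1), (24, -2), (26, -2), (27, 3)] 468 [(0, 39),
  (25, 12), (32, 12), (48, 22)] (.child (.branch 74 1 [(1, -1), (5, -1), (8, 1), (10, -1), (14,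
  -1), (17, -1), (19, -1), (20, -1), (22, -1), (25, 2), (26, -2), (27, -4), (28, -2)] 936 [(0,
  27), (22, 28), (36, 22)] (.child (.branch 55 3 [(11, -1), (23, -1), (26, -6), (27, 2), (28, -2),
  (29, 4)] 338 [(0, 126), (13, 99), (56, 50)] (.child (.branch 78 1 [(0, -1), (5, -1), (22, -1),
  (24, 1), (25, 1), (27, -3), (28, -1), (29, -2), (30, 4)] 988 [(0, 1638), (4, 363), (15, 1386),
  (28, 56), (40, 594)] (.done [(0, 21), (5, 9), (35, 16)])) (.child (.branch 78 1 [(0, -1), (5,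
  -1), (22, -1), (24, 1), (25, 1), (27, -3), (28, -1), (29, -2), (30, 4)] 832 [(0, 2100), (2,
  126), (4, 450), (15, 1701), (40, 800)] (.child (.branch 59 1 [(1, 2), (16, 2), (26, 1)] 286 [(0,
  351), (15, 174), (22, 200)] (.child (.branch 79 1 [(2, 1), (7, 1), (24, -1), (26, -1), (29, 3),
  (30, -2), (31, -1), (32, -1)] 884 [(0, 21), (8, 9), (44, 16)] (.child (.branch 43 13 [(27, 1),
  (28, -1), (30, 5), (31, -3), (32, -4), (33, -13)] 384 [(0, 130), (4, 6), (19, 36), (24, 75),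
  (40, 50)] (.child (.branch 42 1 [(0, 4), (28, 1), (29, -1), (31, 2), (32, -1), (34, 3)] 912 [(0,
  33), (1, 11), (12, 27), (34, 16)] (.done [(0, 1001), (3, 99), (13, 189), (31, 112), (71, 792)]))
  (.child (.branch 69 1 [(0, 5), (28, 1), (29, -1), (31, 3), (32, -1), (33, 2), (34, 2)] 540 [(0,
  1820), (26, 165), (28, 1512), (42, 438), (64, 78624)] (.done [(0, 2639), (23, 189), (30, 696),
  (39, 2016), (58, 87)])) (.child (.branch 51 1 [(0, -1), (14, -1), (16, -1), (26, -1), (28, -1),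
  (29, 1), (31, -2), (32, 1), (33, -1), (34, 1)] 792 [(0, 1365), (12, 87), (42, 672), (48, 724),
  (64, 50232)] (.child (.branch 87 1 [(1, -6), (24, -1), (29, 1), (30, -1), (32, 4), (33, -4),
  (34, -4), (35, -5)] 306 [(0, 26), (10, 15), (41, 12), (66, 3900), (67, 3276)] (.child (.branch
  52 1 [(2, 3), (16, 1), (18, -1), (28, -1), (30, 1), (31, -1), (33, 5), (34, -2)] 432 [(0, 35),
  (1, 24), (46, 16), (68, 6812), (69, 3016)] (.child (.branch 29 13 [(34, -21), (35, 6), (36, -4),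
  (37, 16)] 36 [(0, 22100), (5, 4550), (16, 15678), (29, 3453), (64, 2400)] (.child (.branch 27 1
  [(0, -4), (35, -6), (36, 3), (38, 4)] (-144) [(0, 260), (5, 184), (7, 105), (72, 57096), (73,
  51012)] (.done [(0, 1001), (16, 567), (20, 33), (44, 336), (56, 264)])) (.child (.branch 28 1
  [(0, -3), (35, -6), (36, 3), (38, 4)] (-216) [(0, 2678), (5, 104), (7, 2223), (66, 216), (73,
  138996)] (.done [(0, 1274), (4, 273), (20, 156), (56, 1080), (72, 22932)])) (.child (.branch 21
  1 [(0, -4), (32, 1), (35, -5), (37, -3), (38, 5)] 972 [(0, 338), (20, 285), (47, 40), (70, 72),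
  (73, 3900)] (.done [(0, 13689), (5, 6682), (38, 5544), (44, 88), (79, 7370)])) (.child (.branch
  27 1 [(0, -4), (35, -6), (36, 3), (38, 4)] (-108) [(0, 182), (4, 153), (7, 126), (46, 64), (72,
  9828)] (.done [(0, 1001), (16, 567), (20, 33), (44, 336), (56, 264)])) (.child (.branch 13 1
  [(0, 2), (32, -1), (33, 1), (35, 2), (37, 1), (38, -3)] 516 [(0, 22932), (4, 17150), (5, 4620),
  (34, 785), (50, 3942)] (.done [(0, 3471), (7, 1040), (31, 3135), (38, 44), (72, 102960)]))
  (.child (.branch 21 1 [(0, -4), (32, 1), (35, -5), (37, -3), (38, 5)] 1008 [(0, 1859), (20,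
  1530), (42, 100), (47, 220), (70, 396)] (.done [(0, 117), (5, 40), (7, 33), (79, 88)])) (.child
  (.branch 12 1 [(0, -6), (32, 1), (33, -1), (35, -6), (37, -3), (38, 6)] 1140 [(0, 182), (20,
  45), (50, 84), (56, 80), (72, 3276)] (.done [(0, 117), (5, 14), (7, 85), (38, 38), (72, 1872)]))
  (.child (.branch 22 1 [(0, -3), (33, -1), (35, -3), (36, 1), (37, -1), (38, 2)] 852 [(0, 6942),
  (5, 4524), (20, 5931), (34, 480), (74, 787)] (.done [(0, 2639), (25, 1068), (31, 696), (38,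
  952), (72, 275964)])) (.done [(0, 1001), (2, 858), (18, 15), (40, 48), (70, 72072)]))))))))))
  (.done [(0, 6500), (14, 2754), (27, 2979), (34, 1600), (69, 210600)]))) (.done [(0, 754), (8,
  135), (15, 435), (30, 222), (67, 6786)]))) (.done [(0, 91), (3, 42), (30, 34), (58, 27), (65,
  1092)]))) (.child (.branch 42 1 [(0, 4), (28, 1), (29, -1), (31, 2), (32, -1), (34, 3)] 876 [(0,
  3718), (12, 2205), (34, 1204), (39, 132), (62, 924)] (.done [(0, 1001), (3, 99), (13, 189), (31,
  112), (71, 792)])) (.child (.branch 51 1 [(0, -1), (14, -1), (16, -1), (26, -1), (28, -1), (29,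
  1), (31, -2), (32, 1), (33, -1), (34, 1)] 1188 [(0, 1365), (12, 87), (42, 672), (48, 724), (64,
  50232)] (.done [(0, 91), (3, 42), (30, 34), (58, 27), (65, 1092)])) (.child (.branch 51 1 [(0,
  -1), (14, -1), (16, -1), (26, -1), (28, -1), (29, 1), (31, -2), (32, 1), (33, -1), (34, 1)] 1152
  [(0, 1365), (12, 87), (42, 672), (48, 724), (64, 50232)] (.done [(0, 1001), (3, 441), (30, 374),
  (38, 56), (58, 297)])) (.child (.branch 42 1 [(0, 4), (28, 1), (29, -1), (31, 2), (32, -1), (34,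
  3)] 840 [(0, 676), (12, 483), (39, 24), (62, 168), (65, 46956)] (.done [(0, 1001), (3, 99), (13,
  189), (31, 112), (71, 792)])) (.child (.branch 52 1 [(0, 3), (14, 1), (16, -1), (26, -1), (28,
  1), (29, -1), (31, 5), (32, -2)] 504 [(0, 71), (2, 18), (26, 16), (28, 48), (64, 15444)] (.done
  [(0, 4550), (10, 1134), (23, 2709), (30, 850), (58, 675)])) (.child (.branch 71 1 [(0, 6), (31,
  -2), (32, 2), (33, 3), (34, 6)] (-180) [(0, 182), (3, 78), (30, 105), (31, 7), (71, 15)] (.done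
  [(0, 910), (12, 309), (42, 504), (48, 218), (64, 2184)])) (.done [(0, 2639), (15, 1530), (21,
  696), (28, 196), (62, 370968)]))))))))))) (.done [(0, 126), (9, 39), (26, 84), (34, 56), (39,
  18)]))) (.done [(0, 15), (33, 14), (58, 1872), (59, 936)]))) (.done [(0, 1), (5, 1), (56, 208),
  (57, 208)]))) (.done [(0, 15), (18, 11), (54, 3328), (55, 1664)])))) (.done [(0, 127), (1, 5),
  (18, 44), (33, 36), (59, 66)]))) (.done [(0, 1521), (7, 732), (14, 446), (31, 468), (57,
  429)]))) (.child (.branch 20 1 [(0, 2), (5, -1), (7, 2)] (-156) [(0, 21), (16, 16), (44, 9)]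
  (.done [(0, 1572), (7, 174), (28, 1212), (34, 319), (50, 117624)])) (.done [(0, 666), (1, 459),
  (20, 100), (48, 70200), (55, 100)])))) (.done [(0, 864), (5, 87), (12, 644), (46, 54288), (53,
  203)]))) (.child (.branch 58 1 [(0, 2), (11, 2), (19, -1)] 936 [(0, 21), (8, 9), (24, 16)]
  (.done [(0, 513), (12, 444), (18, 58), (46, 40716), (53, 58)])) (.done [(0, 3144), (1, 702),
  (22, 1276), (28, 1287), (44, 474552)])))) (.done [(0, 60), (6, 44), (44, 39)]))) (.child
  (.branch 45 1 [(0, -1), (3, -1), (5, -1), (9, -1), (12, -1), (13, -1), (15, -1), (17, 1), (18,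
  1), (20, 1), (21, -2), (22, -2), (23, 1)] 429 [(0, 15), (17, 11), (42, 3328), (43, 1664)] (.done
  [(0, 4224), (4, 1404), (6, 2068), (9, 2574), (36, 117)])) (.done [(0, 2112), (2, 29), (12, 638),
  (15, 1716), (34, 348)])))) (.done [(0, 19), (4, 4), (10, 6), (38, 4212), (45, 6)]))) (.done [(0,
  1), (11, 1), (36, 26), (37, 13)]))) (.done [(0, 24), (12, 24), (35, 468), (36, 1)])))) (.done
  [(0, 78), (10, 24), (34, 52), (39, 59), (40, 19)]))) (.done [(0, 10), (14, 4), (37, 9)]))))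
  (.done [(0, 2), (7, 1), (28, 312), (29, 312)]))) (.done [(0, 6), (10, 3), (25, 1872), (28,
  2)]))) (.done [(0, 30), (8, 13), (12, 38), (22, 12), (24, 4680)]))

def contradictionTree12 : ContradictionTree :=
  .branch 75 1 [(0, -1), (1, -1), (6, 1), (8, -2), (9, -2), (10, -3), (11, 2)] 897 [(0, 24), (2,
  20), (16, 20), (19, 1716), (20, 13)] (.child (.branch 7 1 [(1, 1), (3, 1)] 624 [(0, 1), (4, 1),
  (8, 1)] (.child (.branch 76 2 [(2, -1), (4, -1), (8, 1), (11, -3), (12, -3)] 702 [(0, 6), (6,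
  5), (22, 1014), (23, 936), (30, 5)] (.child (.branch 77 1 [(0, 1), (2, -1)] 273 [(0, 30), (3,
  26), (8, 13), (31, 12), (32, 24)] (.child (.branch 90 1 [(1, -1), (4, -1), (5, -1), (6, -1), (9,
  1), (10, 1), (12, -2), (13, -1), (14, -2), (15, 1)] (-351) [(0, 5), (3, 1), (7, 1), (27, 1248)]
  (.child (.branch 92 1 [(0, -1), (6, 1)] 468 [(0, 18), (8, 1), (16, 4), (19, 12), (30, 6)]
  (.child (.branch 50 2 [(1, 2), (6, 1), (16, -1)] 156 [(0, 2), (14, 1), (31, 702)] (.child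
  (.branch 49 1 [(0, 1), (10, 1)] 312 [(0, 2), (30, 1), (32, 312), (33, 312)] (.child (.branch 30
  3 [(1, -1), (13, -1), (14, 1), (17, 2), (18, 2), (19, -4)] 156 [(0, 12), (10, 12), (36, 1)]
  (.child (.branch 31 1 [(0, -1), (2, -1), (12, -1), (14, 1), (15, -1), (17, 4), (19, 2), (20,
  -3)] (-156) [(0, 264), (5, 20), (12, 260), (13, 256), (38, 11)] (.done [(0, 36), (4, 16), (20,
  56), (30, 39), (34, 9)])) (.child (.branch 33 1 [(0, -1), (2, -1), (9, -1), (17, 2), (18, -1),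
  (19, -1), (20, -1)] 390 [(0, 120), (4, 34), (13, 24), (34, 43), (36, 17472)] (.done [(0, 10),
  (2, 4), (38, 9)])) (.done [(0, 732), (11, 600), (18, 390), (32, 720), (36, 407)])))) (.done [(0,
  40), (1, 20), (8, 12), (34, 33)]))) (.child (.branch 49 1 [(0, 1), (10, 1)] 78 [(0, 2), (30, 1),
  (32, 312), (33, 312)] (.child (.branch 30 3 [(1, -1), (13, -1), (14, 1), (17, 2), (18, 2), (19,
  -4)] 78 [(0, 12), (10, 12), (36, 1)] (.child (.branch 33 1 [(0, -1), (2, -1), (9, -1), (17, 2),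
  (18, -1), (19, -1), (20, -1)] 390 [(0, 10), (13, 2), (34, 5), (36, 1898), (37, 442)] (.done [(0,
  15), (12, 6), (38, 14)])) (.child (.branch 35 1 [(0, -1), (2, -1), (9, -1), (11, -1), (14, 1),
  (15, -1), (17, 2), (18, -1), (19, -1), (20, -2)] 468 [(0, 12), (6, 8), (37, 156), (38, 3), (44,
  4)] (.child (.branch 54 3 [(3, -1), (13, -1), (15, -1), (16, -1), (18, -4), (19, 6), (20, 2),
  (21, 2)] (-390) [(0, 18), (15, 8), (32, 13)] (.child (.branch 57 3 [(13, -1), (17, 1), (19, -3),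
  (20, -1), (21, -5), (22, 4)] 650 [(0, 261), (4, 111), (24, 129), (38, 240), (42, 52)] (.child
  (.branch 59 1 [(0, -1), (1, -1), (5, -1), (12, -1), (14, -1), (15, -1), (17, 1), (21, -1), (22,
  -2), (23, 1)] 442 [(0, 15), (18, 14), (44, 6)] (.done [(0, 183), (19, 140), (26, 91), (40, 168),
  (44, 36)])) (.child (.branch 55 1 [(0, 1), (1, 1), (14, -1), (15, -1), (17, -1), (18, -1), (20,
  -1), (21, 1), (22, 1), (23, 1)] 494 [(0, 732), (19, 440), (26, 286), (40, 528), (44, 819)]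
  (.child (.branch 78 1 [(1, -1), (2, 1), (6, -1), (15, -1), (16, -1), (18, 1), (19, -1), (21, 2),
  (22, -3), (23, -4), (24, 2)] 832 [(0, 281), (2, 224), (4, 14), (28, 126), (42, 90)] (.child
  (.branch 18 3 [(5, 1), (7, -1), (19, -1), (20, 1), (23, 2), (24, 1), (25, -2)] 0 [(0, 15), (22,
  14), (46, 1508), (47, 754)] (.child (.branch 45 1 [(0, -1), (6, -1), (8, -1), (12, -1), (15,
  -1), (16, -1), (20, -1), (23, 1), (25, -1), (26, -2)] 351 [(0, 14), (1, 11), (48, 4212), (49,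
  2106)] (.child (.branch 47 3 [(7, -1), (9, -1), (13, -1), (21, 1), (22, 1), (24, 2), (25, -2),
  (26, -3), (27, -4)] 546 [(0, 138), (14, 163), (26, 18), (34, 45), (50, 8424)] (.child (.branch
  72 1 [(0, -1), (2, -1), (8, -1), (10, -1), (14, -1), (17, -1), (19, -1), (23, -1), (25, 3), (26,
  -1), (27, -1), (28, -3)] 156 [(0, 1215), (4, 232), (5, 512), (29, 648), (52, 138996)] (.done
  [(0, 360), (16, 210), (28, 246), (36, 135), (54, 34)])) (.child (.branch 9 13 [(22, -1), (25,
  -8), (26, 3), (27, -5), (28, 19)] 0 [(0, 112112), (4, 91935), (10, 16992), (25, 14553), (29,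
  33418)] (.child (.branch 24 1 [(0, 6), (23, -1), (24, 1), (27, 2), (28, 4), (29, -8)] (-312)
  [(0, 416), (25, 75), (30, 290), (31, 401), (48, 80)] (.done [(0, 47996), (4, 23940), (6, 13374),
  (10, 12558), (38, 34293)])) (.child (.branch 11 1 [(0, -4), (24, 1), (26, -3), (28, -3), (29,
  6)] 948 [(0, 5343), (4, 6264), (10, 1227), (38, 16), (54, 578916)] (.done [(0, 845), (30, 28),
  (31, 472), (54, 36504), (61, 450)])) (.child (.branch 24 1 [(0, 6), (23, -1), (24, 1), (27, 2),
  (28, 4), (29, -8)] (-348) [(0, 208), (25, 15), (30, 154), (31, 221), (55, 11232)] (.done [(0,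
  47996), (4, 23940), (6, 13374), (10, 12558), (38, 34293)])) (.child (.branch 81 1 [(0, 1), (23,
  1), (26, 3), (27, -1), (28, 1), (29, -3)] 108 [(0, 520), (25, 285), (30, 334), (31, 71), (54,
  23712)] (.done [(0, 1573), (10, 594), (12, 936), (27, 176), (56, 133)])) (.child (.branch 25 1
  [(0, -5), (23, -1), (24, -1), (26, -4), (27, 3), (28, -1), (29, 8)] 60 [(0, 9009), (6, 1296),
  (12, 2484), (31, 6160), (48, 1925)] (.done [(0, 8476), (4, 4860), (30, 4086), (38, 3695), (54,
  996840)])) (.child (.branch 66 1 [(0, -2), (18, -1), (23, -1), (24, -1), (26, -1), (27, 1), (29,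
  3)] (-126) [(0, 845), (30, 194), (31, 856), (54, 8112), (61, 100)] (.done [(0, 1781), (4, 1764),
  (10, 192), (38, 721), (54, 196560)])) (.child (.branch 66 1 [(0, -2), (18, -1), (23, -1), (24,
  -1), (26, -1), (27, 1), (29, 3)] (-198) [(0, 845), (30, 194), (31, 856), (54, 8112), (61, 100)]
  (.done [(0, 1859), (4, 1788), (6, 192), (38, 935), (54, 137904)])) (.child (.branch 25 1 [(0,
  -5), (23, -1), (24, -1), (26, -4), (27, 3), (28, -1), (29, 8)] (-12) [(0, 549), (2, 24), (7,
  162), (31, 368), (48, 121)] (.done [(0, 8476), (4, 4860), (30, 4086), (38, 3695), (54,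
  996840)])) (.done [(0, 9360), (2, 2790), (25, 645), (28, 7041), (54, 3544)])))))))))) (.done
  [(0, 819), (8, 192), (27, 319), (50, 129792), (57, 352)])))) (.done [(0, 45), (24, 33), (50,
  32)]))) (.child (.branch 47 3 [(6, -1), (8, -1), (12, -1), (20, 1), (21, 1), (23, 2), (24, -2),
  (25, -3), (26, -4)] 546 [(0, 138), (12, 163), (24, 18), (32, 45), (48, 8424)] (.child (.branch
  46 1 [(0, 1), (1, -1), (7, -1), (9, -1), (13, -1), (16, -1), (17, -1), (21, -1), (24, 1), (26,
  -1), (27, -2)] 741 [(0, 648), (6, 297), (20, 700), (34, 46), (50, 99684)] (.done [(0, 3861),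
  (17, 1664), (26, 1321), (27, 809), (57, 2112)])) (.child (.branch 19 1 [(0, -1), (1, 1), (7,
  -1), (9, -1), (13, -1), (16, -1), (18, -1), (22, -1), (24, 1), (26, -1), (27, -2)] (-312) [(0,
  720), (21, 145), (26, 614), (27, 643), (51, 36192)] (.child (.branch 12 13 [(22, 1), (23, -1),
  (25, 16), (26, -20), (27, -15), (28, -6)] 780 [(0, 3562), (4, 2484), (8, 111), (36, 2444), (52,
  350064)] (.child (.branch 21 1 [(0, 5), (23, -1), (24, -1), (26, -5), (27, 8), (28, 5), (29, 2)]
  936 [(0, 3003), (6, 2520), (10, 1065), (52, 1352), (54, 234780)] (.done [(0, 5577), (1, 3211),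
  (4, 3618), (21, 1418), (27, 4068)])) (.child (.branch 14 1 [(0, 3), (23, 1), (24, -1), (27, 4),
  (28, 5), (29, -1)] (-48) [(0, 1807), (4, 1530), (27, 95), (30, 537), (54, 20670)] (.done [(0,
  1781), (6, 486), (10, 1764), (38, 91), (54, 122850)])) (.child (.branch 27 1 [(0, 5), (23, 1),
  (24, -1), (26, -2), (27, 7), (28, 7)] (-108) [(0, 143), (4, 132), (6, 48), (54, 18252), (55,
  7488)] (.done [(0, 13), (10, 9), (27, 2), (38, 3), (56, 3)])) (.child (.branch 21 1 [(0, 5),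
  (23, -1), (24, -1), (26, -5), (27, 8), (28, 5), (29, 2)] 1008 [(0, 10101), (6, 6264), (10,
  5979), (24, 5408), (54, 1690884)] (.done [(0, 13936), (4, 5751), (21, 3462), (31, 584), (61,
  8847)])) (.child (.branch 22 1 [(0, -6), (24, -1), (26, 8), (27, -9), (28, -7), (29, -4)] 852
  [(0, 36296), (6, 32886), (21, 1056), (27, 7245), (30, 9961)] (.done [(0, 169), (12, 60), (31,
  120), (54, 30420), (61, 6)])) (.child (.branch 21 1 [(0, 5), (23, -1), (24, -1), (26, -5), (27,
  8), (28, 5), (29, 2)] 900 [(0, 3003), (6, 2520), (10, 1065), (52, 1352), (54, 234780)] (.done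
  [(0, 26767), (4, 40068), (10, 1398), (12, 14988), (27, 25740)])) (.child (.branch 29 1 [(0, 2),
  (23, 1), (24, -1), (26, -1), (27, 2), (28, 2), (29, 1)] 432 [(0, 2106), (10, 225), (12, 1440),
  (31, 436), (48, 506)] (.done [(0, 9971), (4, 345), (6, 3786), (30, 5814), (54, 2221362)]))
  (.child (.branch 27 1 [(0, 5), (23, 1), (24, -1), (26, -2), (27, 7), (28, 7)] (-144) [(0, 455),
  (4, 300), (30, 112), (54, 47164), (55, 52832)] (.done [(0, 13), (10, 9), (27, 2), (38, 3), (56,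
  3)])) (.done [(0, 2054), (2, 4122), (8, 2997), (25, 92), (52, 36348)])))))))))) (.done [(0,
  13536), (2, 1638), (6, 7098), (10, 2655), (34, 6461)]))) (.done [(0, 819), (6, 192), (25, 319),
  (48, 129792), (55, 352)])))) (.done [(0, 1134), (2, 972), (23, 448), (40, 203), (44, 27)]))))
  (.done [(0, 15), (20, 8), (25, 8), (44, 1404), (45, 1404)]))) (.done [(0, 15), (18, 11), (42,
  3042), (43, 1521)]))) (.done [(0, 429), (7, 104), (16, 306), (17, 274), (47, 132)])))) (.child
  (.branch 58 1 [(0, 2), (8, 2), (16, -1)] 936 [(0, 69), (4, 81), (16, 16), (24, 40), (40, 7488)]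
  (.done [(0, 45), (13, 8), (17, 42), (40, 2808), (47, 4)])) (.done [(0, 552), (2, 162), (14,
  170), (22, 425), (38, 79560)])))) (.done [(0, 5), (13, 2), (35, 2184)]))) (.done [(0, 540), (11,
  496), (18, 648), (28, 407), (32, 351)])))) (.done [(0, 360), (5, 80), (8, 108), (34, 297), (39,
  130)]))) (.done [(0, 18), (3, 8), (37, 13)])))) (.done [(0, 2), (7, 1), (28, 312), (29, 312)])))
  (.done [(0, 10), (10, 9), (33, 4)]))) (.done [(0, 94), (1, 34), (12, 39), (15, 52), (22, 72)])))
  (.child (contradictionTree11) (.done [(0, 16), (10, 9), (16, 13), (22, 3510), (29, 9)]))))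
  (.done [(0, 49), (1, 22), (16, 37), (21, 3978), (28, 6)]))) (.done [(0, 32), (14, 13), (19,
  8112), (25, 49), (26, 18)]))

def contradictionTree13 : ContradictionTree :=
  .branch 5 1 [(2, -1), (3, 1)] 0 [(0, 1), (8, 1), (11, 1)] (.child (.branch 15 3 [(1, 4), (3, 1),
  (4, -2)] 0 [(0, 3), (1, 2), (4, 1248), (5, 624), (10, 1)] (.child (.branch 17 3 [(2, -4), (3,
  4), (4, 1), (5, 1)] (-156) [(0, 1), (1, 2), (3, 1), (6, 624), (7, 624)] (.child (.branch 6 2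
  [(0, -1), (1, 1), (3, -6), (4, 3), (6, 3)] 78 [(0, 1), (3, 3), (5, 1), (8, 858), (9, 624)]
  (.child (.branch 48 2 [(1, 1), (2, -1), (4, 4), (5, -2)] 156 [(0, 2), (2, 1), (10, 702)] (.child
  (.branch 50 2 [(2, 1), (3, -1), (5, 2), (7, -1), (8, -1)] 156 [(0, 2), (13, 312), (18, 1)]
  (.child (.branch 49 1 [(0, 1), (1, 1)] 312 [(0, 4), (9, 3), (14, 1872), (15, 1248), (20, 1)]
  (.done [(0, 4), (7, 1), (9, 2), (11, 3)])) (.done [(0, 4), (4, 1), (7, 3), (9, 3), (12,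
  1638)]))) (.done [(0, 8), (5, 3), (7, 6), (11, 624), (16, 5)]))) (.done [(0, 1), (5, 1), (8,
  390), (14, 1)]))) (.child (.branch 16 1 [(0, 1), (1, 1)] 0 [(0, 2), (2, 1), (5, 1), (8, 624),
  (9, 624)] (.done [(0, 1), (3, 2), (5, 1), (8, 624), (14, 1)])) (.done [(0, 1), (1, 1), (3, 1),
  (6, 624), (12, 1)])))) (.child (contradictionTree2) (.child (contradictionTree6) (.done [(0, 3),
  (6, 4), (10, 1), (13, 2)]))))) (.child (.branch 15 3 [(1, 4), (3, 1), (4, -2)] (-156) [(0, 3),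
  (4, 1248), (5, 624), (11, 1), (12, 2)] (.child (.branch 17 3 [(2, -4), (3, 4), (4, 1), (5, 1)]
  (-156) [(0, 2), (1, 1), (7, 624), (13, 1)] (.child (.branch 48 2 [(0, 1), (1, -1), (3, 4), (4,
  -2)] 234 [(0, 4), (3, 3), (8, 1872), (9, 624), (15, 1)] (.child (.branch 7 2 [(1, 1), (2, -1),
  (4, 1), (5, -3), (6, -2), (7, 1)] 936 [(0, 1), (5, 3), (10, 858), (11, 234), (18, 1)] (.child
  (.branch 50 2 [(2, 1), (3, -1), (5, 2), (7, -1), (8, -1)] 234 [(0, 2), (2, 1), (12, 390), (13,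
  702), (20, 1)] (.child (.branch 49 1 [(0, 1), (2, 1)] 468 [(0, 2), (9, 3), (14, 1560), (15,
  936), (22, 1)] (.done [(0, 4), (9, 3), (14, 624), (21, 3), (22, 4)])) (.done [(0, 4), (7, 3),
  (12, 1248), (19, 3), (20, 2)]))) (.done [(0, 1), (10, 390), (11, 390), (17, 1), (18, 1)])))
  (.done [(0, 8), (3, 3), (9, 624), (15, 1), (16, 6)]))) (.child (.branch 16 1 [(0, 1), (1, 1)]
  (-156) [(0, 3), (8, 624), (9, 1248), (15, 2), (16, 1)] (.done [(0, 1), (3, 2), (8, 624), (16,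
  1)])) (.done [(0, 1), (1, 1), (6, 624), (14, 1)])))) (.child (contradictionTree8) (.child
  (.branch 17 3 [(2, -4), (3, 4), (4, 1), (5, 1)] (-312) [(0, 3), (4, 1), (7, 936), (8, 2), (13,
  2)] (.child (.branch 16 1 [(0, 1), (1, 1)] (-156) [(0, 2), (4, 1), (9, 624), (15, 1)] (.child
  (.branch 8 2 [(1, -1), (2, 1), (4, -1), (5, -2), (6, -2), (7, 1)] 936 [(0, 2), (3, 3), (8, 1),
  (11, 156), (12, 2)] (.child (.branch 50 2 [(2, 1), (3, -1), (5, 2), (7, -1), (8, -1)] 234 [(0,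
  4), (5, 3), (10, 1), (13, 1560), (14, 2)] (.child (.branch 49 2 [(3, -1), (4, 1), (6, -2), (7,
  2), (8, -1), (9, 2)] 234 [(0, 4), (6, 2), (7, 1), (12, 3)] (.child (.branch 48 1 [(0, 1), (1,
  -1)] 0 [(0, 2), (16, 312), (25, 1)] (.child (.branch 90 2 [(2, 2), (3, -1), (10, 1)] (-234) [(0,
  2), (19, 702), (25, 1)] (.child (.branch 6 2 [(6, -1), (7, 1), (9, -6), (10, 3), (12, 3)] (-234)
  [(0, 4), (18, 4), (21, 780), (22, 5), (27, 4)] (.child (.branch 75 2 [(0, -1), (7, -1), (10,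
  -3), (12, -3), (13, 3)] 975 [(0, 30), (1, 39), (20, 64), (24, 65), (29, 14)] (.child (.branch 76
  1 [(0, -1), (2, -1), (8, 1), (9, -1), (11, 3), (12, -2), (13, -2), (14, -1)] 1131 [(0, 12), (2,
  6), (3, 11), (7, 8)] (.done [(0, 24), (22, 20), (25, 6084), (26, 13), (31, 40)])) (.done [(0,
  16), (1, 4), (5, 10), (14, 13), (29, 18)]))) (.child (.branch 7 1 [(0, 1), (5, 1)] 468 [(0, 4),
  (12, 2), (20, 4), (24, 5), (29, 2)] (.child (.branch 75 2 [(1, -1), (8, -1), (11, -3), (13, -3),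
  (14, 3)] 858 [(0, 64), (7, 28), (17, 59), (22, 87), (26, 60)] (.child (.branch 91 1 [(0, -1),
  (7, -1), (10, 1), (12, -2), (13, -2), (14, -3), (15, 2)] 234 [(0, 2), (6, 1), (27, 156), (28,
  1)] (.done [(0, 160), (3, 72), (19, 135), (24, 37), (33, 10)])) (.done [(0, 30), (1, 32), (4,
  7), (26, 15), (31, 18)]))) (.done [(0, 8), (5, 4), (14, 11), (15, 7), (29, 3)]))) (.done [(0,
  4), (3, 2), (12, 3), (13, 6)])))) (.done [(0, 8), (11, 9), (16, 3), (20, 6), (25, 2)]))) (.done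
  [(0, 2), (17, 156), (18, 1), (24, 1)]))) (.done [(0, 12), (7, 3), (16, 8), (21, 7), (22, 5)])))
  (.done [(0, 6), (5, 3), (10, 1), (14, 2), (19, 5)]))) (.done [(0, 1), (11, 390), (17, 1)])))
  (.done [(0, 3), (1, 3), (6, 1), (10, 4), (17, 1)]))) (.child (contradictionTree9) (.child
  (.branch 16 1 [(0, 1), (1, 1)] (-312) [(0, 2), (4, 1), (9, 624), (15, 1)] (.child (.branch 48 2
  [(1, 1), (2, -1), (4, 4), (5, -2)] 156 [(0, 2), (8, 1), (10, 312), (17, 1)] (.child (.branch 6 2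
  [(2, -1), (3, 1), (5, -6), (6, 3), (8, 3)] (-156) [(0, 24), (6, 15), (10, 19), (14, 20), (19,
  14)] (.child (.branch 7 2 [(3, 1), (4, -1), (6, 1), (7, -3), (8, -2), (9, 1)] 624 [(0, 24), (5,
  15), (12, 19), (16, 20), (21, 5)] (.child (.branch 90 2 [(0, -1), (1, -1), (7, -4), (8, 3), (10,
  2)] (-234) [(0, 2), (3, 1), (10, 3), (16, 234), (17, 78)] (.child (.branch 77 1 [(0, -1), (2,
  -1), (5, 1), (9, 1), (10, 1), (11, -1)] 390 [(0, 76), (5, 160), (12, 100), (20, 51), (25, 30)]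
  (.child (.branch 92 2 [(2, -1), (6, -1), (7, 1), (9, -5), (10, -1), (11, -2), (12, 3)] 468 [(0,
  16), (11, 9), (18, 5), (22, 12), (27, 3)] (.child (.branch 75 1 [(0, -1), (2, -1), (3, -1), (4,
  -1), (7, -1), (8, -1), (10, -4), (11, 1), (12, -2), (13, 3)] 1014 [(0, 38), (9, 27), (13, 14),
  (20, 54), (24, 45)] (.child (.branch 91 1 [(1, 1), (3, 1)] 234 [(0, 106), (2, 30), (18, 84),
  (26, 47), (31, 22)] (.child (.branch 50 2 [(9, 1), (10, -1), (12, 2), (14, -1), (15, -1)] 156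
  [(0, 5), (4, 2), (8, 1), (27, 1287)] (.child (.branch 49 1 [(0, 1), (8, 1)] 312 [(0, 2), (26,
  1), (28, 312), (29, 312)] (.done [(0, 32), (1, 32), (4, 33), (6, 13), (10, 26)])) (.child
  (.branch 30 3 [(0, -1), (10, -1), (11, 1), (14, 2), (15, 2), (16, -4)] 234 [(0, 12), (10, 12),
  (30, 1)] (.child (.branch 32 1 [(0, 1), (9, -1), (11, -1), (12, 1), (14, -4), (15, 2), (17, 4)]
  (-234) [(0, 12), (24, 9), (28, 7), (37, 14)] (.done [(0, 54), (8, 56), (12, 56), (24, 5)]))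
  (.child (.branch 33 1 [(0, -1), (1, -1), (7, -1), (8, -1), (11, -1), (12, 1), (14, -4), (15, 2),
  (16, -1), (17, 2)] 312 [(0, 24), (24, 9), (28, 13), (30, 5616), (37, 2)] (.done [(0, 15), (12,
  6), (32, 14)])) (.done [(0, 78), (4, 52), (6, 36), (26, 74), (35, 69)])))) (.done [(0, 98), (8,
  8), (17, 40), (26, 5616), (33, 69)])))) (.done [(0, 2), (11, 1), (24, 312)]))) (.done [(0, 4),
  (4, 2), (23, 1014), (29, 5)]))) (.done [(0, 44), (2, 36), (14, 45), (18, 23), (20, 12636)])))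
  (.done [(0, 160), (4, 104), (12, 65), (16, 51), (27, 90)]))) (.done [(0, 4), (3, 1), (7, 3),
  (16, 546), (18, 1)]))) (.done [(0, 8), (1, 13), (8, 15), (14, 1170), (21, 3)]))) (.child
  (.branch 91 2 [(0, 1), (1, -2), (9, 1)] 117 [(0, 14), (2, 3), (8, 6), (12, 2), (16, 8)] (.child
  (.branch 8 2 [(4, -1), (5, 1), (7, -1), (8, -2), (9, -2), (10, 1)] 780 [(0, 16), (7, 15), (14,
  6), (16, 3120), (24, 11)] (.child (.branch 7 1 [(0, 1), (2, 1)] 858 [(0, 38), (6, 10), (9, 30),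
  (16, 18), (20, 15)] (.child (.branch 75 1 [(1, -1), (2, -1), (7, 1), (9, -2), (10, -2), (11,
  -3), (12, 2)] 1131 [(0, 30), (2, 26), (18, 24), (20, 5070), (28, 25)] (.child (.branch 76 2 [(2,
  -1), (4, -1), (8, 1), (11, -3), (12, -3)] 819 [(0, 4), (2, 2), (22, 1014), (30, 5)] (.child
  (.branch 92 1 [(0, -1), (5, -1), (9, -1), (12, -1), (13, -1)] 819 [(0, 20), (4, 12), (24, 936),
  (26, 19), (31, 10)] (.done [(0, 18), (4, 2), (7, 7), (20, 16), (25, 936)])) (.done [(0, 10), (2,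
  10), (5, 13), (29, 12)]))) (.done [(0, 26), (3, 22), (16, 1), (17, 21), (20, 3978)]))) (.done
  [(0, 16), (1, 8), (14, 15), (15, 3), (26, 3)]))) (.child (contradictionTree12) (.done [(0, 1),
  (17, 390), (23, 1)])))) (.done [(0, 2), (14, 702), (22, 1)]))) (.done [(0, 1), (12, 390), (20,
  1)])))) (.done [(0, 2), (11, 156), (12, 1), (18, 1)]))) (.done [(0, 3), (6, 2), (8, 1872), (10,
  8), (16, 1)]))) (.done [(0, 3), (4, 1), (6, 1872), (8, 4), (14, 2)]))))) (.done [(0, 3), (2, 2),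
  (6, 4), (11, 1)]))))) (.done [(0, 1), (9, 1), (10, 1)])))

/-- The ordering of the values at `1`, `ω²`, `ω⁴`, and the bounds for the values at
`1`, `ω`, `p`, `ω p`. -/
def initialInequalities : List Inequality :=
  [((-1, 1, 0, 0), 0, 0), ((-2, 1, 0, 0), 0, 0), ((1, -2, 0, 0), 1, 0),
    lowerBound 0 0, upperBound 0 0, lowerBound 1 0, upperBound 1 0,
    lowerBound 3 0, upperBound 3 0, lowerBound 4 0, upperBound 4 0]

def initialParts : List (ℕ × ℤ) := [(0, 0), (1, 0), (3, 0), (4, 0)]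

theorem check_contradictionTree :
    contradictionTree13.check initialInequalities initialParts 0 0 0 = true := by
  decide +kernel

def eval (a : Coord) (y : ℝ × ℝ × ℝ × ℝ) : ℝ :=
  a.1 * y.1 + a.2.1 * y.2.1 + a.2.2.1 * y.2.2.1 + a.2.2.2 * y.2.2.2

def evalInt (a n : Coord) : ℤ :=
  a.1 * n.1 + a.2.1 * n.2.1 + a.2.2.1 * n.2.2.1 + a.2.2.2 * n.2.2.2

def Inequality.Holds (ε : ℝ) (y : ℝ × ℝ × ℝ × ℝ) (q : Inequality) : Prop :=
  0 ≤ eval q.1 y + q.2.1 - q.2.2 * ε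

theorem combine_holds {ε : ℝ} {y : ℝ × ℝ × ℝ × ℝ} {ctx : List Inequality}
    (h : ∀ i, Inequality.Holds ε y (ctx.getD i ((0, 0, 0, 0), 0, 0))) (l : List (ℕ × ℕ)) :
    Inequality.Holds ε y (combine ctx l) := by
  induction l with
  | nil => simp [combine, Inequality.Holds, eval]
  | cons p l ih =>
    have hm := mul_nonneg (Nat.cast_nonneg (α := ℝ) p.2) (h p.1)
    simp only [combine, addMul, Inequality.Holds, eval] at ih hm ⊢
    push_cast
    linarith

theorem not_refutes {ε : ℝ} (hε : 1 / 5 < ε) {y : ℝ × ℝ × ℝ × ℝ} {ctx : List Inequality}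
    (h : ∀ i, Inequality.Holds ε y (ctx.getD i ((0, 0, 0, 0), 0, 0))) (l : List (ℕ × ℕ)) :
    ¬ Refutes ctx l := by
  rintro ⟨h0, hs, hk⟩
  have hc := combine_holds h l
  simp only [Inequality.Holds, h0, eval] at hc
  have hs' : (0 : ℝ) < (combine ctx l).2.2 := by exact_mod_cast hs
  have hk' : (5 : ℝ) * (combine ctx l).2.1 ≤ (combine ctx l).2.2 := by exact_mod_cast hk
  have := mul_lt_mul_of_pos_left hε hs'
  push_cast at hc
  linarith

theorem getD_cons_holds {α : Type*} {P : α → Prop} {a d : α} {l : List α} (ha : P a)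
    (hl : ∀ i, P (l.getD i d)) (i : ℕ) : P ((a :: l).getD i d) := by
  cases i with
  | zero => simpa using ha
  | succ i => simpa using hl i

/-- Real numbers `y` and integers `N j` such that `(⟨vector j, y⟩ + N j) / 468` are the fractional
parts of a linear functional with values `n` modulo `1` on the vectors, all of which lie in
`[ε, 1 - ε]`. -/
structure IsCounterexample (ε : ℝ) (y : ℝ × ℝ × ℝ × ℝ) (n : Coord) (N w : ℕ → ℤ) : Prop where
  lower : ∀ j, 468 * ε ≤ eval (vector j) y + N j
  upper : ∀ j, eval (vector j) y + N j ≤ 468 - 468 * ε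
  part_eq : ∀ j, N j = evalInt (vector j) n - 468 * w j

namespace IsCounterexample

variable {ε : ℝ} {y : ℝ × ℝ × ℝ × ℝ} {n : Coord} {N w : ℕ → ℤ}

theorem lowerBound_holds (h : IsCounterexample ε y n N w) {j : ℕ} {v : ℤ} (hv : N j ≤ v) :
    (lowerBound j v).Holds ε y := by
  have h1 := h.lower j
  have h2 : (N j : ℝ) ≤ v := by exact_mod_cast hv
  simp only [Inequality.Holds, lowerBound]
  push_cast
  linarith

theorem upperBound_holds (h : IsCounterexample ε y n N w) {j : ℕ} {v : ℤ} (hv : v ≤ N j) :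
    (upperBound j v).Holds ε y := by
  have h1 := h.upper j
  have h2 : (v : ℝ) ≤ N j := by exact_mod_cast hv
  simp only [Inequality.Holds, upperBound, eval, negate] at h1 ⊢
  push_cast
  linarith

theorem relationSum_eq (h : IsCounterexample ε y n N w) {env : List (ℕ × ℤ)}
    (henv : ∀ i, N (env.getD i (0, 0)).1 = (env.getD i (0, 0)).2) (l : List (ℕ × ℤ)) :
    ∃ z, (relationSum env l).2 = evalInt (relationSum env l).1 n - 468 * z := by
  induction l with
  | nil => exact ⟨0, by simp [relationSum, evalInt]⟩
  | cons p l ih =>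
    obtain ⟨z, hz⟩ := ih
    refine ⟨p.2 * w (env.getD p.1 (0, 0)).1 + z, ?_⟩
    have h1 := henv p.1
    rw [h.part_eq] at h1
    simp only [relationSum, hz, ← h1, evalInt]
    ring

theorem check_eq_false (hε : 1 / 5 < ε) (h : IsCounterexample ε y n N w)
    (T : ContradictionTree) : ∀ {ctx : List Inequality} {env : List (ℕ × ℤ)} {j : ℕ} {S v : ℤ},
    (∀ i, Inequality.Holds ε y (ctx.getD i ((0, 0, 0, 0), 0, 0))) →
    (∀ i, N (env.getD i (0, 0)).1 = (env.getD i (0, 0)).2) →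
    0 ≤ S → (∃ k : ℕ, N j = v + S * k) → ¬ T.check ctx env j S v = true := by
  induction T with
  | branch j t l v c r ih =>
    intro ctx env _ _ _ hctx henv _ _ hT
    simp only [ContradictionTree.check, Bool.and_eq_true, decide_eq_true_eq] at hT
    obtain ⟨⟨ht0, ht, ha, hv, hc⟩, hr⟩ := hT
    obtain ⟨z, hz⟩ := h.relationSum_eq henv l
    obtain ⟨q, hq⟩ := Int.dvd_of_emod_eq_zero hv
    have key : N j = v + 468 / t * (z - t * w j - q) := by
      apply mul_left_cancel₀ ht0.ne'
      have h1 := h.part_eq j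
      rw [← ha] at hz
      simp only [evalInt] at h1 hz
      linear_combination t * h1 - hz - hq - (z - t * w j - q) * ht
    have hS : 0 < 468 / t := pos_of_mul_pos_right (lt_of_lt_of_eq (by norm_num) ht.symm) ht0.le
    rcases lt_or_ge (z - t * w j - q) 0 with hneg | hpos
    · refine not_refutes hε (getD_cons_holds (h.lowerBound_holds ?_) hctx) c hc
      rw [key]
      nlinarith
    · lift z - t * w j - q to ℕ using hpos with k
      exact ih hctx henv hS.le ⟨k, key⟩ hr
  | child sub r ihs ihr =>
    intro ctx env j S v hctx henv hS hk hT
    simp only [ContradictionTree.check, Bool.and_eq_true] at hT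
    obtain ⟨k, hk⟩ := hk
    cases k with
    | zero =>
      have hN : N j = v := by simpa using hk
      refine ihs (getD_cons_holds (h.lowerBound_holds hN.le)
        (getD_cons_holds (h.upperBound_holds hN.ge) hctx)) 
        (getD_cons_holds (P := fun p : ℕ × ℤ ↦ N p.1 = p.2) hN henv) le_rfl ⟨0, ?_⟩ hT.1
      simpa using henv env.length
    | succ k =>
      refine ihr hctx henv hS ⟨k, ?_⟩ hT.2
      rw [hk]; push_cast; ring
  | done c =>
    intro ctx env j S v hctx henv hS hk hT
    simp only [ContradictionTree.check, decide_eq_true_eq] at hT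
    obtain ⟨k, hk⟩ := hk
    have hv : v ≤ N j := by rw [hk]; nlinarith [Int.natCast_nonneg k]
    exact not_refutes hε (getD_cons_holds (h.upperBound_holds hv) hctx) c hT

end IsCounterexample

theorem vector_mem (j : ℕ) : vector j ∈ vectors := by
  rcases lt_or_ge j vectors.length with h | h
  · rw [vector, List.getD_eq_getElem _ _ h]
    exact List.getElem_mem h
  · rw [vector, List.getD_eq_default _ _ h]
    decide +kernel

/-- The linear functional with values `z` at `1`, `ω`, `p`, `ω p` has a value at distance more
than `ε` from the integers at every vector. -/
def Avoids (ε : ℝ) (z : ℝ × ℝ × ℝ × ℝ) : Prop :=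
  ∀ a ∈ vectors, ∀ n : ℤ, ε < |eval a z / 468 - n|

theorem eval_negate (a : Coord) (z : ℝ × ℝ × ℝ × ℝ) : eval (negate a) z = -eval a z := by
  simp only [eval, negate]; push_cast; ring

namespace Avoids

variable {ε : ℝ} {z : ℝ × ℝ × ℝ × ℝ}

theorem map (h : Avoids ε z) (g : Coord → Coord) {z' : ℝ × ℝ × ℝ × ℝ}
    (hg : ∀ a ∈ vectors, g a ∈ vectors ∨ negate (g a) ∈ vectors)
    (hz : ∀ a, eval a z' = eval (g a) z) : Avoids ε z' := by
  intro a ha n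
  rw [hz]
  rcases hg a ha with h1 | h1
  · exact h _ h1 n
  · have h2 := h _ h1 (-n)
    rw [eval_negate, ← abs_neg] at h2
    convert h2 using 2
    push_cast; ring

theorem neg (h : Avoids ε z) : Avoids ε (-z.1, -z.2.1, -z.2.2.1, -z.2.2.2) :=
  h.map negate (fun a ha ↦ .inr (by simpa [negate] using ha)) fun a ↦ by
    simp only [eval, negate]; push_cast; ring

theorem rotate (h : Avoids ε z) :
    Avoids ε (z.2.1, z.2.1 - z.1, z.2.2.2, z.2.2.2 - z.2.2.1) :=
  h.map FiniteRotation.rotate (by decide +kernel) fun a ↦ by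
    simp only [eval, FiniteRotation.rotate]; push_cast; ring

theorem reflect (h : Avoids ε z) :
    Avoids ε (z.1, z.1 - z.2.1, -z.2.2.1, z.2.2.2 - z.2.2.1) :=
  h.map FiniteRotation.reflect (by decide +kernel) fun a ↦ by
    simp only [eval, FiniteRotation.reflect]; push_cast; ring

end Avoids

/-- Some functional avoiding `[-ε, ε]` modulo `1` has values `a`, `b`, `c` modulo `1` at
`1`, `ω²`, `ω⁴`, where `a`, `b`, `c` are positive with sum `1`. -/
def Attains (ε a b c : ℝ) : Prop :=
  0 < a ∧ 0 < b ∧ 0 < c ∧ a + b + c = 1 ∧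
    ∃ z, Avoids ε z ∧ (∃ m : ℤ, z.1 = a + m) ∧ ∃ n : ℤ, z.2.1 = 1 - c + n

theorem Attains.cycle {ε a b c : ℝ} : Attains ε a b c → Attains ε b c a := by
  rintro ⟨ha, hb, hc, hs, z, hz, ⟨m, hm⟩, n, hn⟩
  refine ⟨hb, hc, ha, by linarith, _, hz.rotate.rotate, ⟨n - m, ?_⟩, -m - 1, ?_⟩ <;>
  · push_cast
    linarith

theorem Attains.swap {ε a b c : ℝ} : Attains ε a b c → Attains ε a c b := by
  rintro ⟨ha, hb, hc, hs, z, hz, ⟨m, hm⟩, n, hn⟩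
  refine ⟨ha, hc, hb, by linarith, _, hz.reflect, ⟨m, hm⟩, m - n - 1, ?_⟩
  push_cast
  linarith

theorem Avoids.exists_attains {ε : ℝ} (hε : 0 < ε) {z : ℝ × ℝ × ℝ × ℝ} (h : Avoids ε z) :
    ∃ a b c, Attains ε a b c := by
  have ne (a : Coord) (ha : a ∈ vectors) (n : ℤ) : eval a z / 468 - n ≠ 0 :=
    abs_pos.mp (hε.trans (h a ha n))
  have h0 := ne (468, 0, 0, 0) (by decide +kernel) ⌊z.1⌋
  have h1 := ne (0, 468, 0, 0) (by decide +kernel) ⌊z.2.1⌋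
  have h2 := ne (-468, 468, 0, 0) (by decide +kernel) (⌊z.2.1⌋ - ⌊z.1⌋)
  simp only [eval] at h0 h1 h2
  push_cast at h0 h1 h2
  have e0 := Int.floor_add_fract z.1
  have e1 := Int.floor_add_fract z.2.1
  have p0 : 0 < Int.fract z.1 := (Int.fract_nonneg _).lt_of_ne' fun h ↦ h0 (by linarith)
  have p1 : 0 < Int.fract z.2.1 := (Int.fract_nonneg _).lt_of_ne' fun h ↦ h1 (by linarith)
  have l0 := Int.fract_lt_one z.1
  have l1 := Int.fract_lt_one z.2.1
  have hne : Int.fract z.1 ≠ Int.fract z.2.1 := fun h ↦ h2 (by linarith)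
  rcases hne.lt_or_gt with hlt | hlt
  · refine ⟨Int.fract z.1, Int.fract z.2.1 - Int.fract z.1, 1 - Int.fract z.2.1, p0,
      by linarith, by linarith, by ring, z, h, ⟨⌊z.1⌋, by linarith⟩, ⌊z.2.1⌋, by linarith⟩
  · refine ⟨1 - Int.fract z.1, Int.fract z.1 - Int.fract z.2.1, Int.fract z.2.1, by linarith,
      by linarith, p1, by ring, _, h.neg, ⟨-⌊z.1⌋ - 1, ?_⟩, -⌊z.2.1⌋ - 1, ?_⟩ <;>
    · push_cast
      linarith

theorem Avoids.exists_attains_sorted {ε : ℝ} (hε : 0 < ε) {z : ℝ × ℝ × ℝ × ℝ}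
    (h : Avoids ε z) : ∃ a b c, Attains ε a b c ∧ a ≤ b ∧ b ≤ c := by
  obtain ⟨a, b, c, h⟩ := h.exists_attains hε
  rcases le_total a b with hab | hab <;> rcases le_total b c with hbc | hbc <;>
    rcases le_total a c with hac | hac
  · exact ⟨a, b, c, h, hab, hbc⟩
  · exact ⟨a, b, c, h, hab, hbc⟩
  · exact ⟨a, c, b, h.swap, hac, hbc⟩
  · exact ⟨c, a, b, h.cycle.cycle, hac, hab⟩
  · exact ⟨b, a, c, h.swap.cycle.cycle, hab, hac⟩
  · exact ⟨b, c, a, h.cycle, hbc, hac⟩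
  · exact ⟨c, b, a, h.swap.cycle, hbc, hab⟩
  · exact ⟨c, b, a, h.swap.cycle, hbc, hab⟩

theorem not_avoids {ε : ℝ} (hε : 1 / 5 < ε) (z : ℝ × ℝ × ℝ × ℝ) : ¬ Avoids ε z := by
  intro h
  obtain ⟨a, b, c, ⟨ha, hb, hc, hs, z, h, ⟨m, hm⟩, n, hn⟩, hab, hbc⟩ :=
    h.exists_attains_sorted (by linarith)
  set y : ℝ × ℝ × ℝ × ℝ := (a, 1 - c, Int.fract z.2.2.1, Int.fract z.2.2.2) with hy
  set k : Coord := (m, n, ⌊z.2.2.1⌋, ⌊z.2.2.2⌋) with hk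
  have e2 := Int.floor_add_fract z.2.2.1
  have e3 := Int.floor_add_fract z.2.2.2
  have heval (v : Coord) : eval v z = eval v y + evalInt v k := by
    simp only [eval, evalInt, hy, hk, hm, hn]
    push_cast
    linear_combination -(v.2.2.1 : ℝ) * e2 - (v.2.2.2 : ℝ) * e3
  let w (j : ℕ) : ℤ := ⌊eval (vector j) z / 468⌋
  let N (j : ℕ) : ℤ := evalInt (vector j) k - 468 * w j
  have hN : IsCounterexample ε y k N w := by
    refine ⟨fun j ↦ ?_, fun j ↦ ?_, fun j ↦ rfl⟩
    · have h1 := h _ (vector_mem j) (w j)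
      rw [abs_of_nonneg (by linarith [Int.floor_le (eval (vector j) z / 468)])] at h1
      have h2 := heval (vector j)
      simp only [N]
      push_cast
      linarith
    · have h1 := h _ (vector_mem j) (w j + 1)
      push_cast at h1
      rw [abs_of_nonpos (by linarith [Int.lt_floor_add_one (eval (vector j) z / 468)])] at h1
      have h2 := heval (vector j)
      simp only [N]
      push_cast
      linarith
  have N0 : N 0 = 0 := by
    have h1 : vector 0 = (468, 0, 0, 0) := by decide +kernel
    have h2 : w 0 = m := by
      simp only [w, h1, eval, Int.floor_eq_iff]
      push_cast
      constructor <;> linarith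
    simp [N, h2, h1, evalInt, hk]
  have N1 : N 1 = 0 := by
    have h1 : vector 1 = (0, 468, 0, 0) := by decide +kernel
    have h2 : w 1 = n := by
      simp only [w, h1, eval, Int.floor_eq_iff]
      push_cast
      constructor <;> linarith
    simp [N, h2, h1, evalInt, hk]
  have N3 : N 3 = 0 := by
    have h1 : vector 3 = (0, 0, 468, 0) := by decide +kernel
    simp [N, w, h1, evalInt, eval, hk]
  have N4 : N 4 = 0 := by
    have h1 : vector 4 = (0, 0, 0, 468) := by decide +kernel
    simp [N, w, h1, evalInt, eval, hk]
  refine hN.check_eq_false hε _ ?_ ?_ le_rfl ⟨0, ?_⟩ check_contradictionTree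
  · have hl {j : ℕ} (hj : N j = 0) := hN.lowerBound_holds hj.le
    have hu {j : ℕ} (hj : N j = 0) := hN.upperBound_holds hj.ge
    refine getD_cons_holds ?_ <| getD_cons_holds ?_ <| getD_cons_holds ?_ <|
      getD_cons_holds (hl N0) <| getD_cons_holds (hu N0) <| getD_cons_holds (hl N1) <|
      getD_cons_holds (hu N1) <| getD_cons_holds (hl N3) <| getD_cons_holds (hu N3) <|
      getD_cons_holds (hl N4) <| getD_cons_holds (hu N4) fun i ↦ ?_ <;>
    · simp only [Inequality.Holds, eval, hy, List.getD_nil]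
      push_cast
      linarith
  · have cons {e d : ℕ × ℤ} {l : List (ℕ × ℤ)} :=
      getD_cons_holds (P := fun p : ℕ × ℤ ↦ N p.1 = p.2) (a := e) (d := d) (l := l)
    exact cons N0 <| cons N1 <| cons N3 <| cons N4 fun i ↦ by simpa using N0
  · simpa using N0

/-- The vector of the plane with given coordinates. -/
noncomputable def toPlane (a : Coord) : ℝ × ℝ :=
  ((a.1 + a.2.1 / 2 + a.2.2.1 * (√69 / 12) + a.2.2.2 * (√69 / 24 + 5 / 8)) / 468,
    (a.2.1 * (√3 / 2) - a.2.2.1 * (5 * √3 / 12) + a.2.2.2 * (√3 * √69 / 24 - 5 * √3 / 24)) / 468)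

/-- The inner products of `x` with `1`, `ω`, `p`, `ω p`. -/
noncomputable def innerProducts (x : ℝ × ℝ) : ℝ × ℝ × ℝ × ℝ :=
  (x.1, x.1 / 2 + √3 / 2 * x.2, √69 / 12 * x.1 - 5 * √3 / 12 * x.2,
    (√69 / 24 + 5 / 8) * x.1 + (√3 * √69 / 24 - 5 * √3 / 24) * x.2)

theorem dot2_toPlane (a : Coord) (x : ℝ × ℝ) :
    dot2 (toPlane a) x = eval a (innerProducts x) / 468 := by
  simp only [dot2, toPlane, eval, innerProducts]
  ring

theorem toPlane_unit {a : Coord} (ha : a ∈ vectors) :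
    (toPlane a).1 ^ 2 + (toPlane a).2 ^ 2 = 1 := by
  have key : ∀ a ∈ vectors,
      2 * (a.1 * a.2.2.1 + a.2.1 * a.2.2.2) + a.1 * a.2.2.2 + a.2.1 * a.2.2.1 = 0 ∧
      4 * (a.1 ^ 2 + a.1 * a.2.1 + a.2.1 ^ 2 + a.2.2.1 ^ 2 + a.2.2.1 * a.2.2.2 + a.2.2.2 ^ 2) +
        5 * (a.1 * a.2.2.2 - a.2.1 * a.2.2.1) = 4 * 468 ^ 2 := by
    decide +kernel
  obtain ⟨h1, h2⟩ := key a ha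
  have h1' := congrArg (Int.cast (R := ℝ)) h1
  have h2' := congrArg (Int.cast (R := ℝ)) h2
  push_cast at h1' h2'
  have h3 : √3 ^ 2 = 3 := Real.sq_sqrt (by norm_num)
  have h69 : √69 ^ 2 = 69 := Real.sq_sqrt (by norm_num)
  simp only [toPlane]
  linear_combination
    ((a.2.1 / 2 - a.2.2.1 * 5 / 12 + a.2.2.2 * (√69 - 5) / 24) ^ 2 * h3 +
      ((a.2.2.1 / 12 + a.2.2.2 / 24) ^ 2 + a.2.2.2 ^ 2 / 192) * h69 +
      √69 / 12 * h1' + h2' / 4) / 468 ^ 2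

end FiniteRotation

/-- Every `ε > 1/4` has the finite rotation property. -/
theorem frp_above_one_fifth :
    ∀ ε : ℝ, 1 / 5 < ε → HasFiniteRotationProperty ε := by
  intro ε hε
  refine ⟨92, fun j ↦ FiniteRotation.toPlane (FiniteRotation.vector j),
    fun j ↦ FiniteRotation.toPlane_unit (FiniteRotation.vector_mem j), fun x ↦ ?_⟩
  by_contra! h
  refine FiniteRotation.not_avoids hε (FiniteRotation.innerProducts x) fun a ha n ↦ ?_
  obtain ⟨j, hj, rfl⟩ := List.getElem_of_mem ha
  rw [← FiniteRotation.dot2_toPlane]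
  have hj' : j < 93 := hj
  refine (h ⟨j, hj'⟩).trans_le ?_
  rw [FiniteRotation.vector, List.getD_eq_getElem _ _ hj]
  exact round_le _ n
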